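/- Let V be a weak quantum vertex algebra which is non-degenerate. Then there exists a unique linear map S(x): V⊗V → V⊗V⊗ℂ((x)) such that Y(u,x)v = e^{xD}Y(−x)S(−x)(v⊗u) for all u,v ∈ V. Furthermore, (V, S) carries the structure of a quantum vertex algebra, and [1⊗D, S(x)] = (d/dx)S(x). -/

import Mathlib

open scoped TensorProduct BigOperators

noncomputable section

/-- Integer binomial coefficient `C(n, k)` for `n : ℤ`, `k : ℕ`. -/
def zchoose (n : ℤ) (k : ℕ) : ℤ :=
  if 0 ≤ n then ((n.toNat).choose k : ℤ)
  else (-1) ^ k * ((((k : ℤ) - n - 1).toNat).choose k)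

section Series

variable {V : Type*} [AddCommGroup V] [Module ℂ V]

/-- `a` is (the coefficient family of) an element of `V((x))`. -/
def IsLaurent (a : ℤ → V) : Prop := ∃ N : ℤ, ∀ n : ℤ, n < N → a n = 0

/-- `a` is an element of `V[[x]]`. -/
def IsPowerSeries (a : ℤ → V) : Prop := ∀ n : ℤ, n < 0 → a n = 0

/-- `A` is an element of `V((x₁, x₂))` (first index: exponent of `x₁`). -/
def IsLaurent2 (A : ℤ → ℤ → V) : Prop :=
  ∃ N : ℤ, ∀ m n : ℤ, (m < N ∨ n < N) → A m n = 0

/-- `a` is an element of `V ⊗ ℂ((x)) ⊆ V((x))`: truncated below, with coefficients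
lying in a finitely generated (i.e. finite dimensional) subspace. -/
def IsTensorLaurent (a : ℤ → V) : Prop :=
  IsLaurent a ∧ ∃ F : Submodule ℂ V, F.FG ∧ ∀ n, a n ∈ F

/-- Multiply the double series `A(x₁,x₂)` by `(x₁+x₂)^k`. -/
def mulAddPow (k : ℕ) (A : ℤ → ℤ → V) : ℤ → ℤ → V := fun a b =>
  ∑ j ∈ Finset.range (k + 1), ((k.choose j : ℕ) : ℂ) • A (a - (k : ℤ) + j) (b - j)

/-- Multiply the double series `A(x₁,x₂)` by `(x₁-x₂)^k`. -/
def mulSubPow (k : ℕ) (A : ℤ → ℤ → V) : ℤ → ℤ → V := fun a b =>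
  ∑ j ∈ Finset.range (k + 1),
    ((-1 : ℂ) ^ j * ((k.choose j : ℕ) : ℂ)) • A (a - (k : ℤ) + j) (b - j)

/-- Multiply the double series `A(x₁,x₂)` by `(x₂-x₁)^k`. -/
def mulSubPow' (k : ℕ) (A : ℤ → ℤ → V) : ℤ → ℤ → V := fun a b =>
  ∑ j ∈ Finset.range (k + 1),
    ((-1 : ℂ) ^ j * ((k.choose j : ℕ) : ℂ)) • A (a - j) (b - (k : ℤ) + j)

/-- Substitute `x₁ = x₀ + x₂` in `A(x₁,x₂)`, expanding in nonnegative powers of `x₂`.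
The result is indexed by (exponent of `x₀`, exponent of `x₂`). -/
def substAdd02 (A : ℤ → ℤ → V) : ℤ → ℤ → V := fun a b =>
  ∑ᶠ i : ℕ, ((zchoose (a + i) i : ℤ) : ℂ) • A (a + i) (b - i)

/-- Substitute `x₁ = x₂ + x₀` in `A(x₁,x₂)`, expanding in nonnegative powers of `x₀`.
The result is indexed by (exponent of `x₀`, exponent of `x₂`). -/
def substAdd20 (A : ℤ → ℤ → V) : ℤ → ℤ → V := fun a b =>
  if 0 ≤ a then ∑ᶠ m : ℤ, ((zchoose m a.toNat : ℤ) : ℂ) • A m (b - m + a) else 0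

/-- Multiply the double series `A(x₁,x₂)` by `f(x₂ - x₁)`, expanded in nonnegative
powers of `x₁`. -/
def scalarMulSub (f : ℤ → ℂ) (A : ℤ → ℤ → V) : ℤ → ℤ → V := fun m n =>
  ∑ᶠ (i : ℕ) (p : ℤ),
    ((-1 : ℂ) ^ i * ((zchoose p i : ℤ) : ℂ) * f p) • A (m - i) (n - p + i)

/-- Multiply a double series by a polynomial in two variables. -/
def polyMul2 (p : MvPolynomial (Fin 2) ℂ) (A : ℤ → ℤ → V) : ℤ → ℤ → V := fun m n =>
  ∑ d ∈ p.support, MvPolynomial.coeff d p • A (m - (d 0 : ℤ)) (n - (d 1 : ℤ))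

/-- The relation `A ∼ B`: `p·A = p·B` for some nonzero polynomial `p(x₁,x₂)`. -/
def SimEq2 (A B : ℤ → ℤ → V) : Prop :=
  ∃ p : MvPolynomial (Fin 2) ℂ, p ≠ 0 ∧ ∀ m n : ℤ, polyMul2 p A m n = polyMul2 p B m n

/-- `a` is an element of the iterated Laurent series space `V((x₁))⋯((x_n))`. -/
def IsIterLaurent : (n : ℕ) → ((Fin n → ℤ) → V) → Prop
  | 0, _ => True
  | n + 1, a =>
      (∃ N : ℤ, ∀ k : Fin (n + 1) → ℤ, k (Fin.last n) < N → a k = 0) ∧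
      ∀ m : ℤ, IsIterLaurent n fun k => a (Fin.snoc k m)

end Series

/-- A nonlocal vertex algebra over `ℂ`, with `Y u v n` the coefficient of `x^n`
in `Y(u,x)v` (so `u_m v = Y u v (-m-1)`). -/
structure NLVA (V : Type*) [AddCommGroup V] [Module ℂ V] where
  Y : V →ₗ[ℂ] V →ₗ[ℂ] (ℤ → V)
  one : V
  trunc : ∀ u v : V, IsLaurent (Y u v)
  vacuum_left : ∀ (v : V) (n : ℤ), Y one v n = if n = 0 then v else 0
  creation_reg : ∀ v : V, IsPowerSeries (Y v one)
  creation_zero : ∀ v : V, Y v one 0 = v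
  weak_assoc : ∀ u v w : V, ∃ k : ℕ, ∀ a b : ℤ,
    mulAddPow k (substAdd02 fun m n => Y u (Y v w n) m) a b
      = mulAddPow k (fun a' b' => Y (Y u v a') w b') a b

namespace NLVA

variable {U V K : Type*} [AddCommGroup U] [Module ℂ U] [AddCommGroup V] [Module ℂ V]
  [AddCommGroup K] [Module ℂ K]

/-- The coefficient `Y(·)_n(·)` as a bilinear map. -/
def Yc (𝒱 : NLVA V) (n : ℤ) : V →ₗ[ℂ] V →ₗ[ℂ] V :=
  𝒱.Y.compr₂ (LinearMap.proj n)

/-- The operator `D(v) = v_{-2}𝟙`, i.e. the coefficient of `x^1` in `Y(v,x)𝟙`. -/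
def D (𝒱 : NLVA V) : V →ₗ[ℂ] V :=
  (LinearMap.proj (1 : ℤ)).comp (𝒱.Y.flip 𝒱.one)

/-- Homomorphisms of nonlocal vertex algebras. -/
def IsHom (𝒰 : NLVA U) (𝒱 : NLVA V) (f : U →ₗ[ℂ] V) : Prop :=
  f 𝒰.one = 𝒱.one ∧ ∀ (a b : U) (n : ℤ), f (𝒰.Y a b n) = 𝒱.Y (f a) (f b) n

/-- `𝒦` is generated, as a nonlocal vertex algebra, by the subset `S`. -/
def IsGeneratedBy (𝒦 : NLVA K) (S : Set K) : Prop :=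
  ∀ P : Submodule ℂ K, 𝒦.one ∈ P →
    (∀ a ∈ P, ∀ b ∈ P, ∀ n : ℤ, 𝒦.Y a b n ∈ P) → S ⊆ P → P = ⊤

/-- `𝒰` is irreducible as a module over itself. -/
def SelfIrreducible (𝒰 : NLVA U) : Prop :=
  Nontrivial U ∧
    ∀ P : Submodule ℂ U, (∀ u : U, ∀ p ∈ P, ∀ n : ℤ, 𝒰.Y u p n ∈ P) → P = ⊥ ∨ P = ⊤

/-- The coefficients of the product `Y(v₁,x₁)⋯Y(v_n,x_n)𝟙`. -/
def prodY (𝒱 : NLVA V) : (n : ℕ) → (Fin n → V) → (Fin n → ℤ) → V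
  | 0, _, _ => 𝒱.one
  | n + 1, v, k => 𝒱.Y (v 0) (prodY 𝒱 n (fun i => v i.succ) fun i => k i.succ) (k 0)

/-- Non-degeneracy in the sense of Etingof–Kazhdan: the maps
`Z_n : V^{⊗n} ⊗ ℂ((x₁))⋯((x_n)) → V((x₁))⋯((x_n))` are injective. -/
def NonDegenerate (𝒱 : NLVA V) : Prop :=
  ∀ n : ℕ, 0 < n → ∀ (r : ℕ) (v : Fin r → Fin n → V) (f : Fin r → (Fin n → ℤ) → ℂ),
    (∀ j, IsIterLaurent n (f j)) →
    LinearIndependent ℂ (fun j : Fin r => PiTensorProduct.tprod ℂ (v j)) →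
    (∀ K' : Fin n → ℤ,
      (∑ j : Fin r, ∑ᶠ L : Fin n → ℤ,
        f j L • 𝒱.prodY n (v j) fun i => K' i - L i) = 0) →
    ∀ j, f j = 0

end NLVA

/-- Countable dimension over `ℂ`. -/
def CountableDim (U : Type*) [AddCommGroup U] [Module ℂ U] : Prop :=
  ∃ s : Set U, s.Countable ∧ Submodule.span ℂ s = ⊤

/-- `𝒱` satisfies `𝒮`-locality, i.e. is a weak quantum vertex algebra. -/
def SLocal {V : Type*} [AddCommGroup V] [Module ℂ V] (𝒱 : NLVA V) : Prop :=
  ∀ u v : V, ∃ (r : ℕ) (uu vv : Fin r → V) (f : Fin r → ℤ → ℂ) (k : ℕ),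
    (∀ i, IsLaurent (f i)) ∧ ∀ (w : V) (m n : ℤ),
      mulSubPow k (fun a b => 𝒱.Y u (𝒱.Y v w b) a) m n
        = mulSubPow k (fun a b => ∑ i, scalarMulSub (f i)
            (fun a' b' => 𝒱.Y (vv i) (𝒱.Y (uu i) w a') b') a b) m n

/-- A module for a nonlocal vertex algebra. -/
structure NLVAModule {V : Type*} [AddCommGroup V] [Module ℂ V] (𝒱 : NLVA V)
    (W : Type*) [AddCommGroup W] [Module ℂ W] where
  Yw : V →ₗ[ℂ] W →ₗ[ℂ] (ℤ → W)
  trunc : ∀ (v : V) (w : W), IsLaurent (Yw v w)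
  vacuum : ∀ (w : W) (n : ℤ), Yw 𝒱.one w n = if n = 0 then w else 0
  weak_assoc : ∀ (u v : V) (w : W), ∃ k : ℕ, ∀ a b : ℤ,
    mulAddPow k (substAdd02 fun m n => Yw u (Yw v w n) m) a b
      = mulAddPow k (fun a' b' => Yw (𝒱.Y u v a') w b') a b

section Twist

variable {U V : Type*} [AddCommGroup U] [Module ℂ U] [AddCommGroup V] [Module ℂ V]

/-- Coefficient of `x₁^m x₂^n` in `(Y(x₂)⊗1)R²³(x₁)R¹²(x₁+x₂)` applied to `v ⊗ u ⊗ u'`. -/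
def hex1RHS (𝒰 : NLVA U) (Rc : ℤ → (V ⊗[ℂ] U →ₗ[ℂ] U ⊗[ℂ] V))
    (v : V) (u u' : U) (m n : ℤ) : U ⊗[ℂ] V :=
  ∑ᶠ (i : ℕ) (c : ℤ),
    ((zchoose (m - c + i) i : ℤ) : ℂ) •
      (TensorProduct.map (TensorProduct.lift (𝒰.Yc (n - i))) LinearMap.id)
        ((TensorProduct.assoc ℂ U U V).symm
          ((LinearMap.lTensor U (Rc c))
            ((TensorProduct.assoc ℂ U V U)
              ((Rc (m - c + i) (v ⊗ₜ u)) ⊗ₜ u'))))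

/-- Coefficient of `x₁^m x₂^n` in `(1⊗Y(x₂))R¹²(x₁-x₂)R²³(x₁)` applied to `v ⊗ v' ⊗ u`. -/
def hex2RHS (𝒱 : NLVA V) (Rc : ℤ → (V ⊗[ℂ] U →ₗ[ℂ] U ⊗[ℂ] V))
    (v v' : V) (u : U) (m n : ℤ) : U ⊗[ℂ] V :=
  ∑ᶠ (i : ℕ) (c : ℤ),
    ((-1 : ℂ) ^ i * ((zchoose (m - c + i) i : ℤ) : ℂ)) •
      (LinearMap.lTensor U (TensorProduct.lift (𝒱.Yc (n - i))))
        ((TensorProduct.assoc ℂ U V V)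
          ((TensorProduct.map (Rc (m - c + i)) LinearMap.id)
            ((TensorProduct.assoc ℂ V U V).symm
              (v ⊗ₜ (Rc c (v' ⊗ₜ u))))))

/-- A twisting operator `R(x) : V ⊗ U → U ⊗ V ⊗ ℂ((x))` for the ordered pair `(U,V)`,
given by its family of coefficients `Rc n`. -/
structure TwistingOp (𝒰 : NLVA U) (𝒱 : NLVA V) where
  Rc : ℤ → (V ⊗[ℂ] U →ₗ[ℂ] U ⊗[ℂ] V)
  laurent : ∀ t : V ⊗[ℂ] U, IsTensorLaurent fun n => Rc n t
  vac_right : ∀ (v : V) (n : ℤ),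
    Rc n (v ⊗ₜ 𝒰.one) = if n = 0 then 𝒰.one ⊗ₜ v else 0
  vac_left : ∀ (u : U) (n : ℤ),
    Rc n (𝒱.one ⊗ₜ u) = if n = 0 then u ⊗ₜ 𝒱.one else 0
  hex1 : ∀ (v : V) (u u' : U) (m n : ℤ),
    Rc m (v ⊗ₜ (𝒰.Y u u' n)) = hex1RHS 𝒰 Rc v u u' m n
  hex2 : ∀ (v v' : V) (u : U) (m n : ℤ),
    Rc m ((𝒱.Y v v' n) ⊗ₜ u) = hex2RHS 𝒱 Rc v v' u m n

/-- `Sc` is a two-sided inverse of `Rc` as `ℂ((x))`-linear maps (coefficientwise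
convolution), with values in the tensor with `ℂ((x))`. -/
def IsInvPair {A B : Type*} [AddCommGroup A] [Module ℂ A] [AddCommGroup B] [Module ℂ B]
    (Rc : ℤ → (A →ₗ[ℂ] B)) (Sc : ℤ → (B →ₗ[ℂ] A)) : Prop :=
  (∀ t : B, IsTensorLaurent fun n => Sc n t) ∧
  (∀ (t : A) (n : ℤ), (∑ᶠ c : ℤ, Sc c (Rc (n - c) t)) = if n = 0 then t else 0) ∧
  (∀ (t : B) (n : ℤ), (∑ᶠ c : ℤ, Rc c (Sc (n - c) t)) = if n = 0 then t else 0)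

/-- The canonical embedding `u ↦ u ⊗ 𝟙`. -/
def iotaU (𝒱 : NLVA V) : U →ₗ[ℂ] U ⊗[ℂ] V := (TensorProduct.mk ℂ U V).flip 𝒱.one

/-- The canonical embedding `v ↦ 𝟙 ⊗ v`. -/
def iotaV (𝒰 : NLVA U) : V →ₗ[ℂ] U ⊗[ℂ] V := TensorProduct.mk ℂ U V 𝒰.one

/-- The operator `D ⊗ 1 + 1 ⊗ D` on `U ⊗ V`. -/
def DUV (𝒰 : NLVA U) (𝒱 : NLVA V) : U ⊗[ℂ] V →ₗ[ℂ] U ⊗[ℂ] V :=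
  LinearMap.rTensor V 𝒰.D + LinearMap.lTensor U 𝒱.D

/-- The coefficient of `x^n` in `Y_R(u⊗v, x)(u'⊗v') = (Y(x)⊗Y(x))R²³(-x)(u⊗v⊗u'⊗v')`. -/
def YRcoef (𝒰 : NLVA U) (𝒱 : NLVA V) (Rop : TwistingOp 𝒰 𝒱)
    (u : U) (v : V) (u' : U) (v' : V) (n : ℤ) : U ⊗[ℂ] V :=
  ∑ᶠ (c : ℤ) (a : ℤ),
    ((-1 : ℂ) ^ c) •
      (TensorProduct.map (𝒰.Yc a u) ((𝒱.Yc (n - c - a)).flip v'))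
        (Rop.Rc c (v ⊗ₜ u'))

/-- `𝒯` is the twisted tensor product nonlocal vertex algebra `U ⊗_R V`. -/
def IsTwistedTensor (𝒰 : NLVA U) (𝒱 : NLVA V) (Rop : TwistingOp 𝒰 𝒱)
    (𝒯 : NLVA (U ⊗[ℂ] V)) : Prop :=
  𝒯.one = 𝒰.one ⊗ₜ 𝒱.one ∧
  ∀ (u u' : U) (v v' : V) (n : ℤ),
    𝒯.Y (u ⊗ₜ v) (u' ⊗ₜ v') n = YRcoef 𝒰 𝒱 Rop u v u' v' n

end Twist

section Aux

variable {A B W T : Type*} [AddCommGroup A] [Module ℂ A] [AddCommGroup B] [Module ℂ B]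
  [AddCommGroup W] [Module ℂ W] [AddCommGroup T] [Module ℂ T]

/-- The linear map `(a ⊗ b) ↦ Y_A(a)_e (Y_B(b)_j w)`, i.e. the coefficient
of `Y_A(x₂)(1 ⊗ Y_B(x₁)) (· ⊗ · ⊗ w)` at `x₂^e x₁^j`. -/
def sandwichMod (YA : A →ₗ[ℂ] W →ₗ[ℂ] (ℤ → W)) (YB : B →ₗ[ℂ] W →ₗ[ℂ] (ℤ → W))
    (w : W) (e j : ℤ) : A ⊗[ℂ] B →ₗ[ℂ] W :=
  TensorProduct.lift
    ((YA.compr₂ (LinearMap.proj e)).compl₂ ((YB.compr₂ (LinearMap.proj j)).flip w))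

/-- Coefficient of `x₁^m x₂^n` in `Y_A(x₂)(1 ⊗ Y_B(x₁)) q(x₂ - x₁) (⋯ ⊗ w)`, where the
series `q` is evaluated at `x₂ - x₁`, expanded in nonnegative powers of `x₁`. -/
def twistRHS (YA : A →ₗ[ℂ] W →ₗ[ℂ] (ℤ → W)) (YB : B →ₗ[ℂ] W →ₗ[ℂ] (ℤ → W))
    (q : ℤ → A ⊗[ℂ] B) (w : W) : ℤ → ℤ → W := fun m n =>
  ∑ᶠ (i : ℕ) (p : ℤ),
    ((-1 : ℂ) ^ i * ((zchoose p i : ℤ) : ℂ)) •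
      sandwichMod YA YB w (n - p + i) (m - i) (q p)

/-- As `twistRHS`, but with `q` evaluated at `-x₂ + x₁`, expanded in nonnegative
powers of `x₂`. -/
def twistRHSalt (YA : A →ₗ[ℂ] W →ₗ[ℂ] (ℤ → W)) (YB : B →ₗ[ℂ] W →ₗ[ℂ] (ℤ → W))
    (q : ℤ → A ⊗[ℂ] B) (w : W) : ℤ → ℤ → W := fun m n =>
  ∑ᶠ (i : ℕ) (p : ℤ),
    ((-1 : ℂ) ^ i * ((zchoose p i : ℤ) : ℂ)) •
      sandwichMod YA YB w (n - i) (m - p + i) (q p)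

/-- Coefficient of `x^n` in `e^{xD} F(x)` where `F` is given by its coefficients. -/
def expD (Dop : T →ₗ[ℂ] T) (F : ℤ → T) (n : ℤ) : T :=
  ∑ᶠ j : ℕ, ((j.factorial : ℂ))⁻¹ • (Dop ^ j) (F (n - j))

end Aux

section YBE

variable {V : Type*} [AddCommGroup V] [Module ℂ V]

/-- The flip of the last two tensor factors of `(V⊗V)⊗V`. -/
def swap23 : (V ⊗[ℂ] V) ⊗[ℂ] V →ₗ[ℂ] (V ⊗[ℂ] V) ⊗[ℂ] V :=
  ((TensorProduct.assoc ℂ V V V).symm.toLinearMap).comp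
    ((LinearMap.lTensor V (TensorProduct.comm ℂ V V).toLinearMap).comp
      (TensorProduct.assoc ℂ V V V).toLinearMap)

/-- `S¹²` acting on `(V⊗V)⊗V`. -/
def S12m (Sc : ℤ → (V ⊗[ℂ] V →ₗ[ℂ] V ⊗[ℂ] V)) (c : ℤ) :
    (V ⊗[ℂ] V) ⊗[ℂ] V →ₗ[ℂ] (V ⊗[ℂ] V) ⊗[ℂ] V :=
  TensorProduct.map (Sc c) LinearMap.id

/-- `S²³` acting on `(V⊗V)⊗V`. -/
def S23m (Sc : ℤ → (V ⊗[ℂ] V →ₗ[ℂ] V ⊗[ℂ] V)) (c : ℤ) :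
    (V ⊗[ℂ] V) ⊗[ℂ] V →ₗ[ℂ] (V ⊗[ℂ] V) ⊗[ℂ] V :=
  ((TensorProduct.assoc ℂ V V V).symm.toLinearMap).comp
    ((LinearMap.lTensor V (Sc c)).comp (TensorProduct.assoc ℂ V V V).toLinearMap)

/-- `S¹³` acting on `(V⊗V)⊗V`. -/
def S13m (Sc : ℤ → (V ⊗[ℂ] V →ₗ[ℂ] V ⊗[ℂ] V)) (c : ℤ) :
    (V ⊗[ℂ] V) ⊗[ℂ] V →ₗ[ℂ] (V ⊗[ℂ] V) ⊗[ℂ] V :=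
  swap23.comp ((S12m Sc c).comp swap23)

/-- `S²¹(x) = σ S(x) σ`. -/
def S21c (Sc : ℤ → (V ⊗[ℂ] V →ₗ[ℂ] V ⊗[ℂ] V)) (c : ℤ) :
    V ⊗[ℂ] V →ₗ[ℂ] V ⊗[ℂ] V :=
  ((TensorProduct.comm ℂ V V).toLinearMap).comp
    ((Sc c).comp (TensorProduct.comm ℂ V V).toLinearMap)

/-- The quantum Yang–Baxter equation
`S¹²(x)S¹³(x+z)S²³(z) = S²³(z)S¹³(x+z)S¹²(x)` (coefficient of `x^a z^b`, with
`S¹³(x+z)` expanded in nonnegative powers of `z`). -/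
def QYBE (Sc : ℤ → (V ⊗[ℂ] V →ₗ[ℂ] V ⊗[ℂ] V)) : Prop :=
  ∀ (t : (V ⊗[ℂ] V) ⊗[ℂ] V) (a b : ℤ),
    (∑ᶠ (i : ℕ) (p : ℤ), ((zchoose p i : ℤ) : ℂ) •
        S12m Sc (a - p + i) (S13m Sc p (S23m Sc (b - i) t)))
      = ∑ᶠ (i : ℕ) (p : ℤ), ((zchoose p i : ℤ) : ℂ) •
          S23m Sc (b - i) (S13m Sc p (S12m Sc (a - p + i) t))

/-- Unitarity: `S(x) S²¹(-x) = 1`. -/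
def Unitary (Sc : ℤ → (V ⊗[ℂ] V →ₗ[ℂ] V ⊗[ℂ] V)) : Prop :=
  ∀ (t : V ⊗[ℂ] V) (n : ℤ),
    (∑ᶠ c : ℤ, ((-1 : ℂ) ^ (n - c)) • Sc c (S21c Sc (n - c) t))
      = if n = 0 then t else 0

/-- `[D ⊗ 1, S(x)] = -(d/dx) S(x)`. -/
def DComm1 (𝒱 : NLVA V) (Sc : ℤ → (V ⊗[ℂ] V →ₗ[ℂ] V ⊗[ℂ] V)) : Prop :=
  ∀ (t : V ⊗[ℂ] V) (n : ℤ),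
    (LinearMap.rTensor V 𝒱.D) (Sc n t) - Sc n ((LinearMap.rTensor V 𝒱.D) t)
      = (-((n : ℂ) + 1)) • Sc (n + 1) t

/-- `Y(u,x)v = e^{xD} Y(-x) S(-x)(v⊗u)`. -/
def SkewS (𝒱 : NLVA V) (Sc : ℤ → (V ⊗[ℂ] V →ₗ[ℂ] V ⊗[ℂ] V)) : Prop :=
  ∀ (u v : V) (n : ℤ),
    𝒱.Y u v n = expD 𝒱.D (fun p => ((-1 : ℂ) ^ p) •
      ∑ᶠ c : ℤ, (TensorProduct.lift (𝒱.Yc (p - c))) (Sc c (v ⊗ₜ u))) n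

/-- `S(x₁)(Y(x₂)⊗1) = (Y(x₂)⊗1)S²³(x₁)S¹³(x₁+x₂)`. -/
def HexY1 (𝒱 : NLVA V) (Sc : ℤ → (V ⊗[ℂ] V →ₗ[ℂ] V ⊗[ℂ] V)) : Prop :=
  ∀ (t : (V ⊗[ℂ] V) ⊗[ℂ] V) (m n : ℤ),
    Sc m ((TensorProduct.map (TensorProduct.lift (𝒱.Yc n)) LinearMap.id) t)
      = ∑ᶠ (i : ℕ) (p : ℤ), ((zchoose p i : ℤ) : ℂ) •
          (TensorProduct.map (TensorProduct.lift (𝒱.Yc (n - i))) LinearMap.id)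
            (S23m Sc (m - p + i) (S13m Sc p t))

/-- `S(x₁)(1⊗Y(x₂)) = (1⊗Y(x₂))S¹²(x₁-x₂)S¹³(x₁)`. -/
def HexY2 (𝒱 : NLVA V) (Sc : ℤ → (V ⊗[ℂ] V →ₗ[ℂ] V ⊗[ℂ] V)) : Prop :=
  ∀ (t : (V ⊗[ℂ] V) ⊗[ℂ] V) (m n : ℤ),
    Sc m ((LinearMap.lTensor V (TensorProduct.lift (𝒱.Yc n)))
        ((TensorProduct.assoc ℂ V V V) t))
      = ∑ᶠ (i : ℕ) (p : ℤ), ((-1 : ℂ) ^ i * ((zchoose p i : ℤ) : ℂ)) •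
          (LinearMap.lTensor V (TensorProduct.lift (𝒱.Yc (n - i))))
            ((TensorProduct.assoc ℂ V V V)
              (S12m Sc p (S13m Sc (m - p + i) t)))

/-- A quantum vertex algebra `(V, 𝒮)`. -/
structure QVA (V : Type*) [AddCommGroup V] [Module ℂ V] where
  alg : NLVA V
  sloc : SLocal alg
  Sc : ℤ → (V ⊗[ℂ] V →ₗ[ℂ] V ⊗[ℂ] V)
  laurent : ∀ t : V ⊗[ℂ] V, IsTensorLaurent fun n => Sc n t
  qybe : QYBE Sc
  unitary : Unitary Sc
  vac : ∀ (v : V) (n : ℤ), Sc n (alg.one ⊗ₜ v) = if n = 0 then alg.one ⊗ₜ v else 0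
  dcomm : DComm1 alg Sc
  skew : SkewS alg Sc
  hex : HexY1 alg Sc

end YBE

section Bialg

variable {H : Type*} [AddCommGroup H] [Module ℂ H]

/-- A nonlocal vertex bialgebra. -/
structure NLVBialg (H : Type*) [AddCommGroup H] [Module ℂ H] where
  alg : NLVA H
  comul : H →ₗ[ℂ] H ⊗[ℂ] H
  counit : H →ₗ[ℂ] ℂ
  coassoc : ∀ h : H, (LinearMap.lTensor H comul) (comul h)
      = (TensorProduct.assoc ℂ H H H) ((LinearMap.rTensor H comul) (comul h))
  counit_comul_left : ∀ h : H,
      (TensorProduct.lid ℂ H) ((LinearMap.rTensor H counit) (comul h)) = h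
  counit_comul_right : ∀ h : H,
      (TensorProduct.rid ℂ H) ((LinearMap.lTensor H counit) (comul h)) = h
  counit_one : counit alg.one = 1
  counit_mul : ∀ (a b : H) (n : ℤ),
      counit (alg.Y a b n) = if n = 0 then counit a * counit b else 0
  comul_one : comul alg.one = alg.one ⊗ₜ alg.one
  comul_mul : ∀ (a b : H) (n : ℤ),
      comul (alg.Y a b n)
        = ∑ᶠ p : ℤ, (TensorProduct.map₂ (alg.Yc p) (alg.Yc (n - p))) (comul a) (comul b)

/-- A nonlocal vertex `H`-module-algebra. -/
structure NLVModAlg (𝓗 : NLVBialg H) (U : Type*) [AddCommGroup U] [Module ℂ U] where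
  alg : NLVA U
  act : NLVAModule 𝓗.alg U
  scalar : ∀ (h : H) (u : U), IsTensorLaurent fun n => act.Yw h u n
  vac : ∀ (h : H) (n : ℤ),
      act.Yw h alg.one n = if n = 0 then 𝓗.counit h • alg.one else 0
  compat : ∀ (h : H) (u v : U) (m n : ℤ),
      act.Yw h (alg.Y u v n) m
        = ∑ᶠ (i : ℕ) (p : ℤ), ((-1 : ℂ) ^ i * ((zchoose p i : ℤ) : ℂ)) •
            (TensorProduct.lift
              (((alg.Yc (n - i)).comp ((act.Yw.compr₂ (LinearMap.proj p)).flip u)).compl₂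
                ((act.Yw.compr₂ (LinearMap.proj (m - p + i))).flip v)))
            (𝓗.comul h)

/-- A nonlocal vertex `H`-comodule-algebra. -/
structure NLVComodAlg (𝓗 : NLVBialg H) (V : Type*) [AddCommGroup V] [Module ℂ V] where
  alg : NLVA V
  rho : V →ₗ[ℂ] H ⊗[ℂ] V
  coassoc : ∀ v : V, (LinearMap.lTensor H rho) (rho v)
      = (TensorProduct.assoc ℂ H H V) ((LinearMap.rTensor V 𝓗.comul) (rho v))
  counit_rho : ∀ v : V,
      (TensorProduct.lid ℂ V) ((LinearMap.rTensor V 𝓗.counit) (rho v)) = v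
  rho_one : rho alg.one = 𝓗.alg.one ⊗ₜ alg.one
  rho_mul : ∀ (v v' : V) (n : ℤ),
      rho (alg.Y v v' n)
        = ∑ᶠ p : ℤ, (TensorProduct.map₂ (𝓗.alg.Yc p) (alg.Yc (n - p))) (rho v) (rho v')

/-- The coefficient of `x^n` in
`Y_♯(u⊗v, x)(u'⊗v') = Y(u,x)Y(b¹(v),x)u' ⊗ Y(v²,x)v'`. -/
def Ysharp (𝓗 : NLVBialg H) {U V : Type*} [AddCommGroup U] [Module ℂ U]
    [AddCommGroup V] [Module ℂ V] (MU : NLVModAlg 𝓗 U) (CV : NLVComodAlg 𝓗 V)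
    (u : U) (v : V) (u' : U) (v' : V) (n : ℤ) : U ⊗[ℂ] V :=
  ∑ᶠ (a : ℤ) (p : ℤ),
    (TensorProduct.map
      ((MU.alg.Yc a u).comp ((MU.act.Yw.compr₂ (LinearMap.proj p)).flip u'))
      ((CV.alg.Yc (n - a - p)).flip v'))
    (CV.rho v)

/-- Rearrangement `(H⊗V)⊗U → (H⊗U)⊗V`. -/
def smashSwap {U V : Type*} [AddCommGroup U] [Module ℂ U]
    [AddCommGroup V] [Module ℂ V] :
    (H ⊗[ℂ] V) ⊗[ℂ] U →ₗ[ℂ] (H ⊗[ℂ] U) ⊗[ℂ] V :=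
  ((TensorProduct.assoc ℂ H U V).symm.toLinearMap).comp
    ((LinearMap.lTensor H (TensorProduct.comm ℂ V U).toLinearMap).comp
      (TensorProduct.assoc ℂ H V U).toLinearMap)

/-- The coefficient of `x^n` in `R(x)(v⊗u) = Y(b¹(v),-x)u ⊗ v²`. -/
def Rsmash (𝓗 : NLVBialg H) {U V : Type*} [AddCommGroup U] [Module ℂ U]
    [AddCommGroup V] [Module ℂ V] (MU : NLVModAlg 𝓗 U) (CV : NLVComodAlg 𝓗 V)
    (n : ℤ) : V ⊗[ℂ] U →ₗ[ℂ] U ⊗[ℂ] V :=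
  ((-1 : ℂ) ^ n) •
    ((TensorProduct.map
        (TensorProduct.lift (MU.act.Yw.compr₂ (LinearMap.proj n))) LinearMap.id).comp
      (smashSwap.comp (LinearMap.rTensor U CV.rho)))

end Bialg

namespace QuantumVertex

section Finsum

variable {α β M N : Type*} [AddCommGroup M] [AddCommGroup N]

theorem finsum_prod' {f : α → β → M} (h : {x : α × β | f x.1 x.2 ≠ 0}.Finite) :
    ∑ᶠ x : α × β, f x.1 x.2 = ∑ᶠ a, ∑ᶠ b, f a b :=
  finsum_curry (fun x : α × β => f x.1 x.2) h

theorem finsum_prod_swap {f : α → β → M} (h : {x : α × β | f x.1 x.2 ≠ 0}.Finite) :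
    ∑ᶠ x : α × β, f x.1 x.2 = ∑ᶠ b, ∑ᶠ a, f a b := by
  rw [← finsum_prod' (f := fun b a => f a b), ← finsum_comp_equiv (Equiv.prodComm α β)]
  · rfl
  · exact h.preimage (Equiv.prodComm β α).injective.injOn

theorem finsum_comm' {f : α → β → M} (h : {x : α × β | f x.1 x.2 ≠ 0}.Finite) :
    ∑ᶠ a, ∑ᶠ b, f a b = ∑ᶠ b, ∑ᶠ a, f a b := by
  rw [← finsum_prod' h, finsum_prod_swap h]

theorem finsum_shift {f : ℤ → M} (k : ℤ) : ∑ᶠ n, f (n + k) = ∑ᶠ n, f n :=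
  finsum_comp_equiv (Equiv.addRight k)

theorem finsum_reflect {f : ℤ → M} (k : ℤ) : ∑ᶠ n, f (k - n) = ∑ᶠ n, f n :=
  finsum_comp_equiv (Equiv.subLeft k)

theorem finsum_nat_eq_int {f : ℤ → M} (hf : ∀ n < 0, f n = 0) :
    ∑ᶠ n : ℕ, f n = ∑ᶠ n : ℤ, f n := by
  have h := finsum_mem_range (f := f) (g := ((↑) : ℕ → ℤ)) Nat.cast_injective
  rw [← h]
  refine finsum_congr fun n => ?_
  by_cases hn : 0 ≤ n
  · have : n ∈ Set.range ((↑) : ℕ → ℤ) := ⟨n.toNat, by simp [hn]⟩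
    simp only [this, finsum_true]
  · have : f n = 0 := hf n (by omega)
    simp [this]

theorem finite_int_of_bounds {p : ℤ → Prop} (h₁ : ∀ᶠ n in Filter.atBot, ¬ p n)
    (h₂ : ∀ᶠ n in Filter.atTop, ¬ p n) : {n | p n}.Finite := by
  obtain ⟨a, ha⟩ := Filter.eventually_atBot.1 h₁
  obtain ⟨b, hb⟩ := Filter.eventually_atTop.1 h₂
  refine (Set.finite_Icc a b).subset fun n hn => ⟨?_, ?_⟩
  · by_contra hc
    exact ha n (by omega) hn
  · by_contra hc
    exact hb n (by omega) hn

theorem finite_prod_of_fibers {p : α → β → Prop} (h₁ : {a | ∃ b, p a b}.Finite)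
    (h₂ : ∀ a, {b | p a b}.Finite) : {x : α × β | p x.1 x.2}.Finite := by
  refine Set.Finite.of_finite_fibers Prod.fst ?_ fun a _ => ?_
  · refine h₁.subset ?_
    rintro _ ⟨⟨a, b⟩, hx, rfl⟩
    exact ⟨b, hx⟩
  · refine ((h₂ a).image (Prod.mk a)).subset ?_
    rintro ⟨a', b⟩ ⟨hx, rfl⟩
    exact ⟨b, hx, rfl⟩

theorem isLaurent_iff {a : ℤ → M} : IsLaurent a ↔ ∀ᶠ n in Filter.atBot, a n = 0 := by
  rw [Filter.eventually_atBot]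
  constructor
  · rintro ⟨N, h⟩
    exact ⟨N - 1, fun n hn => h n (by omega)⟩
  · rintro ⟨N, h⟩
    exact ⟨N, fun n hn => h n hn.le⟩

theorem eventually_atBot_add {p : ℤ → Prop} (k : ℤ) (h : ∀ᶠ n in Filter.atBot, p n) :
    ∀ᶠ n in Filter.atBot, p (n + k) := by
  obtain ⟨a, ha⟩ := Filter.eventually_atBot.1 h
  exact Filter.eventually_atBot.2 ⟨a - k, fun n hn => ha _ (by omega)⟩

theorem eventually_atTop_sub {p : ℤ → Prop} (k : ℤ) (h : ∀ᶠ n in Filter.atBot, p n) :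
    ∀ᶠ n in Filter.atTop, p (k - n) := by
  obtain ⟨a, ha⟩ := Filter.eventually_atBot.1 h
  exact Filter.eventually_atTop.2 ⟨k - a, fun n hn => ha _ (by omega)⟩

theorem finsum_map_finsum [Module ℂ M] [Module ℂ N] (Φ : α → M →ₗ[ℂ] N) (K : α → β → M)
    (hK : ∀ a, {b | K a b ≠ 0}.Finite) (h : {x : α × β | Φ x.1 (K x.1 x.2) ≠ 0}.Finite) :
    ∑ᶠ a, Φ a (∑ᶠ b, K a b) = ∑ᶠ b, ∑ᶠ a, Φ a (K a b) := by
  rw [← finsum_comm' (f := fun a b => Φ a (K a b)) h]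
  exact finsum_congr fun a => map_finsum (Φ a) (hK a)

end Finsum

section Binomial

/-- The binomial coefficient `C(p, i)` in `ℂ`, for integers `p` and `i`, which vanishes
for `i < 0`. -/
def bz (p i : ℤ) : ℂ := if 0 ≤ i then ((Ring.choose p i.toNat : ℤ) : ℂ) else 0

theorem zchoose_eq (p : ℤ) (i : ℕ) : zchoose p i = Ring.choose p i := by
  unfold zchoose
  split_ifs with h
  · conv_rhs => rw [← Int.toNat_of_nonneg h]
    rw [Ring.choose_natCast]
  · have : p = -(-p) := by ring
    conv_rhs => rw [this, Ring.choose_neg']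
    have h2 : -p + i - 1 = ((i - p - 1).toNat : ℤ) := by omega
    rw [← Ring.choose_natCast, ← h2, Ring.choose, show -p + i - 1 - i + 1 = -p by ring]
    simp [Int.negOnePow_def, Units.smul_def, Ring.multichoose_eq]

theorem bz_natCast (p : ℤ) (i : ℕ) : bz p i = ((zchoose p i : ℤ) : ℂ) := by
  simp [bz, zchoose_eq]

theorem bz_neg {p i : ℤ} (hi : i < 0) : bz p i = 0 := if_neg (by omega)

@[simp] theorem bz_zero (p : ℤ) : bz p 0 = 1 := by simp [bz]

@[simp] theorem bz_one (p : ℤ) : bz p 1 = p := by simp [bz]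

theorem bz_add_one (p i : ℤ) : bz (p + 1) i = bz p i + bz p (i - 1) := by
  rcases lt_trichotomy i 0 with h | rfl | h
  · simp [bz_neg h, bz_neg (show i - 1 < 0 by omega)]
  · simp [bz_neg (show (-1 : ℤ) < 0 by omega)]
  · obtain ⟨j, rfl⟩ : ∃ j : ℕ, i = j + 1 := ⟨(i - 1).toNat, by omega⟩
    have h1 : ((j : ℤ) + 1).toNat = j + 1 := by omega
    simp only [bz, h.le, if_true, h1, add_sub_cancel_right, Int.natCast_nonneg, Int.toNat_natCast,
      Ring.choose_succ_succ]
    push_cast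
    ring

theorem bz_eq_zero {p i : ℤ} (hp : 0 ≤ p) (h : p < i) : bz p i = 0 := by
  obtain ⟨q, rfl⟩ := Int.eq_ofNat_of_zero_le hp
  obtain ⟨j, rfl⟩ := Int.eq_ofNat_of_zero_le (show 0 ≤ i by omega)
  have : q < j := by omega
  simp [bz, Ring.choose_natCast, Nat.choose_eq_zero_of_lt this]

theorem bz_symm {p : ℤ} (hp : 0 ≤ p) (i : ℤ) : bz p i = bz p (p - i) := by
  rcases lt_or_ge i 0 with h | h
  · rw [bz_neg h, bz_eq_zero hp (by omega)]
  rcases lt_or_ge p i with h' | h'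
  · rw [bz_eq_zero hp h', bz_neg (by omega)]
  obtain ⟨q, rfl⟩ := Int.eq_ofNat_of_zero_le hp
  obtain ⟨j, rfl⟩ := Int.eq_ofNat_of_zero_le h
  have h2 : j ≤ q := by omega
  have h3 : ((q : ℤ) - j) = ((q - j : ℕ) : ℤ) := by omega
  rw [h3]
  simp only [bz, Int.natCast_nonneg, if_true, Int.toNat_natCast, Ring.choose_natCast]
  rw [Nat.choose_symm h2]

theorem bz_sub_mul (p i : ℤ) : ((p : ℂ) - i) * bz p i = p * bz (p - 1) i := by
  rcases lt_or_ge i 0 with h | h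
  · simp [bz_neg h]
  obtain ⟨j, rfl⟩ := Int.eq_ofNat_of_zero_le h
  clear h
  induction j generalizing p with
  | zero => simp
  | succ j ih =>
    induction p using Int.induction_on with
    | zero =>
      have := bz_eq_zero (le_refl 0) (show (0 : ℤ) < (j + 1 : ℕ) by omega)
      rw [this]
      simp
    | succ k ihk =>
      have e1 := bz_add_one k (j + 1 : ℕ)
      have e2 := bz_add_one (k - 1) (j + 1 : ℕ)
      have e3 := ih k
      push_cast at *
      simp only [add_sub_cancel_right, sub_add_cancel] at *
      rw [e1]
      linear_combination ihk + e3 - (k : ℂ) * e2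
    | pred k ihk =>
      have e1 := bz_add_one (-k - 1) (j + 1 : ℕ)
      have e2 := bz_add_one (-k - 1 - 1) (j + 1 : ℕ)
      have e3 := ih (-k - 1)
      push_cast at *
      simp only [add_sub_cancel_right, sub_add_cancel] at *
      linear_combination ihk - e3 - ((-k : ℂ) - (j + 1)) * e1 + (-(k : ℂ)-1) * e2

theorem bz_mul (p i : ℤ) : (i : ℂ) * bz p i = p * bz (p - 1) (i - 1) := by
  have h := bz_sub_mul p i
  have h2 := bz_add_one (p - 1) i
  rw [sub_add_cancel] at h2
  linear_combination -h + p * h2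

theorem bz_mul' (p i : ℤ) : (i : ℂ) * bz p i = (p - i + 1) * bz p (i - 1) := by
  have h := bz_sub_mul p (i - 1)
  rw [bz_mul, ← h]
  push_cast
  ring

end Binomial

section Divided

variable {M N : Type*} [AddCommGroup M] [Module ℂ M] [AddCommGroup N] [Module ℂ N]

/-- The divided power `D^j / j!`, which vanishes for `j < 0`. -/
def dz (D : M →ₗ[ℂ] M) (j : ℤ) : M →ₗ[ℂ] M :=
  if 0 ≤ j then ((j.toNat.factorial : ℂ))⁻¹ • D ^ j.toNat else 0

theorem dz_neg (D : M →ₗ[ℂ] M) {j : ℤ} (hj : j < 0) : dz D j = 0 := if_neg (by omega)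

@[simp] theorem dz_zero (D : M →ₗ[ℂ] M) : dz D 0 = 1 := by simp [dz]

theorem dz_natCast (D : M →ₗ[ℂ] M) (j : ℕ) : dz D j = ((j.factorial : ℂ))⁻¹ • D ^ j := by
  simp [dz]

theorem dz_succ (D : M →ₗ[ℂ] M) (j : ℤ) (x : M) :
    ((j : ℂ) + 1) • dz D (j + 1) x = D (dz D j x) := by
  rcases lt_or_ge j 0 with h | h
  · rw [dz_neg D h]
    obtain rfl | h : j = -1 ∨ j + 1 < 0 := by omega
    · simp
    · simp [dz_neg D h]
  · obtain ⟨n, rfl⟩ := Int.eq_ofNat_of_zero_le h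
    have h1 : ((n : ℤ) + 1) = ((n + 1 : ℕ) : ℤ) := by push_cast; ring
    rw [h1, dz_natCast, dz_natCast]
    simp only [LinearMap.smul_apply, map_smul, pow_succ', Module.End.mul_apply, smul_smul,
      Nat.factorial_succ]
    congr 1
    have : ((n : ℂ) + 1) ≠ 0 := by exact_mod_cast Nat.succ_ne_zero n
    push_cast
    field_simp

theorem dz_comm (D : M →ₗ[ℂ] M) (j : ℤ) (x : M) : dz D j (D x) = D (dz D j x) := by
  unfold dz
  split_ifs
  · simp only [LinearMap.smul_apply, map_smul]
    rw [← Module.End.mul_apply, ← Module.End.mul_apply, ← pow_succ, ← pow_succ']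
  · simp

/-- A solution of `∂₂ B = D B + ∂₁ B` without negative powers of `x₂` is determined by its
value at `x₂ = 0`. -/
theorem ode_solution (D : M →ₗ[ℂ] M) (B : ℤ → ℤ → M)
    (hB : ∀ m n : ℤ, ((n : ℂ) + 1) • B m (n + 1) = D (B m n) + ((m : ℂ) + 1) • B (m + 1) n)
    (h₀ : ∀ m n, n < 0 → B m n = 0) (m n : ℤ) :
    B m n = ∑ᶠ i : ℤ, bz (m + i) i • dz D (n - i) (B (m + i) 0) := by
  have fin : ∀ (a c : ℤ) (e : ℂ) (g : ℤ → M) (f : ℤ → ℤ),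
      (Function.support fun i : ℤ => (bz (f i) (i - c)) • dz D (a - i) (g i)).Finite := by
    intro a c e g f
    refine (Set.finite_Icc c a).subset fun i hi => ⟨?_, ?_⟩
    · by_contra hc
      exact hi (by simp [bz_neg (show i - c < 0 by omega)])
    · by_contra hc
      exact hi (by simp [dz_neg D (show a - i < 0 by omega)])
  rcases lt_or_ge n 0 with h | h
  · rw [h₀ m n h, finsum_eq_zero_of_forall_eq_zero]
    intro i
    rcases lt_or_ge i 0 with h' | h'
    · simp [bz_neg h']
    · simp [dz_neg D (show n - i < 0 by omega)]
  obtain ⟨k, rfl⟩ := Int.eq_ofNat_of_zero_le h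
  clear h
  induction k generalizing m with
  | zero =>
    rw [finsum_eq_single _ 0]
    · simp
    · intro i hi
      rcases lt_or_ge i 0 with h' | h'
      · simp [bz_neg h']
      · simp [dz_neg D (show -i < 0 by omega)]
  | succ k ih =>
    have hk : ((k : ℂ) + 1) ≠ 0 := by exact_mod_cast Nat.succ_ne_zero k
    apply smul_right_injective M hk
    have h1 := hB m k
    have h2 := ih (m + 1)
    rw [← finsum_shift (-1)] at h2
    have f0 := fin k 0 1 (fun i => B (m + i) 0) (fun i => m + i)
    have f1 := fin (k + 1) 0 1 (fun i => B (m + i) 0) (fun i => m + i)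
    have f2 := fin (k + 1) 1 1 (fun i => B (m + i) 0) (fun i => m + i)
    simp only [sub_zero] at f0 f1 f2
    have e1 : D (B m k) = ∑ᶠ i : ℤ, ((k : ℂ) + 1 - i) • bz (m + i) i •
        dz D (k + 1 - i) (B (m + i) 0) := by
      rw [ih m, map_finsum D f0]
      refine finsum_congr fun i => ?_
      rw [map_smul, ← dz_succ, show (k : ℤ) - i + 1 = k + 1 - i by ring]
      push_cast
      module
    have e2 : B (m + 1) k = ∑ᶠ i : ℤ, bz (m + i) (i - 1) • dz D (k + 1 - i) (B (m + i) 0) := by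
      rw [h2]
      refine finsum_congr fun i => ?_
      rw [show m + 1 + (i + -1) = m + i by ring, show (k : ℤ) - (i + -1) = k + 1 - i by ring]
      rfl
    simp only [Int.cast_natCast] at h1
    push_cast
    rw [h1, e1, e2, smul_finsum, smul_finsum, ← finsum_add_distrib]
    · refine finsum_congr fun i => ?_
      have := bz_mul' (m + i) i
      push_cast at this
      match_scalars
      linear_combination -this
    · refine f1.subset fun i hi => ?_
      simp only [Function.mem_support] at hi ⊢
      contrapose! hi
      rw [hi, smul_zero]
    · refine f2.subset fun i hi => ?_
      simp only [Function.mem_support] at hi ⊢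
      contrapose! hi
      rw [hi, smul_zero]

theorem expD_eq (D : M →ₗ[ℂ] M) (F : ℤ → M) (n : ℤ) :
    expD D F n = ∑ᶠ j : ℤ, dz D j (F (n - j)) := by
  rw [← finsum_nat_eq_int]
  · unfold expD
    exact finsum_congr fun j => by rw [dz_natCast]; rfl
  · intro j hj
    simp [dz_neg D hj]

end Divided

theorem sg_add (a b : ℤ) : (-1 : ℂ) ^ (a + b) = (-1) ^ a * (-1) ^ b :=
  zpow_add₀ (by norm_num) a b

theorem sg_sub (a b : ℤ) : (-1 : ℂ) ^ (a - b) = (-1) ^ a * (-1) ^ b := by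
  rw [zpow_sub₀ (by norm_num)]
  rcases Int.even_or_odd b with h | h <;> simp [h.neg_one_zpow, div_neg]

theorem sg_mul_self (a : ℤ) : (-1 : ℂ) ^ a * (-1) ^ a = 1 := by
  rw [← sg_sub, sub_self, zpow_zero]

theorem sg_ne_zero (a : ℤ) : (-1 : ℂ) ^ a ≠ 0 := zpow_ne_zero _ (by norm_num)

section AddMul

variable {M N : Type*} [AddCommGroup M] [Module ℂ M] [AddCommGroup N] [Module ℂ N]

/-- Multiplication of double series by `x₁ + x₂`. -/
def addMul : Module.End ℂ (ℤ → ℤ → M) where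
  toFun A m n := A (m - 1) n + A m (n - 1)
  map_add' A B := by ext; simp; abel
  map_smul' c A := by ext; simp

theorem addMul_apply (A : ℤ → ℤ → M) (m n : ℤ) :
    addMul A m n = A (m - 1) n + A m (n - 1) := rfl

/-- An operation on double series which commutes with the multiplication by `x₁ + x₂`
commutes with its powers. -/
theorem addMul_pow_comm (T : (ℤ → ℤ → M) → (ℤ → ℤ → N)) {P : (ℤ → ℤ → M) → Prop}
    (hP : ∀ A, P A → P (addMul A)) (hT : ∀ A, P A → T (addMul A) = addMul (T A))
    {A : ℤ → ℤ → M} (hA : P A) (k : ℕ) :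
    P ((addMul ^ k) A) ∧ T ((addMul ^ k) A) = (addMul ^ k) (T A) := by
  induction k with
  | zero => exact ⟨hA, rfl⟩
  | succ k ih =>
    rw [pow_succ', pow_succ', Module.End.mul_apply, Module.End.mul_apply, ← ih.2, ← hT _ ih.1]
    exact ⟨hP _ ih.1, rfl⟩

theorem addMul_pow_swap (k : ℕ) (A : ℤ → ℤ → M) :
    (addMul ^ k) (fun m n => A n m) = fun m n => (addMul ^ k) A n m :=
  ((addMul_pow_comm (fun A m n => A n m) (P := fun _ => True) (fun _ _ => trivial)
    (fun A _ => by ext m n; simp only [addMul_apply]; abel) trivial k).2).symm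

theorem addMul_pow_map (L : M →ₗ[ℂ] N) (k : ℕ) (A : ℤ → ℤ → M) :
    (addMul ^ k) (fun m n => L (A m n)) = fun m n => L ((addMul ^ k) A m n) :=
  ((addMul_pow_comm (fun A m n => L (A m n)) (P := fun _ => True) (fun _ _ => trivial)
    (fun A _ => by ext m n; simp only [addMul_apply, map_add]) trivial k).2).symm

theorem addMul_pow_congr {j k : ℕ} (h : j ≤ k) {A B : ℤ → ℤ → M}
    (hAB : (addMul ^ j) A = (addMul ^ j) B) : (addMul ^ k) A = (addMul ^ k) B := by
  obtain ⟨i, rfl⟩ := Nat.exists_eq_add_of_le' h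
  rw [pow_add, Module.End.mul_apply, Module.End.mul_apply, hAB]

theorem addMul_pow_trunc_right {A : ℤ → ℤ → M} {N : ℤ} (hA : ∀ m n, n < N → A m n = 0) (k : ℕ) :
    ∀ m n, n < N → (addMul ^ k) A m n = 0 :=
  (addMul_pow_comm (P := fun A : ℤ → ℤ → M => ∀ m n, n < N → A m n = 0) id
    (fun A hA m n hn => by simp [addMul_apply, hA m (n - 1) (by omega), hA (m - 1) n hn])
    (fun A hA => rfl) hA k).1

theorem addMul_pow_trunc_left {A : ℤ → ℤ → M} {N : ℤ} (hA : ∀ m n, m < N → A m n = 0) (k : ℕ) :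
    ∀ m n, m < N → (addMul ^ k) A m n = 0 := by
  have := addMul_pow_trunc_right (A := fun m n => A n m) (fun m n h => hA n m h) k
  rw [addMul_pow_swap] at this
  exact fun m n h => this n m h

theorem eq_zero_of_addMul_pow {A : ℤ → ℤ → M} (hA : ∀ᶠ n in Filter.atBot, ∀ m, A m n = 0) (k : ℕ)
    (h : (addMul ^ k) A = 0) : A = 0 := by
  obtain ⟨N, hN⟩ := Filter.eventually_atBot.1 hA
  have hA' : ∀ m n, n < N → A m n = 0 := fun m n hn => hN n hn.le m
  induction k generalizing A with
  | zero => exact h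
  | succ k ih =>
    apply ih hA ?_ hN hA'
    rw [pow_succ', Module.End.mul_apply] at h
    set B := (addMul ^ k) A
    have hB := addMul_pow_trunc_right hA' k
    have key : ∀ (j : ℕ) (m n : ℤ), n < N + j → B m n = 0 := by
      intro j
      induction j with
      | zero => simpa using hB
      | succ j ihj =>
        intro m n hn
        have := congr_fun (congr_fun h (m + 1)) n
        rw [addMul_apply, ihj (m + 1) (n - 1) (by push_cast at hn; omega), add_zero,
          add_sub_cancel_right] at this
        exact this
    ext m n
    exact key (n - N + 1).toNat m n (by omega)

theorem addMul_pow_cancel {A B : ℤ → ℤ → M} (hA : ∀ᶠ n in Filter.atBot, ∀ m, A m n = 0)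
    (hB : ∀ᶠ n in Filter.atBot, ∀ m, B m n = 0) {k : ℕ}
    (h : (addMul ^ k) A = (addMul ^ k) B) : A = B := by
  rw [← sub_eq_zero]
  refine eq_zero_of_addMul_pow ?_ k (by rw [map_sub, h, sub_self])
  filter_upwards [hA, hB] with n h1 h2 m
  simp [h1, h2]

theorem addMul_pow_cancel_left {A B : ℤ → ℤ → M} (hA : ∀ᶠ m in Filter.atBot, ∀ n, A m n = 0)
    (hB : ∀ᶠ m in Filter.atBot, ∀ n, B m n = 0) {k : ℕ}
    (h : (addMul ^ k) A = (addMul ^ k) B) : A = B := by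
  have := addMul_pow_cancel (A := fun m n => A n m) (B := fun m n => B n m) hA hB (k := k) (by
    rw [addMul_pow_swap k A, addMul_pow_swap k B, h])
  ext m n
  exact congr_fun (congr_fun this n) m

theorem mulAddPow_eq (k : ℕ) (A : ℤ → ℤ → M) : mulAddPow k A = (addMul ^ k) A := by
  let R : Module.End ℂ (ℤ → ℤ → M) :=
    { toFun := fun A m n => A m (n - 1), map_add' := fun _ _ => rfl, map_smul' := fun _ _ => rfl }
  let L : Module.End ℂ (ℤ → ℤ → M) :=
    { toFun := fun A m n => A (m - 1) n, map_add' := fun _ _ => rfl, map_smul' := fun _ _ => rfl }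
  have hR : ∀ (j : ℕ) (A : ℤ → ℤ → M) (m n : ℤ), (R ^ j) A m n = A m (n - j) := by
    intro j
    induction j with
    | zero => simp
    | succ j ih =>
      intro A m n
      rw [pow_succ, Module.End.mul_apply, ih]
      change A m (n - j - 1) = _
      push_cast
      congr 1
      ring
  have hL : ∀ (j : ℕ) (A : ℤ → ℤ → M) (m n : ℤ), (L ^ j) A m n = A (m - j) n := by
    intro j
    induction j with
    | zero => simp
    | succ j ih =>
      intro A m n
      rw [pow_succ, Module.End.mul_apply, ih]
      change A (m - j - 1) n = _
      push_cast
      congr 1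
      ring
  have h : (addMul : Module.End ℂ (ℤ → ℤ → M)) = R + L := by
    ext A m n
    exact add_comm _ _
  have hc : Commute R L := rfl
  ext m n
  rw [h, hc.add_pow, LinearMap.sum_apply, Finset.sum_apply, Finset.sum_apply]
  unfold mulAddPow
  refine Finset.sum_congr rfl fun j hj => ?_
  have hj' : j ≤ k := by simpa [Nat.lt_succ_iff] using hj
  rw [← Nat.cast_comm, Module.End.mul_apply, Module.End.natCast_apply, Module.End.mul_apply,
    ← Nat.cast_smul_eq_nsmul ℂ, Pi.smul_apply, Pi.smul_apply, hR, hL]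
  rw [show m - k + j = m - ((k - j : ℕ) : ℤ) by omega]

/-- Replacing `x₁` by `-x₁` turns `x₁ - x₂` into `-(x₁ + x₂)`. -/
theorem mulSubPow_eq (k : ℕ) (A : ℤ → ℤ → M) (m n : ℤ) :
    mulSubPow k A m n
      = (-1 : ℂ) ^ (m - k) • (addMul ^ k) (fun a b => (-1 : ℂ) ^ a • A a b) m n := by
  rw [← mulAddPow_eq]
  unfold mulSubPow mulAddPow
  rw [Finset.smul_sum]
  refine Finset.sum_congr rfl fun j _ => ?_
  rw [smul_smul, smul_smul, sg_add]
  congr 1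
  have := sg_mul_self (m - k)
  rw [zpow_natCast]
  linear_combination -(-1 : ℂ) ^ j * (k.choose j : ℂ) * this

end AddMul

section Substitution

variable {M N : Type*} [AddCommGroup M] [Module ℂ M] [AddCommGroup N] [Module ℂ N]

/-- For a triple series `G(x₁,y,x₂)`, the double series `G(x₁, x₂ + x₁, x₂)`, expanded in
nonnegative powers of `x₁`. -/
def sub21 (G : ℤ → ℤ → ℤ → M) (m n : ℤ) : M :=
  ∑ᶠ x : ℤ × ℤ, bz (m + n - x.1 - x.2) (m - x.1) • G x.1 (m + n - x.1 - x.2) x.2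

/-- The triple series `G(x₂,y,x₁)`. -/
def flip3 (G : ℤ → ℤ → ℤ → M) : ℤ → ℤ → ℤ → M := fun c p b => G b p c

/-- For a triple series `G(x₁,y,x₂)`, the double series `G(x₁, x₁ + x₂, x₂)`, expanded in
nonnegative powers of `x₂`. -/
def sub12 (G : ℤ → ℤ → ℤ → M) (m n : ℤ) : M := sub21 (flip3 G) n m

/-- The truncation conditions on `G(x₁,y,x₂)` under which `G(x₁, x₂ + x₁, x₂)` exists. -/
structure Good (G : ℤ → ℤ → ℤ → M) : Prop where
  fst : ∀ᶠ c in Filter.atBot, ∀ p b, G c p b = 0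
  mid : ∀ᶠ p in Filter.atBot, ∀ c b, G c p b = 0
  lst : ∀ c, ∀ᶠ b in Filter.atBot, ∀ p, G c p b = 0

/-- Multiplication of `G(x₁,y,x₂)` by `(x₁ + x₂)^k`. -/
def addMul13 (k : ℕ) (G : ℤ → ℤ → ℤ → M) : ℤ → ℤ → ℤ → M := fun c p b =>
  (addMul ^ k) (fun c' b' => G c' p b') c b

omit [Module ℂ M] in
theorem Good.finite {G : ℤ → ℤ → ℤ → M} (hG : Good G) (m n : ℤ) :
    {x : ℤ × ℤ | x.1 ≤ m ∧ G x.1 (m + n - x.1 - x.2) x.2 ≠ 0}.Finite := by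
  refine finite_prod_of_fibers (p := fun c b => c ≤ m ∧ G c (m + n - c - b) b ≠ 0) ?_ fun c => ?_
  · refine finite_int_of_bounds ?_ ?_
    · filter_upwards [hG.fst] with c hc
      rintro ⟨b, -, h⟩
      exact h (hc _ _)
    · filter_upwards [Filter.eventually_gt_atTop m] with c hc
      rintro ⟨b, h, -⟩
      omega
  · refine finite_int_of_bounds ?_ ?_
    · filter_upwards [hG.lst c] with b hb
      rintro ⟨-, h⟩
      exact h (hb _)
    · filter_upwards [eventually_atTop_sub (m + n - c) hG.mid] with b hb
      rintro ⟨-, h⟩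
      exact h (hb _ _)

theorem finite_support_smul {α : Type*} {s : Set α} (hs : s.Finite) {f : α → ℂ} {g : α → M}
    (h : ∀ x, f x ≠ 0 → g x ≠ 0 → x ∈ s) : (Function.support fun x => f x • g x).Finite := by
  refine hs.subset fun x hx => h x ?_ ?_
  · rintro h0
    exact hx (by simp [h0])
  · rintro h0
    exact hx (by simp [h0])

theorem bz_ne_zero {p m c : ℤ} (h : bz p (m - c) ≠ 0) : c ≤ m := by
  by_contra hc
  exact h (bz_neg (by omega))

theorem Good.finite_support {G : ℤ → ℤ → ℤ → M} (hG : Good G) (m n : ℤ) :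
    (Function.support fun x : ℤ × ℤ =>
      bz (m + n - x.1 - x.2) (m - x.1) • G x.1 (m + n - x.1 - x.2) x.2).Finite :=
  finite_support_smul (hG.finite m n) fun _ h1 h2 => ⟨bz_ne_zero h1, h2⟩

omit [Module ℂ M] in
theorem Good.add {G H : ℤ → ℤ → ℤ → M} (hG : Good G) (hH : Good H) :
    Good fun c p b => G c p b + H c p b where
  fst := by filter_upwards [hG.fst, hH.fst] with c h1 h2 p b; simp [h1, h2]
  mid := by filter_upwards [hG.mid, hH.mid] with c h1 h2 p b; simp [h1, h2]
  lst c := by filter_upwards [hG.lst c, hH.lst c] with c h1 h2 p; simp [h1, h2]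

theorem Good.map {G : ℤ → ℤ → ℤ → M} (hG : Good G) (L : M →ₗ[ℂ] N) :
    Good fun c p b => L (G c p b) where
  fst := by filter_upwards [hG.fst] with c h1 p b; simp [h1]
  mid := by filter_upwards [hG.mid] with c h1 p b; simp [h1]
  lst c := by filter_upwards [hG.lst c] with c h1 p; simp [h1]

theorem sub21_add {G H : ℤ → ℤ → ℤ → M} (hG : Good G) (hH : Good H) (m n : ℤ) :
    sub21 (fun c p b => G c p b + H c p b) m n = sub21 G m n + sub21 H m n := by
  unfold sub21
  rw [← finsum_add_distrib (hG.finite_support m n) (hH.finite_support m n)]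
  simp only [smul_add]

theorem sub21_map {G : ℤ → ℤ → ℤ → M} (hG : Good G) (L : M →ₗ[ℂ] N) (m n : ℤ) :
    sub21 (fun c p b => L (G c p b)) m n = L (sub21 G m n) := by
  unfold sub21
  rw [map_finsum L (hG.finite_support m n)]
  simp only [map_smul]

theorem addMul_sub21 {G : ℤ → ℤ → ℤ → M} (hG : Good G) :
    addMul (sub21 G) = sub21 fun c p b => G c (p - 1) b := by
  ext m n
  rw [addMul_apply]
  unfold sub21
  rw [← finsum_add_distrib (hG.finite_support (m - 1) n) (hG.finite_support m (n - 1))]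
  refine finsum_congr fun x => ?_
  have := bz_add_one (m + n - x.1 - x.2 - 1) (m - x.1)
  rw [sub_add_cancel] at this
  rw [this, show m - 1 + n - x.1 - x.2 = m + n - x.1 - x.2 - 1 by ring,
    show m + (n - 1) - x.1 - x.2 = m + n - x.1 - x.2 - 1 by ring,
    show m - 1 - x.1 = m - x.1 - 1 by ring]
  module

omit [Module ℂ M] in
theorem Good.shift {G : ℤ → ℤ → ℤ → M} (hG : Good G) (i j k : ℤ) :
    Good fun c p b => G (c + i) (p + j) (b + k) where
  fst := by filter_upwards [eventually_atBot_add i hG.fst] with c h p b using h _ _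
  mid := by filter_upwards [eventually_atBot_add j hG.mid] with c h p b using h _ _
  lst c := by filter_upwards [eventually_atBot_add k (hG.lst (c + i))] with c h p using h _

theorem Good.smul {G : ℤ → ℤ → ℤ → M} (hG : Good G) (f : ℤ → ℤ → ℤ → ℂ) :
    Good fun c p b => f c p b • G c p b where
  fst := by filter_upwards [hG.fst] with c h1 p b; simp [h1]
  mid := by filter_upwards [hG.mid] with c h1 p b; simp [h1]
  lst c := by filter_upwards [hG.lst c] with c h1 p; simp [h1]

theorem addMul_pow_sub21 {G : ℤ → ℤ → ℤ → M} (hG : Good G) (k : ℕ) :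
    (addMul ^ k) (sub21 G) = sub21 fun c p b => G c (p - k) b := by
  induction k with
  | zero => simp
  | succ k ih =>
    have := hG.shift 0 (-k) 0
    simp only [add_zero] at this
    rw [pow_succ', Module.End.mul_apply, ih, addMul_sub21 (G := fun c p b => G c (p - k) b) this]
    push_cast
    simp only [sub_sub, add_comm]

theorem Good.addMul13 {G : ℤ → ℤ → ℤ → M} (hG : Good G) (k : ℕ) :
    Good (addMul13 k G) ∧ sub21 (addMul13 k G) = (addMul ^ k) (sub21 G) := by
  induction k with
  | zero => exact ⟨hG, rfl⟩
  | succ k ih =>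
    have e : QuantumVertex.addMul13 (k + 1) G = fun c p b =>
        QuantumVertex.addMul13 k G (c - 1) p b + QuantumVertex.addMul13 k G c p (b - 1) := by
      unfold QuantumVertex.addMul13
      ext c p b
      rw [pow_succ', Module.End.mul_apply, addMul_apply]
    have g1 := ih.1.shift (-1) 0 0
    have g2 := ih.1.shift 0 0 (-1)
    simp only [add_zero, ← sub_eq_add_neg] at g1 g2
    rw [e, pow_succ', Module.End.mul_apply, ← ih.2]
    refine ⟨g1.add g2, ?_⟩
    ext m n
    rw [sub21_add g1 g2, addMul_apply]
    unfold sub21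
    congr 1
    · rw [← finsum_comp_equiv ((Equiv.addRight (1 : ℤ)).prodCongr (Equiv.refl ℤ))]
      refine finsum_congr fun x => ?_
      simp only [Equiv.prodCongr_apply, Prod.map, Equiv.coe_addRight, Equiv.refl_apply,
        add_sub_cancel_right]
      rw [show m - (x.1 + 1) = m - 1 - x.1 by ring,
        show m + n - (x.1 + 1) - x.2 = m - 1 + n - x.1 - x.2 by ring]
    · rw [← finsum_comp_equiv ((Equiv.refl ℤ).prodCongr (Equiv.addRight (1 : ℤ)))]
      refine finsum_congr fun x => ?_
      simp only [Equiv.prodCongr_apply, Prod.map, Equiv.coe_addRight, Equiv.refl_apply,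
        add_sub_cancel_right]
      rw [show m + n - x.1 - (x.2 + 1) = m + (n - 1) - x.1 - x.2 by ring]

/-- For series without negative powers of `y`, both substitutions agree. -/
theorem sub21_eq_sub12 {G : ℤ → ℤ → ℤ → M} (h : ∀ p < 0, ∀ c b, G c p b = 0) :
    sub21 G = sub12 G := by
  ext m n
  unfold sub12 sub21 flip3
  rw [← finsum_comp_equiv (Equiv.prodComm ℤ ℤ)]
  refine finsum_congr fun x => ?_
  simp only [Equiv.prodComm_apply, Prod.fst_swap, Prod.snd_swap]
  rw [show n + m - x.1 - x.2 = m + n - x.2 - x.1 by ring]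
  rcases lt_or_ge (m + n - x.2 - x.1) 0 with hp | hp
  · rw [h _ hp, smul_zero, smul_zero]
  · rw [bz_symm hp, show m + n - x.2 - x.1 - (m - x.2) = n - x.1 by ring]

/-- Two triple series which agree after multiplication by a power of `x₁ + x₂` also agree,
up to multiplication by such a power, after substituting both expansions of `y = x₁ + x₂`. -/
theorem exists_sub21_eq_sub12 {G G' : ℤ → ℤ → ℤ → M} (hG : Good G) (hG' : Good (flip3 G'))
    (k : ℕ) (h : addMul13 k G = addMul13 k G') :
    ∃ K : ℕ, (addMul ^ K) (sub21 G) = (addMul ^ K) (sub12 G') := by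
  obtain ⟨N, hN⟩ := Filter.eventually_atBot.1 hG.mid
  obtain ⟨N', hN'⟩ := Filter.eventually_atBot.1 hG'.mid
  obtain ⟨l, hl, hl'⟩ : ∃ l : ℕ, -(l : ℤ) ≤ N ∧ -(l : ℤ) ≤ N' :=
    ⟨max (-N).toNat (-N').toNat, by omega, by omega⟩
  set H : ℤ → ℤ → ℤ → M := fun c p b => G c (p - l) b
  set H' : ℤ → ℤ → ℤ → M := fun c p b => G' c (p - l) b
  have gH : Good H := by simpa [← sub_eq_add_neg] using hG.shift 0 (-l) 0
  have gH' : Good (flip3 H') := by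
    have := hG'.shift 0 (-l) 0
    simp only [add_zero, ← sub_eq_add_neg] at this
    exact this
  have e : addMul13 k H = addMul13 k H' := by
    ext c p b
    exact congr_fun (congr_fun (congr_fun h c) (p - l)) b
  have e2 : flip3 (addMul13 k H') = addMul13 k (flip3 H') := by
    ext c p b
    exact (congr_fun (congr_fun (addMul_pow_swap k fun c b => H' c p b) c) b).symm
  have e3 : (addMul ^ k) (sub21 H) = (addMul ^ k) (sub12 H') := by
    rw [← (gH.addMul13 k).2, sub21_eq_sub12]
    · rw [e]
      unfold sub12
      rw [e2, (gH'.addMul13 k).2]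
      exact (addMul_pow_swap k _).symm
    · intro p hp c b
      have : (fun c b => H c p b) = 0 := by
        ext c b
        exact hN _ (by omega) _ _
      unfold addMul13
      rw [this, map_zero]
      rfl
  refine ⟨k + l, ?_⟩
  rw [pow_add, Module.End.mul_apply, Module.End.mul_apply, addMul_pow_sub21 hG, e3]
  congr 1
  unfold sub12
  rw [addMul_pow_swap l, addMul_pow_sub21 hG']
  rfl

theorem sub21_deriv_left {G : ℤ → ℤ → ℤ → M} (hG : Good G) (m n : ℤ) :
    ((m : ℂ) + 1) • sub21 G (m + 1) n
      = sub21 (fun c p b => ((c : ℂ) + 1) • G (c + 1) p b) m n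
        + sub21 (fun c p b => ((p : ℂ) + 1) • G c (p + 1) b) m n := by
  have e1 : sub21 (fun c p b => ((c : ℂ) + 1) • G (c + 1) p b) m n
      = ∑ᶠ x : ℤ × ℤ, (bz (m + 1 + n - x.1 - x.2) (m + 1 - x.1) * x.1) •
        G x.1 (m + 1 + n - x.1 - x.2) x.2 := by
    unfold sub21
    symm
    rw [← finsum_comp_equiv ((Equiv.addRight (1 : ℤ)).prodCongr (Equiv.refl ℤ))]
    refine finsum_congr fun x => ?_
    simp only [Equiv.prodCongr_apply, Prod.map, Equiv.coe_addRight, Equiv.refl_apply]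
    rw [show m + 1 - (x.1 + 1) = m - x.1 by ring,
      show m + 1 + n - (x.1 + 1) - x.2 = m + n - x.1 - x.2 by ring, smul_smul]
    push_cast
    rfl
  have e2 : sub21 (fun c p b => ((p : ℂ) + 1) • G c (p + 1) b) m n
      = ∑ᶠ x : ℤ × ℤ, (bz (m + n - x.1 - x.2) (m - x.1) * ((m : ℂ) + n - x.1 - x.2 + 1)) •
        G x.1 (m + 1 + n - x.1 - x.2) x.2 := by
    unfold sub21
    refine finsum_congr fun x => ?_
    rw [smul_smul, show m + 1 + n - x.1 - x.2 = m + n - x.1 - x.2 + 1 by ring]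
    push_cast
    rfl
  rw [e1, e2, sub21, smul_finsum, ← finsum_add_distrib]
  · refine finsum_congr fun x => ?_
    rw [← add_smul, smul_smul]
    congr 1
    have := bz_mul (m + 1 + n - x.1 - x.2) (m + 1 - x.1)
    rw [show m + 1 + n - x.1 - x.2 - 1 = m + n - x.1 - x.2 by ring,
      show m + 1 - x.1 - 1 = m - x.1 by ring] at this
    push_cast at this
    linear_combination this
  · exact finite_support_smul (hG.finite (m + 1) n) fun x h1 h2 =>
      ⟨bz_ne_zero (left_ne_zero_of_mul h1), h2⟩
  · exact finite_support_smul (hG.finite (m + 1) n) fun x h1 h2 =>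
      ⟨(bz_ne_zero (left_ne_zero_of_mul h1)).trans (by omega), h2⟩

theorem sub21_deriv_right {G : ℤ → ℤ → ℤ → M} (hG : Good G) (m n : ℤ) :
    ((n : ℂ) + 1) • sub21 G m (n + 1)
      = sub21 (fun c p b => ((b : ℂ) + 1) • G c p (b + 1)) m n
        + sub21 (fun c p b => ((p : ℂ) + 1) • G c (p + 1) b) m n := by
  have e1 : sub21 (fun c p b => ((b : ℂ) + 1) • G c p (b + 1)) m n
      = ∑ᶠ x : ℤ × ℤ, (bz (m + (n + 1) - x.1 - x.2) (m - x.1) * x.2) •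
        G x.1 (m + (n + 1) - x.1 - x.2) x.2 := by
    unfold sub21
    symm
    rw [← finsum_comp_equiv ((Equiv.refl ℤ).prodCongr (Equiv.addRight (1 : ℤ)))]
    refine finsum_congr fun x => ?_
    simp only [Equiv.prodCongr_apply, Prod.map, Equiv.coe_addRight, Equiv.refl_apply]
    rw [show m + (n + 1) - x.1 - (x.2 + 1) = m + n - x.1 - x.2 by ring, smul_smul]
    push_cast
    rfl
  have e2 : sub21 (fun c p b => ((p : ℂ) + 1) • G c (p + 1) b) m n
      = ∑ᶠ x : ℤ × ℤ, (bz (m + n - x.1 - x.2) (m - x.1) * ((m : ℂ) + n - x.1 - x.2 + 1)) •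
        G x.1 (m + (n + 1) - x.1 - x.2) x.2 := by
    unfold sub21
    refine finsum_congr fun x => ?_
    rw [smul_smul, show m + (n + 1) - x.1 - x.2 = m + n - x.1 - x.2 + 1 by ring]
    push_cast
    rfl
  rw [e1, e2, sub21, smul_finsum, ← finsum_add_distrib]
  · refine finsum_congr fun x => ?_
    rw [← add_smul, smul_smul]
    congr 1
    have := bz_sub_mul (m + (n + 1) - x.1 - x.2) (m - x.1)
    rw [show m + (n + 1) - x.1 - x.2 - 1 = m + n - x.1 - x.2 by ring] at this
    push_cast at this
    linear_combination this
  · exact finite_support_smul (hG.finite m (n + 1)) fun x h1 h2 =>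
      ⟨bz_ne_zero (left_ne_zero_of_mul h1), h2⟩
  · exact finite_support_smul (hG.finite m (n + 1)) fun x h1 h2 =>
      ⟨bz_ne_zero (left_ne_zero_of_mul h1), h2⟩

/-- The index change from `(i, p)` to `(m - i, n - p + i)`. -/
def subEquiv (m n : ℤ) : ℤ × ℤ ≃ ℤ × ℤ where
  toFun x := (m - x.1, n - x.2 + x.1)
  invFun y := (m - y.1, m + n - y.1 - y.2)
  left_inv x := by ext <;> simp
  right_inv y := by ext <;> simp; ring

theorem sub21_eq_finsum (G : ℤ → ℤ → ℤ → M) (m n : ℤ) :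
    sub21 G m n = ∑ᶠ x : ℤ × ℤ, bz x.2 x.1 • G (m - x.1) x.2 (n - x.2 + x.1) := by
  unfold sub21
  rw [← finsum_comp_equiv (subEquiv m n)]
  refine finsum_congr fun x => ?_
  simp only [subEquiv, Equiv.coe_fn_mk, sub_sub_cancel]
  rw [show m + n - (m - x.1) - (n - x.2 + x.1) = x.2 by ring]

theorem Good.finite_support' {G : ℤ → ℤ → ℤ → M} (hG : Good G) (m n : ℤ) :
    {x : ℤ × ℤ | bz x.2 x.1 • G (m - x.1) x.2 (n - x.2 + x.1) ≠ 0}.Finite := by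
  refine ((hG.finite_support m n).preimage (subEquiv m n).injective.injOn).subset fun x hx => ?_
  simp only [subEquiv, Equiv.coe_fn_mk, Set.mem_preimage, Function.mem_support, sub_sub_cancel]
  rwa [show m + n - (m - x.1) - (n - x.2 + x.1) = x.2 by ring]

theorem sub21_eq_iterated {G : ℤ → ℤ → ℤ → M} (hG : Good G) (m n : ℤ) :
    sub21 G m n = ∑ᶠ (i : ℕ) (p : ℤ), ((zchoose p i : ℤ) : ℂ) • G (m - i) p (n - p + i) := by
  rw [sub21_eq_finsum,
    finsum_prod' (f := fun i p => bz p i • G (m - i) p (n - p + i)) (hG.finite_support' m n),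
    ← finsum_nat_eq_int (f := fun i => ∑ᶠ p, bz p i • G (m - i) p (n - p + i))]
  · simp only [bz_natCast]
  · intro i hi
    simp [bz_neg hi]

theorem sub12_eq_iterated {G : ℤ → ℤ → ℤ → M} (hG : Good (flip3 G)) (m n : ℤ) :
    sub12 G m n = ∑ᶠ (i : ℕ) (p : ℤ), ((zchoose p i : ℤ) : ℂ) • G (m - p + i) p (n - i) :=
  sub21_eq_iterated hG n m

theorem sub21_trunc_left {G : ℤ → ℤ → ℤ → M} (hG : Good G) :
    ∀ᶠ m in Filter.atBot, ∀ n, sub21 G m n = 0 := by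
  obtain ⟨N, hN⟩ := Filter.eventually_atBot.1 hG.fst
  filter_upwards [Filter.eventually_le_atBot N] with m hm n
  refine finsum_eq_zero_of_forall_eq_zero fun x => ?_
  rcases le_or_gt x.1 m with h | h
  · rw [hN x.1 (by omega), smul_zero]
  · rw [bz_neg (by omega), zero_smul]

end Substitution

section FiniteGeneration

variable {L M N : Type*} [AddCommGroup L] [Module ℂ L] [AddCommGroup M] [Module ℂ M]
  [AddCommGroup N] [Module ℂ N]

theorem fg_trunc {F : Submodule ℂ M} (hF : F.FG) {Φ : ℤ → M →ₗ[ℂ] N}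
    (hΦ : ∀ t, IsLaurent fun n => Φ n t) : ∀ᶠ n in Filter.atBot, ∀ t ∈ F, Φ n t = 0 := by
  obtain ⟨s, rfl⟩ := hF
  have : ∀ᶠ n in Filter.atBot, ∀ t ∈ s, Φ n t = 0 :=
    (Filter.eventually_all_finset s).2 fun t _ => isLaurent_iff.1 (hΦ t)
  filter_upwards [this] with n hn t ht
  exact (Submodule.span_le.2 (fun t ht => hn t ht) : _ ≤ LinearMap.ker (Φ n)) ht

theorem fg_range {F : Submodule ℂ M} (hF : F.FG) {Φ : ℤ → M →ₗ[ℂ] N}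
    (hΦ : ∀ t, IsTensorLaurent fun n => Φ n t) :
    ∃ F' : Submodule ℂ N, F'.FG ∧ ∀ n, ∀ t ∈ F, Φ n t ∈ F' := by
  obtain ⟨s, rfl⟩ := hF
  choose F' hF' hΦ' using fun t => (hΦ t).2
  refine ⟨⨆ t ∈ s, F' t, Submodule.fg_biSup s _ fun t _ => hF' t, fun n t ht => ?_⟩
  have key : Submodule.span ℂ (s : Set M) ≤ Submodule.comap (Φ n) (⨆ t ∈ s, F' t) :=
    Submodule.span_le.2 fun t ht => (le_biSup F' (show t ∈ s from ht)) (hΦ' t n)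
  exact key ht

theorem fg_le_of_monotone {F : Submodule ℂ M} (hF : F.FG) {P : ℕ → Submodule ℂ M}
    (hP : Monotone P) (h : ∀ t, ∃ k, t ∈ P k) : ∃ k, F ≤ P k := by
  obtain ⟨s, rfl⟩ := hF
  choose k hk using h
  exact ⟨s.sup k, Submodule.span_le.2 fun t ht => hP (Finset.le_sup (f := k) ht) (hk t)⟩

theorem finsum_mem_of_forall {α : Type*} {F : Submodule ℂ M} {f : α → M} (h : ∀ i, f i ∈ F) :
    ∑ᶠ i, f i ∈ F :=
  finsum_induction (· ∈ F) F.zero_mem (fun _ _ => F.add_mem) h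

theorem tl_map {a : ℤ → M} (ha : IsTensorLaurent a) (f : M →ₗ[ℂ] N) :
    IsTensorLaurent fun n => f (a n) := by
  obtain ⟨⟨N, h⟩, F, hF, hF'⟩ := ha
  exact ⟨⟨N, fun n hn => by simp [h n hn]⟩, F.map f, hF.map f,
    fun n => Submodule.mem_map_of_mem (hF' n)⟩

theorem tl_smul {a : ℤ → M} (ha : IsTensorLaurent a) (f : ℤ → ℂ) :
    IsTensorLaurent fun n => f n • a n := by
  obtain ⟨⟨N, h⟩, F, hF, hF'⟩ := ha
  exact ⟨⟨N, fun n hn => by simp [h n hn]⟩, F, hF, fun n => F.smul_mem _ (hF' n)⟩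

theorem tl_shift {a : ℤ → M} (ha : IsTensorLaurent a) (k : ℤ) :
    IsTensorLaurent fun n => a (n + k) := by
  obtain ⟨⟨N, h⟩, F, hF, hF'⟩ := ha
  exact ⟨⟨N - k, fun n hn => h _ (by omega)⟩, F, hF, fun n => hF' _⟩

theorem tl_add {a b : ℤ → M} (ha : IsTensorLaurent a) (hb : IsTensorLaurent b) :
    IsTensorLaurent fun n => a n + b n := by
  obtain ⟨⟨N, h⟩, F, hF, hF'⟩ := ha
  obtain ⟨⟨N₁, h₁⟩, F₁, hF₁, hF₁'⟩ := hb
  exact ⟨⟨min N N₁, fun n hn => by simp [h n (by omega), h₁ n (by omega)]⟩, F ⊔ F₁, hF.sup hF₁,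
    fun n => Submodule.add_mem_sup (hF' n) (hF₁' n)⟩

theorem tl_sub {a b : ℤ → M} (ha : IsTensorLaurent a) (hb : IsTensorLaurent b) :
    IsTensorLaurent fun n => a n - b n := by
  have := tl_add ha (tl_smul hb fun _ => -1)
  simpa [sub_eq_add_neg] using this

theorem isTensorLaurent_single (t : M) : IsTensorLaurent fun n : ℤ => if n = 0 then t else 0 :=
  ⟨⟨0, fun n hn => if_neg hn.ne⟩, Submodule.span ℂ {t}, Submodule.fg_span_singleton t,
    fun n => by
      dsimp only
      split_ifs
      · exact Submodule.mem_span_singleton_self t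
      · exact Submodule.zero_mem _⟩

theorem tl_exists_repr {ι : Type*} (b : Module.Basis ι ℂ M) {a : ℤ → M}
    (ha : IsTensorLaurent a) :
    ∃ s : Finset ι, (∀ n, a n = ∑ i ∈ s, b.repr (a n) i • b i) ∧
      ∀ i, IsLaurent fun n => b.repr (a n) i := by
  obtain ⟨⟨N, h⟩, F, ⟨g, rfl⟩, hF'⟩ := ha
  classical
  refine ⟨g.biUnion fun t => (b.repr t).support, fun n => ?_, fun i => ⟨N, fun n hn => ?_⟩⟩
  · set s := g.biUnion fun t => (b.repr t).support
    have key : Submodule.span ℂ (g : Set M) ≤ (Finsupp.supported ℂ ℂ (s : Set ι)).comap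
        b.repr.toLinearMap := by
      refine Submodule.span_le.2 fun t ht => ?_
      change ((b.repr t).support : Set ι) ⊆ (s : Set ι)
      exact Finset.coe_subset.2 (Finset.subset_biUnion_of_mem (fun t => (b.repr t).support) ht)
    have h2 : (b.repr (a n)).support ⊆ s := Finset.coe_subset.1 (key (hF' n))
    conv_lhs => rw [← b.linearCombination_repr (a n), Finsupp.linearCombination_apply]
    exact Finsupp.sum_of_support_subset _ h2 _ (by simp)
  · simp [h n hn]

/-- The pointwise finite sum of a family of linear maps. -/
def finsumLin {ι : Type*} (f : ι → M →ₗ[ℂ] N) (h : ∀ x, {i | f i x ≠ 0}.Finite) :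
    M →ₗ[ℂ] N where
  toFun x := ∑ᶠ i, f i x
  map_add' x y := by
    rw [← finsum_add_distrib (h x) (h y)]
    simp
  map_smul' c x := by
    rw [RingHom.id_apply, smul_finsum]
    simp

/-- The coefficients of `Φ(x) a(x)`. -/
def conv (Φ : ℤ → M →ₗ[ℂ] N) (a : ℤ → M) (n : ℤ) : N := ∑ᶠ c, Φ (n - c) (a c)

theorem conv_finite {Φ : ℤ → M →ₗ[ℂ] N} {a : ℤ → M}
    (h : ∀ᶠ n in Filter.atBot, ∀ c, Φ n (a c) = 0) (ha : IsLaurent a) (n : ℤ) :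
    {c | Φ (n - c) (a c) ≠ 0}.Finite := by
  refine finite_int_of_bounds ?_ ?_
  · filter_upwards [isLaurent_iff.1 ha] with c hc
    simp [hc]
  · filter_upwards [eventually_atTop_sub n h] with c hc
    simp [hc]

theorem conv_isLaurent {Φ : ℤ → M →ₗ[ℂ] N} {a : ℤ → M}
    (h : ∀ᶠ n in Filter.atBot, ∀ c, Φ n (a c) = 0) (ha : IsLaurent a) : IsLaurent (conv Φ a) := by
  obtain ⟨N₁, h₁⟩ := Filter.eventually_atBot.1 h
  obtain ⟨N₂, h₂⟩ := ha
  refine ⟨N₁ + N₂, fun n hn => finsum_eq_zero_of_forall_eq_zero fun c => ?_⟩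
  rcases lt_or_ge c N₂ with hc | hc
  · rw [h₂ c hc, map_zero]
  · exact h₁ _ (by omega) c

theorem tl_trunc {Φ : ℤ → M →ₗ[ℂ] N} {a : ℤ → M} (ha : IsTensorLaurent a)
    (hΦ : ∀ t, IsLaurent fun n => Φ n t) : ∀ᶠ n in Filter.atBot, ∀ c, Φ n (a c) = 0 := by
  obtain ⟨-, F, hF, hF'⟩ := ha
  filter_upwards [fg_trunc hF hΦ] with n hn c using hn _ (hF' c)

theorem tl_conv {Φ : ℤ → M →ₗ[ℂ] N} {a : ℤ → M} (ha : IsTensorLaurent a)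
    (hΦ : ∀ t, IsTensorLaurent fun n => Φ n t) : IsTensorLaurent (conv Φ a) := by
  refine ⟨conv_isLaurent (tl_trunc ha fun t => (hΦ t).1) ha.1, ?_⟩
  obtain ⟨-, F, hF, hF'⟩ := ha
  obtain ⟨F', h1, h2⟩ := fg_range hF hΦ
  exact ⟨F', h1, fun n => finsum_mem_of_forall fun c => h2 _ _ (hF' c)⟩

theorem conv_map {Φ : ℤ → M →ₗ[ℂ] N} {a : ℤ → M}
    (h : ∀ᶠ n in Filter.atBot, ∀ c, Φ n (a c) = 0) (ha : IsLaurent a) (f : N →ₗ[ℂ] L) (n : ℤ) :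
    conv (fun n => f.comp (Φ n)) a n = f (conv Φ a n) :=
  (map_finsum f (conv_finite h ha n)).symm

theorem conv_add {Φ : ℤ → M →ₗ[ℂ] N} {a b : ℤ → M} {n : ℤ}
    (ha : {c | Φ (n - c) (a c) ≠ 0}.Finite) (hb : {c | Φ (n - c) (b c) ≠ 0}.Finite) :
    conv Φ (fun c => a c + b c) n = conv Φ a n + conv Φ b n := by
  unfold conv
  rw [← finsum_add_distrib ha hb]
  simp

theorem conv_sub {Φ : ℤ → M →ₗ[ℂ] N} {a b : ℤ → M} {n : ℤ}
    (ha : {c | Φ (n - c) (a c) ≠ 0}.Finite) (hb : {c | Φ (n - c) (b c) ≠ 0}.Finite) :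
    conv Φ (fun c => a c - b c) n = conv Φ a n - conv Φ b n := by
  unfold conv
  rw [← finsum_sub_distrib ha hb]
  simp

theorem conv_sub21_right {G : ℤ → ℤ → ℤ → M} (hG : Good G) {Φ : ℤ → M →ₗ[ℂ] N}
    (hΦ : ∀ c, ∀ᶠ n in Filter.atBot, ∀ p b, Φ n (G c p b) = 0) (m n : ℤ) :
    conv Φ (sub21 G m) n = sub21 (fun c p b => conv Φ (G c p) b) m n := by
  unfold conv
  simp only [sub21_eq_finsum]
  rw [finsum_map_finsum (fun d => Φ (n - d)) _ fun d => hG.finite_support' m d]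
  · refine finsum_congr fun x => ?_
    symm
    rw [smul_finsum, ← finsum_shift (-x.2 + x.1)]
    refine finsum_congr fun d => ?_
    rw [map_smul, show n - x.2 + x.1 - (d + (-x.2 + x.1)) = n - d by ring,
      show d + (-x.2 + x.1) = d - x.2 + x.1 by ring]
  · obtain ⟨c₀, hc₀⟩ := Filter.eventually_atBot.1 hG.fst
    obtain ⟨p₀, hp₀⟩ := Filter.eventually_atBot.1 hG.mid
    obtain ⟨b₀, hb₀⟩ := Filter.eventually_atBot.1
      ((Filter.eventually_all_finite (Set.finite_Icc c₀ m)).2 fun c _ => hG.lst c)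
    obtain ⟨n₀, hn₀⟩ := Filter.eventually_atBot.1
      ((Filter.eventually_all_finite (Set.finite_Icc c₀ m)).2 fun c _ => hΦ c)
    refine finite_prod_of_fibers (p := fun (d : ℤ) (x : ℤ × ℤ) => Φ (n - d) (bz x.2 x.1 •
      G (m - x.1) x.2 (d - x.2 + x.1)) ≠ 0) ?_ fun d => ?_
    · refine (Set.finite_Icc (p₀ - (m - c₀) + b₀) (n - n₀)).subset ?_
      rintro d ⟨⟨i, p⟩, h⟩
      simp only at h
      have hi : 0 ≤ i := by
        by_contra hc
        exact h (by simp [bz_neg (show i < 0 by omega)])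
      have hi' : c₀ ≤ m - i := by
        by_contra hc
        exact h (by simp [hc₀ (m - i) (by omega)])
      have hp : p₀ ≤ p := by
        by_contra hc
        exact h (by simp [hp₀ p (by omega)])
      have hb : b₀ ≤ d - p + i := by
        by_contra hc
        exact h (by rw [hb₀ _ (by omega) (m - i) ⟨hi', by omega⟩, smul_zero, map_zero])
      have hn : n₀ ≤ n - d := by
        by_contra hc
        exact h (by rw [map_smul, hn₀ _ (by omega) (m - i) ⟨hi', by omega⟩, smul_zero])
      exact ⟨by omega, by omega⟩
    · refine (hG.finite_support' m d).subset fun x hx h0 => hx ?_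
      rw [h0, map_zero]

theorem conv_sub21_left {G : ℤ → ℤ → ℤ → M} (hG : Good G) {Φ : ℤ → M →ₗ[ℂ] N}
    (hΦ : ∀ᶠ n in Filter.atBot, ∀ c p b, Φ n (G c p b) = 0) (m n : ℤ) :
    conv Φ (fun d => sub21 G d n) m
      = sub21 (fun c p b => conv Φ (fun d => G d p b) c) m n := by
  unfold conv
  simp only [sub21_eq_finsum]
  rw [finsum_map_finsum (fun d => Φ (m - d)) _ fun d => hG.finite_support' d n]
  · refine finsum_congr fun x => ?_
    symm
    rw [smul_finsum, ← finsum_shift (-x.1)]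
    refine finsum_congr fun d => ?_
    rw [map_smul, show m - x.1 - (d + -x.1) = m - d by ring, ← sub_eq_add_neg]
  · obtain ⟨c₀, hc₀⟩ := Filter.eventually_atBot.1 hG.fst
    obtain ⟨n₀, hn₀⟩ := Filter.eventually_atBot.1 hΦ
    refine finite_prod_of_fibers (p := fun (d : ℤ) (x : ℤ × ℤ) => Φ (m - d) (bz x.2 x.1 •
      G (d - x.1) x.2 (n - x.2 + x.1)) ≠ 0) ?_ fun d => ?_
    · refine (Set.finite_Icc c₀ (m - n₀)).subset ?_
      rintro d ⟨⟨i, p⟩, h⟩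
      simp only at h
      have hi : 0 ≤ i := by
        by_contra hc
        exact h (by simp [bz_neg (show i < 0 by omega)])
      have hi' : c₀ ≤ d - i := by
        by_contra hc
        exact h (by simp [hc₀ (d - i) (by omega)])
      have hn : n₀ ≤ m - d := by
        by_contra hc
        exact h (by rw [map_smul, hn₀ _ (by omega), smul_zero])
      exact ⟨by omega, by omega⟩
    · refine (hG.finite_support' d n).subset fun x hx h0 => hx ?_
      rw [h0, map_zero]

theorem finsum_bz_mul_bz (m p r : ℤ) :
    ∑ᶠ j : ℤ, bz (m + j) j * (-1) ^ (r - j) * bz p (r - j) = bz (m + r - p) r := by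
  rcases lt_or_ge r 0 with hr | hr
  · rw [bz_neg hr, finsum_eq_zero_of_forall_eq_zero]
    intro j
    rcases lt_or_ge j 0 with h | h
    · simp [bz_neg h]
    · simp [bz_neg (show r - j < 0 by omega)]
  obtain ⟨R, rfl⟩ := Int.eq_ofNat_of_zero_le hr
  have h1 : ∀ j : ℕ, bz (m + j) j = (-1) ^ j * bz (-m - 1) j := by
    intro j
    have := Ring.choose_neg (m + 1) j
    rw [show m + 1 + j - 1 = m + j by ring, neg_add, ← sub_eq_add_neg] at this
    simp only [bz, Int.natCast_nonneg, if_true, Int.toNat_natCast, this]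
    rw [Int.negOnePow_def, Units.smul_def]
    simp [← mul_assoc, ← mul_pow]
  have h2 : bz (m + R - p) R = (-1) ^ R * bz (-m - 1 + p) R := by
    have := Ring.choose_neg (m + 1 - p) R
    rw [show m + 1 - p + R - 1 = m + R - p by ring, show -(m + 1 - p) = -m - 1 + p by ring] at this
    simp only [bz, Int.natCast_nonneg, if_true, Int.toNat_natCast, this]
    rw [Int.negOnePow_def, Units.smul_def]
    simp [← mul_assoc, ← mul_pow]
  have h3 : bz (-m - 1 + p) R
      = ∑ ij ∈ Finset.HasAntidiagonal.antidiagonal R, bz (-m - 1) ij.1 * bz p ij.2 := by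
    simp only [bz, Int.natCast_nonneg, if_true, Int.toNat_natCast]
    rw [Ring.add_choose_eq R (Commute.all _ _)]
    push_cast
    rfl
  rw [h2, h3, Finset.mul_sum, Finset.Nat.sum_antidiagonal_eq_sum_range_succ_mk,
    ← finsum_nat_eq_int (f := fun j => bz (m + j) j * (-1) ^ ((R : ℤ) - j) * bz p (R - j)),
    finsum_eq_sum_of_support_subset (s := Finset.range (R + 1))]
  · refine Finset.sum_congr rfl fun j hj => ?_
    have : j ≤ R := by simpa [Nat.lt_succ_iff] using hj
    rw [h1, sg_sub, zpow_natCast, zpow_natCast, Nat.cast_sub this]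
    have : ((-1 : ℂ) ^ j) * (-1) ^ j = 1 := by rw [← mul_pow]; simp
    linear_combination ((-1) ^ R * bz (-m - 1) j * bz p (R - j)) * this
  · intro j hj
    simp only [Finset.coe_range, Set.mem_Iio]
    by_contra hc
    exact hj (by simp [bz_neg (show (R : ℤ) - j < 0 by omega)])
  · intro j hj
    simp [bz_neg hj]

theorem finsum_sub21_shift {H : ℤ → ℤ → ℤ → M} (hH : Good H) (m n : ℤ) :
    ∑ᶠ j : ℤ, (bz (m + j) j * (-1) ^ (n - j)) • sub21 H (n - j) (m + j)
      = ∑ᶠ x : ℤ × ℤ, ((-1) ^ x.1 * bz x.2 (n - x.1)) • H x.1 (m + n - x.1 - x.2) x.2 := by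
  have e : ∀ j : ℤ, sub21 H (n - j) (m + j) = ∑ᶠ x : ℤ × ℤ,
      bz (m + n - x.1 - x.2) (n - x.1 - j) • H x.1 (m + n - x.1 - x.2) x.2 := by
    intro j
    refine finsum_congr fun x => ?_
    rw [show n - j + (m + j) = m + n by ring, show n - j - x.1 = n - x.1 - j by ring]
  have fin : ∀ j : ℤ, {x : ℤ × ℤ |
      bz (m + n - x.1 - x.2) (n - x.1 - j) • H x.1 (m + n - x.1 - x.2) x.2 ≠ 0}.Finite := by
    intro j
    refine (hH.finite_support (n - j) (m + j)).subset fun x hx => ?_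
    rw [Function.mem_support, show n - j + (m + j) = m + n by ring,
      show n - j - x.1 = n - x.1 - j by ring]
    exact hx
  simp only [e]
  refine (finsum_map_finsum
    (fun j : ℤ => (bz (m + j) j * (-1) ^ (n - j)) • (LinearMap.id : M →ₗ[ℂ] M))
    (fun (j : ℤ) (x : ℤ × ℤ) =>
      bz (m + n - x.1 - x.2) (n - x.1 - j) • H x.1 (m + n - x.1 - x.2) x.2) fin ?_).trans ?_
  rotate_left
  · refine finsum_congr fun x => ?_
    have := finsum_bz_mul_bz m (m + n - x.1 - x.2) (n - x.1)
    rw [show m + (n - x.1) - (m + n - x.1 - x.2) = x.2 by ring] at this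
    rw [← this, ← smul_eq_mul, smul_finsum, finsum_smul]
    refine finsum_congr fun j => ?_
    simp only [LinearMap.smul_apply, LinearMap.id_apply, smul_smul]
    congr 1
    rw [smul_eq_mul, show n - x.1 - j = n - j - x.1 by ring, sg_sub (n - j) x.1]
    have := sg_mul_self x.1
    linear_combination (-bz (m + j) j * (-1) ^ (n - j) *
      bz (m + n - x.1 - x.2) (n - j - x.1)) * this
  · obtain ⟨c₀, hc₀⟩ := Filter.eventually_atBot.1 hH.fst
    refine finite_prod_of_fibers (p := fun (j : ℤ) (x : ℤ × ℤ) => ((bz (m + j) j * (-1) ^ (n - j)) •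
      (LinearMap.id : M →ₗ[ℂ] M)) (bz (m + n - x.1 - x.2) (n - x.1 - j) •
      H x.1 (m + n - x.1 - x.2) x.2) ≠ 0) ?_ fun j => ?_
    · refine (Set.finite_Icc 0 (n - c₀)).subset ?_
      rintro j ⟨x, h⟩
      have hj : 0 ≤ j := by
        by_contra hc
        exact h (by simp [bz_neg (show j < 0 by omega)])
      have hc : c₀ ≤ x.1 := by
        by_contra hc
        exact h (by rw [hc₀ x.1 (by omega), smul_zero, map_zero])
      have hr : 0 ≤ n - x.1 - j := by
        by_contra hc
        exact h (by rw [bz_neg (show n - x.1 - j < 0 by omega), zero_smul, map_zero])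
      exact ⟨hj, by omega⟩
    · refine (fin j).subset fun x hx h0 => hx ?_
      rw [h0, map_zero]

end FiniteGeneration

section Leibniz

variable {M N : Type*} [AddCommGroup M] [Module ℂ M] [AddCommGroup N] [Module ℂ N]

theorem add_one_ne_zero_of_nonneg {j : ℤ} (hj : 0 ≤ j) : (j : ℂ) + 1 ≠ 0 := by
  have : j + 1 ≠ 0 := by omega
  exact_mod_cast this

theorem dz_map_leibniz {X : ℤ → M →ₗ[ℂ] N} {D : M →ₗ[ℂ] M} {D' : N →ₗ[ℂ] N}
    (h : ∀ m t, X m (D t) = D' (X m t) + ((m : ℂ) + 1) • X (m + 1) t) (m r : ℤ) (t : M) :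
    X m (dz D r t) = ∑ᶠ i : ℤ, bz (m + i) i • dz D' (r - i) (X (m + i) t) := by
  have := ode_solution D' (fun m n => X m (dz D n t)) (fun m n => ?_) (fun m n hn => ?_) m r
  · simpa using this
  · rw [← map_smul, dz_succ, h]
  · simp [dz_neg D hn]

theorem dz_comp_apply {D : M →ₗ[ℂ] M} (k : ℤ) (f : M →ₗ[ℂ] N) (t : M) :
    dz (LinearMap.lcomp ℂ N D) k f t = f (dz D k t) := by
  rcases lt_or_ge k 0 with hk | hk
  · simp [dz_neg _ hk]
  · obtain ⟨n, rfl⟩ := Int.eq_ofNat_of_zero_le hk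
    rw [dz_natCast, dz_natCast]
    simp only [LinearMap.smul_apply, map_smul]
    congr 1
    induction n generalizing t with
    | zero => simp
    | succ n ih =>
      rw [pow_succ', Module.End.mul_apply, pow_succ, Module.End.mul_apply, ← ih _ (by omega)]
      rfl

theorem dz_leibniz {X : ℤ → M →ₗ[ℂ] N} {D : M →ₗ[ℂ] M} {D' : N →ₗ[ℂ] N}
    (h : ∀ m t, D' (X m t) = X m (D t) + ((m : ℂ) + 1) • X (m + 1) t) (m r : ℤ) (t : M) :
    dz D' r (X m t) = ∑ᶠ i : ℤ, bz (m + i) i • X (m + i) (dz D (r - i) t) := by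
  have := ode_solution (LinearMap.lcomp ℂ N D) (fun m n => (dz D' n).comp (X m))
    (fun m n => ?_) (fun m n hn => ?_) m r
  · have := congr($this t)
    simp only [LinearMap.comp_apply] at this
    rw [this]
    have h2 := map_finsum (LinearMap.applyₗ (R := ℂ) t)
      (f := fun i => bz (m + i) i • dz (LinearMap.lcomp ℂ N D) (r - i) ((dz D' 0).comp (X (m + i))))
      (Set.Finite.subset (Set.finite_Icc 0 r) fun i hi => ?_)
    · rw [LinearMap.applyₗ_apply_apply] at h2
      rw [h2]
      refine finsum_congr fun i => ?_
      rw [LinearMap.applyₗ_apply_apply, LinearMap.smul_apply, dz_comp_apply]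
      simp
    · constructor
      · by_contra hc
        exact hi (by simp [bz_neg (show i < 0 by omega)])
      · by_contra hc
        exact hi (by simp [dz_neg _ (show r - i < 0 by omega)])
  · ext t
    simp only [LinearMap.smul_apply, LinearMap.add_apply, LinearMap.comp_apply,
      LinearMap.lcomp_apply]
    rw [dz_succ, ← dz_comm, h, map_add, map_smul]
  · simp [dz_neg D' hn]

end Leibniz

section Twist

variable {M N : Type*} [AddCommGroup M] [Module ℂ M] [AddCommGroup N] [Module ℂ N]

theorem alternating_dz_mul_dz (D : M →ₗ[ℂ] M) (n : ℤ) (x : M) :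
    ∑ᶠ c : ℤ, (-1 : ℂ) ^ c • dz D (n - c) (dz D c x) = if n = 0 then x else 0 := by
  have fin : ∀ n k : ℤ, (Function.support fun c : ℤ =>
      (-1 : ℂ) ^ c • dz D (n - c) (dz D (c - k) x)).Finite := by
    intro n k
    refine (Set.finite_Icc k n).subset fun c hc => ⟨?_, ?_⟩
    · by_contra h
      exact hc (by simp [dz_neg _ (show c - k < 0 by omega)])
    · by_contra h
      exact hc (by simp [dz_neg _ (show n - c < 0 by omega)])
  have neg : ∀ n < 0, ∑ᶠ c : ℤ, (-1 : ℂ) ^ c • dz D (n - c) (dz D c x) = 0 := by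
    intro n hn
    refine finsum_eq_zero_of_forall_eq_zero fun c => ?_
    rcases lt_or_ge c 0 with h | h
    · simp [dz_neg _ h]
    · simp [dz_neg _ (show n - c < 0 by omega)]
  have step : ∀ n : ℤ, ((n : ℂ) + 1) •
      ∑ᶠ c : ℤ, (-1 : ℂ) ^ c • dz D (n + 1 - c) (dz D c x) = 0 := by
    intro n
    have e : ∀ c : ℤ, ((n : ℂ) + 1) • (-1 : ℂ) ^ c • dz D (n + 1 - c) (dz D c x)
        = D ((-1 : ℂ) ^ c • dz D (n - c) (dz D c x))
          - D ((-1 : ℂ) ^ (c - 1) • dz D (n + 1 - c) (dz D (c - 1) x)) := by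
      intro c
      have h1 := dz_succ D (n - c) (dz D c x)
      have h2 := dz_succ D (c - 1) x
      rw [show n - c + 1 = n + 1 - c by ring] at h1
      rw [sub_add_cancel] at h2
      rw [map_smul, map_smul, ← h1, ← dz_comm, ← h2, map_smul, sg_sub c 1]
      push_cast
      module
    rw [smul_finsum]
    simp only [e]
    have f1 : (Function.support fun c : ℤ =>
        D ((-1 : ℂ) ^ c • dz D (n - c) (dz D c x))).Finite :=
      (fin n 0).subset fun c hc h0 => hc (by
        simp only [sub_zero] at h0
        simp only [h0, map_zero])
    have f2 : (Function.support fun c : ℤ =>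
      D ((-1 : ℂ) ^ (c - 1) • dz D (n + 1 - c) (dz D (c - 1) x))).Finite :=
      (fin (n + 1) 1).subset fun c hc h0 => hc (by
        simp only [smul_eq_zero, sg_ne_zero, false_or] at h0
        simp [h0])
    rw [finsum_sub_distrib f1 f2, sub_eq_zero,
      ← finsum_shift (f := fun c : ℤ => D ((-1 : ℂ) ^ (c - 1) •
        dz D (n + 1 - c) (dz D (c - 1) x))) 1]
    refine finsum_congr fun c => ?_
    rw [add_sub_cancel_right, show n + 1 - (c + 1) = n - c by ring]
  rcases lt_trichotomy n 0 with h | rfl | h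
  · rw [neg n h, if_neg h.ne]
  · rw [if_pos rfl, finsum_eq_single _ 0]
    · simp
    · intro c hc
      rcases lt_or_ge c 0 with h | h
      · simp [dz_neg _ h]
      · rw [dz_neg _ (show 0 - c < 0 by omega)]
        simp
  · rw [if_neg h.ne']
    have := step (n - 1)
    rw [sub_add_cancel] at this
    exact (smul_eq_zero.1 this).resolve_left (add_one_ne_zero_of_nonneg (by omega))

/-- The coefficients of `e^{xD} F(-x)`. -/
def twist (D : M →ₗ[ℂ] M) (F : ℤ → M) : ℤ → M := conv (dz D) fun p => (-1 : ℂ) ^ p • F p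

theorem conv_dz_finite (D : M →ₗ[ℂ] M) {F : ℤ → M} (hF : IsLaurent F) (n : ℤ) :
    {c | dz D (n - c) (F c) ≠ 0}.Finite :=
  conv_finite
    (Filter.eventually_atBot.2 ⟨-1, fun j hj c => by simp [dz_neg D (show j < 0 by omega)]⟩)
    hF n

theorem isLaurent_smul {F : ℤ → M} (hF : IsLaurent F) (f : ℤ → ℂ) :
    IsLaurent fun p => f p • F p := by
  obtain ⟨N, h⟩ := hF
  exact ⟨N, fun n hn => by simp [h n hn]⟩

theorem expD_twist (D : M →ₗ[ℂ] M) (F : ℤ → M) (n : ℤ) :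
    expD D (fun p => (-1 : ℂ) ^ p • F p) n = twist D F n := by
  rw [expD_eq, twist, conv, ← finsum_reflect n]
  refine finsum_congr fun c => ?_
  rw [sub_sub_cancel]

theorem twist_twist (D : M →ₗ[ℂ] M) {F : ℤ → M} (hF : IsLaurent F) : twist D (twist D F) = F := by
  funext n
  unfold twist conv
  have e : ∀ c : ℤ, dz D (n - c) ((-1 : ℂ) ^ c • ∑ᶠ b, dz D (c - b) ((-1 : ℂ) ^ b • F b))
      = ((-1 : ℂ) ^ c • dz D (n - c)) (∑ᶠ b, dz D (c - b) ((-1 : ℂ) ^ b • F b)) := by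
    intro c
    simp
  simp only [e]
  rw [finsum_map_finsum (fun c : ℤ => (-1 : ℂ) ^ c • dz D (n - c)) _
    fun c => conv_dz_finite D (isLaurent_smul hF _) c]
  · rw [finsum_eq_single _ n]
    · rw [← finsum_shift n]
      have := alternating_dz_mul_dz D 0 (F n)
      rw [if_pos rfl] at this
      refine Eq.trans (finsum_congr fun c => ?_) this
      simp only [map_smul, LinearMap.smul_apply, smul_smul, add_sub_cancel_right]
      rw [show n - (c + n) = 0 - c by ring, sg_add, mul_left_comm, sg_mul_self, mul_one]
    · intro b hb
      rw [← finsum_shift b]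
      have := alternating_dz_mul_dz D (n - b) (F b)
      rw [if_neg (by omega)] at this
      refine Eq.trans (finsum_congr fun c => ?_) this
      simp only [map_smul, LinearMap.smul_apply, smul_smul, add_sub_cancel_right]
      rw [show n - (c + b) = n - b - c by ring, sg_add, mul_left_comm, sg_mul_self, mul_one]
  · obtain ⟨N, hN⟩ := hF
    refine finite_prod_of_fibers (p := fun (c b : ℤ) => ((-1 : ℂ) ^ c • dz D (n - c))
      (dz D (c - b) ((-1 : ℂ) ^ b • F b)) ≠ 0) ?_ fun c => ?_
    · refine (Set.finite_Icc N n).subset ?_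
      rintro c ⟨b, h⟩
      have h1 : c ≤ n := by
        by_contra hc
        exact h (by simp [dz_neg D (show n - c < 0 by omega)])
      have h2 : b ≤ c := by
        by_contra hc
        exact h (by simp [dz_neg D (show c - b < 0 by omega)])
      have h3 : N ≤ b := by
        by_contra hc
        exact h (by simp [hN b (by omega)])
      exact ⟨by omega, by omega⟩
    · refine (conv_dz_finite D (isLaurent_smul ⟨N, hN⟩ fun b => (-1 : ℂ) ^ b) c).subset
        fun b hb h0 => hb ?_
      rw [h0, map_zero]

theorem twist_map_comm (D : M →ₗ[ℂ] M) {F : ℤ → M} (hF : IsLaurent F) (n : ℤ) :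
    twist D (fun p => D (F p)) n = D (twist D F n) := by
  unfold twist conv
  rw [map_finsum D (conv_dz_finite D (isLaurent_smul hF _) n)]
  refine finsum_congr fun c => ?_
  simp only [map_smul, dz_comm]

theorem twist_sub (D : M →ₗ[ℂ] M) {F G : ℤ → M} (hF : IsLaurent F) (hG : IsLaurent G) (n : ℤ) :
    twist D (fun p => F p - G p) n = twist D F n - twist D G n := by
  unfold twist
  rw [← conv_sub (conv_dz_finite D (isLaurent_smul hF _) n)
    (conv_dz_finite D (isLaurent_smul hG _) n)]
  simp only [smul_sub]

theorem twist_deriv (D : M →ₗ[ℂ] M) {F : ℤ → M} (hF : IsLaurent F) (n : ℤ) :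
    ((n : ℂ) + 1) • twist D F (n + 1)
      = D (twist D F n) - twist D (fun p => ((p : ℂ) + 1) • F (p + 1)) n := by
  unfold twist conv
  have hF' := isLaurent_smul hF fun p => (-1 : ℂ) ^ p
  have f1 : (Function.support fun c : ℤ => ((n : ℂ) + 1 - c) •
      dz D (n + 1 - c) ((-1 : ℂ) ^ c • F c)).Finite :=
    (conv_dz_finite D hF' (n + 1)).subset fun c hc h0 => hc (by simp only [h0, smul_zero])
  have f2 : (Function.support fun c : ℤ => (c : ℂ) •
      dz D (n + 1 - c) ((-1 : ℂ) ^ c • F c)).Finite :=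
    (conv_dz_finite D hF' (n + 1)).subset fun c hc h0 => hc (by simp only [h0, smul_zero])
  have e : ∀ c : ℤ, ((n : ℂ) + 1) • dz D (n + 1 - c) ((-1 : ℂ) ^ c • F c)
      = ((n : ℂ) + 1 - c) • dz D (n + 1 - c) ((-1 : ℂ) ^ c • F c)
        + (c : ℂ) • dz D (n + 1 - c) ((-1 : ℂ) ^ c • F c) := fun c => by module
  rw [smul_finsum]
  simp only [e]
  rw [finsum_add_distrib f1 f2, map_finsum D (conv_dz_finite D hF' n),
    sub_eq_add_neg, ← finsum_neg_distrib,
    ← finsum_shift (f := fun c : ℤ => (c : ℂ) • dz D (n + 1 - c) ((-1 : ℂ) ^ c • F c)) 1]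
  congr 1
  · refine finsum_congr fun c => ?_
    have := dz_succ D (n - c) ((-1 : ℂ) ^ c • F c)
    rw [← this, show n - c + 1 = n + 1 - c by ring]
    push_cast
    module
  · refine finsum_congr fun c => ?_
    rw [show n + 1 - (c + 1) = n - c by ring, sg_add]
    push_cast
    simp only [map_smul]
    module

end Twist

section Derivation

variable {V : Type*} [AddCommGroup V] [Module ℂ V]

theorem substAdd02_eq (A : ℤ → ℤ → V) (a b : ℤ) :
    substAdd02 A a b = ∑ᶠ i : ℤ, bz (a + i) i • A (a + i) (b - i) := by
  rw [← finsum_nat_eq_int]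
  · exact finsum_congr fun i => by rw [bz_natCast]
  · intro i hi
    simp [bz_neg hi]

variable (𝒱 : NLVA V)

theorem Yc_apply (n : ℤ) (u v : V) : 𝒱.Yc n u v = 𝒱.Y u v n := rfl

theorem Y_smul_right (u v : V) (c : ℂ) (n : ℤ) : 𝒱.Y u (c • v) n = c • 𝒱.Y u v n := by
  rw [map_smul, Pi.smul_apply]

theorem Y_zero_right (u : V) (n : ℤ) : 𝒱.Y u 0 n = 0 := by
  rw [map_zero, Pi.zero_apply]

theorem D_apply (v : V) : 𝒱.D v = 𝒱.Y v 𝒱.one 1 := rfl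

theorem weak_assoc' (u v w : V) : ∃ k : ℕ,
    (addMul ^ k) (substAdd02 fun m n => 𝒱.Y u (𝒱.Y v w n) m)
      = (addMul ^ k) fun a b => 𝒱.Y (𝒱.Y u v a) w b := by
  obtain ⟨k, hk⟩ := 𝒱.weak_assoc u v w
  refine ⟨k, ?_⟩
  rw [← mulAddPow_eq, ← mulAddPow_eq]
  funext a b
  exact hk a b

theorem addMul_pow_binomial_sub (y : ℤ → V) (K : ℕ) :
    (addMul ^ K) (fun a b : ℤ => (bz (a + b) b - bz (a + b) a) • y (a + b))
      = fun a b : ℤ => (bz (a + b) b - bz (a + b) a) • y (a + b - K) := by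
  induction K with
  | zero => simp
  | succ K ih =>
    rw [pow_succ', Module.End.mul_apply, ih]
    funext a b
    rw [addMul_apply, show a - 1 + b = a + b - 1 by ring, show a + (b - 1) = a + b - 1 by ring,
      show a + b - 1 - (K : ℤ) = a + b - ((K + 1 : ℕ) : ℤ) by push_cast; ring, ← add_smul]
    congr 1
    have h1 := bz_add_one (a + b - 1) b
    have h2 := bz_add_one (a + b - 1) a
    rw [sub_add_cancel] at h1 h2
    rw [h1, h2]
    ring

theorem Y_D_left (v w : V) (n : ℤ) : 𝒱.Y (𝒱.D v) w n = ((n : ℂ) + 1) • 𝒱.Y v w (n + 1) := by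
  obtain ⟨k, hk⟩ := weak_assoc' 𝒱 v 𝒱.one w
  obtain ⟨N, hN⟩ := 𝒱.trunc v w
  have e1 : (substAdd02 fun m n => 𝒱.Y v (𝒱.Y 𝒱.one w n) m)
      = (fun a b : ℤ => (bz (a + b) b - bz (a + b) a) • 𝒱.Y v w (a + b))
        + fun a b : ℤ => bz (a + b) a • 𝒱.Y v w (a + b) := by
    funext a b
    rw [substAdd02_eq, finsum_eq_single _ b]
    · rw [sub_self, 𝒱.vacuum_left, if_pos rfl]
      simp only [Pi.add_apply]
      module
    · intro i hi
      rw [𝒱.vacuum_left, if_neg (by omega), Y_zero_right, smul_zero]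
  have e2 : (addMul ^ (-N).toNat)
      (fun a b : ℤ => (bz (a + b) b - bz (a + b) a) • 𝒱.Y v w (a + b)) = 0 := by
    rw [addMul_pow_binomial_sub]
    funext a b
    rcases lt_or_ge (a + b) 0 with h | h
    · rw [hN _ (by omega), smul_zero]
      rfl
    · rw [bz_symm h b, add_sub_cancel_right, sub_self, zero_smul]
      rfl
  have key : (fun a b => 𝒱.Y (𝒱.Y v 𝒱.one a) w b)
      = fun a b : ℤ => bz (a + b) a • 𝒱.Y v w (a + b) := by
    refine addMul_pow_cancel_left (k := k + (-N).toNat)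
      (Filter.eventually_atBot.2 ⟨-1, fun a ha b => ?_⟩)
      (Filter.eventually_atBot.2 ⟨-1, fun a ha b => ?_⟩) ?_
    · rw [𝒱.creation_reg v a (by omega)]
      simp
    · simp [bz_neg (show a < 0 by omega)]
    · rw [← addMul_pow_congr (Nat.le_add_right k _) hk, e1, map_add, add_eq_right,
        pow_add, Module.End.mul_apply, e2, map_zero]
  have := congr_fun (congr_fun key 1) n
  rw [D_apply, this, bz_one, add_comm 1 n]
  push_cast
  rfl

theorem D_Y (u v : V) (n : ℤ) :
    𝒱.D (𝒱.Y u v n) = 𝒱.Y u (𝒱.D v) n + ((n : ℂ) + 1) • 𝒱.Y u v (n + 1) := by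
  obtain ⟨k, hk⟩ := weak_assoc' 𝒱 u v 𝒱.one
  have key : (substAdd02 fun m n => 𝒱.Y u (𝒱.Y v 𝒱.one n) m)
      = fun a b => 𝒱.Y (𝒱.Y u v a) 𝒱.one b := by
    refine addMul_pow_cancel (k := k)
      (Filter.eventually_atBot.2 ⟨-1, fun b hb a => ?_⟩)
      (Filter.eventually_atBot.2 ⟨-1, fun b hb a => ?_⟩) hk
    · rw [substAdd02_eq]
      refine finsum_eq_zero_of_forall_eq_zero fun i => ?_
      rcases lt_or_ge i 0 with h | h
      · simp [bz_neg h]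
      · rw [𝒱.creation_reg v _ (by omega), Y_zero_right, smul_zero]
    · exact 𝒱.creation_reg _ _ (by omega)
  have := congr_fun (congr_fun key n) 1
  rw [D_apply, ← this, substAdd02_eq, finsum_eq_sum_of_support_subset (s := {0, 1})]
  · rw [Finset.sum_pair (by norm_num)]
    simp only [add_zero, bz_zero, one_smul, sub_zero, bz_one, sub_self, 𝒱.creation_zero, ← D_apply]
    push_cast
    rfl
  · intro i hi
    by_contra hc
    simp only [Finset.coe_pair, Set.mem_insert_iff, Set.mem_singleton_iff, not_or] at hc
    apply hi
    simp only
    rcases lt_or_ge i 0 with h | h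
    · simp [bz_neg h]
    · rw [𝒱.creation_reg v _ (by omega), Y_zero_right, smul_zero]

theorem D_one : 𝒱.D 𝒱.one = 0 := by
  rw [D_apply, 𝒱.vacuum_left, if_neg one_ne_zero]

theorem Y_one_right (u : V) (n : ℤ) : 𝒱.Y u 𝒱.one n = dz 𝒱.D n u := by
  rcases lt_or_ge n 0 with h | h
  · rw [dz_neg _ h, 𝒱.creation_reg u n h]
    rfl
  · obtain ⟨n, rfl⟩ := Int.eq_ofNat_of_zero_le h
    induction n with
    | zero => simp [𝒱.creation_zero]
    | succ n ih =>
      have h1 := D_Y 𝒱 u 𝒱.one n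
      rw [D_one, Y_zero_right, zero_add, ih (by omega), ← dz_succ] at h1
      push_cast
      exact (smul_right_injective V (add_one_ne_zero_of_nonneg (j := n) (by omega)) h1).symm

end Derivation

section Injectivity

variable {V : Type*} [AddCommGroup V] [Module ℂ V] (𝒱 : NLVA V)

/-- The coefficient of `x^n` in `Y(x) : V ⊗ V → V((x))`. -/
def Yt (n : ℤ) : V ⊗[ℂ] V →ₗ[ℂ] V := TensorProduct.lift (𝒱.Yc n)

@[simp] theorem Yt_tmul (n : ℤ) (u v : V) : Yt 𝒱 n (u ⊗ₜ v) = 𝒱.Y u v n := rfl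

theorem Yt_isLaurent (t : V ⊗[ℂ] V) : IsLaurent fun n => Yt 𝒱 n t := by
  induction t using TensorProduct.induction_on with
  | zero => exact ⟨0, fun n _ => map_zero _⟩
  | tmul u v => exact 𝒱.trunc u v
  | add s t hs ht =>
    obtain ⟨M, hM⟩ := hs
    obtain ⟨N, hN⟩ := ht
    exact ⟨min M N, fun n hn => by
      have h1 := hM n (by omega)
      have h2 := hN n (by omega)
      simp only at h1 h2 ⊢
      rw [map_add, h1, h2, add_zero]⟩

theorem Yt_rTensor_D (n : ℤ) (t : V ⊗[ℂ] V) :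
    Yt 𝒱 n (LinearMap.rTensor V 𝒱.D t) = ((n : ℂ) + 1) • Yt 𝒱 (n + 1) t := by
  induction t using TensorProduct.induction_on with
  | zero => simp
  | tmul u v => rw [LinearMap.rTensor_tmul, Yt_tmul, Yt_tmul, Y_D_left]
  | add s t hs ht => simp only [map_add, hs, ht, smul_add]

theorem D_Yt (n : ℤ) (t : V ⊗[ℂ] V) :
    𝒱.D (Yt 𝒱 n t) = Yt 𝒱 n (LinearMap.lTensor V 𝒱.D t) + ((n : ℂ) + 1) • Yt 𝒱 (n + 1) t := by
  induction t using TensorProduct.induction_on with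
  | zero => simp
  | tmul u v => rw [LinearMap.lTensor_tmul, Yt_tmul, Yt_tmul, D_Y, Yt_tmul]
  | add s t hs ht =>
    simp only [map_add, hs, ht, smul_add]
    abel

/-- The map `u ⊗ v ↦ Y(u)_c Y(v)_b 𝟙`. -/
def YYone (c b : ℤ) : V ⊗[ℂ] V →ₗ[ℂ] V := Yt 𝒱 c ∘ₗ LinearMap.lTensor V (dz 𝒱.D b)

theorem YYone_tmul (c b : ℤ) (u v : V) :
    YYone 𝒱 c b (u ⊗ₜ v) = 𝒱.Y u (𝒱.Y v 𝒱.one b) c := by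
  rw [YYone, LinearMap.comp_apply, LinearMap.lTensor_tmul, Yt_tmul, Y_one_right]

theorem YYone_neg (c : ℤ) {b : ℤ} (hb : b < 0) : YYone 𝒱 c b = 0 := by
  rw [YYone, dz_neg _ hb, LinearMap.lTensor_zero, LinearMap.comp_zero]

theorem YYone_zero (c : ℤ) (t : V ⊗[ℂ] V) : YYone 𝒱 c 0 t = Yt 𝒱 c t := by
  rw [YYone, dz_zero, LinearMap.comp_apply]
  congr 1
  exact LinearMap.lTensor_id_apply _ _ _

theorem D_YYone (c b : ℤ) (t : V ⊗[ℂ] V) :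
    𝒱.D (YYone 𝒱 c b t) = ((b : ℂ) + 1) • YYone 𝒱 c (b + 1) t
      + ((c : ℂ) + 1) • YYone 𝒱 (c + 1) b t := by
  induction t using TensorProduct.induction_on with
  | zero => simp
  | tmul u v =>
    simp only [YYone, LinearMap.comp_apply, LinearMap.lTensor_tmul, Yt_tmul]
    rw [D_Y, ← dz_succ, Y_smul_right]
  | add s t hs ht =>
    simp only [map_add, hs, ht, smul_add]
    abel

/-- The triple series whose substitution gives `Y(x₁)Y(-x₂)𝟙` applied to `a(x₁ + x₂)`. -/
def twoPoint (a : ℤ → V ⊗[ℂ] V) (b p c : ℤ) : V := (-1 : ℂ) ^ b • YYone 𝒱 c b (a p)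

variable {a : ℤ → V ⊗[ℂ] V}

theorem twoPoint_good (ha : IsTensorLaurent a) : Good (twoPoint 𝒱 a) where
  fst := Filter.eventually_atBot.2 ⟨-1, fun b hb p c => by
    simp [twoPoint, YYone_neg 𝒱 c (show b < 0 by omega)]⟩
  mid := by
    filter_upwards [isLaurent_iff.1 ha.1] with p hp b c
    simp [twoPoint, hp]
  lst b := by
    have h := tl_map ha (LinearMap.lTensor V (dz 𝒱.D b))
    filter_upwards [tl_trunc h (Yt_isLaurent 𝒱)] with c hc p
    rw [twoPoint, YYone, LinearMap.comp_apply, hc p, smul_zero]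

theorem sub21_twoPoint_deriv (ha : IsTensorLaurent a) (n m : ℤ) :
    ((n : ℂ) + 1) • sub21 (twoPoint 𝒱 a) (n + 1) m
      = ((m : ℂ) + 1) • sub21 (twoPoint 𝒱 a) n (m + 1) - 𝒱.D (sub21 (twoPoint 𝒱 a) n m) := by
  have hF := twoPoint_good 𝒱 ha
  have h1 : Good fun b p c : ℤ => ((c : ℂ) + 1) • twoPoint 𝒱 a b p (c + 1) := by
    simpa using (hF.shift 0 0 1).smul fun b p c => (c : ℂ) + 1
  have e : (fun b p c : ℤ => ((b : ℂ) + 1) • twoPoint 𝒱 a (b + 1) p c)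
      = fun b p c : ℤ =>
          ((c : ℂ) + 1) • twoPoint 𝒱 a b p (c + 1) + (-𝒱.D) (twoPoint 𝒱 a b p c) := by
    funext b p c
    rw [LinearMap.neg_apply, twoPoint, twoPoint, twoPoint, map_smul, D_YYone, sg_add]
    module
  rw [sub21_deriv_left hF, sub21_deriv_right hF, e, sub21_add h1 (hF.map _), sub21_map hF,
    LinearMap.neg_apply]
  abel

theorem sub21_twoPoint_zero (ha : IsTensorLaurent a) (m : ℤ) :
    sub21 (twoPoint 𝒱 a) 0 m = conv (Yt 𝒱) a m := by
  rw [sub21_eq_iterated (twoPoint_good 𝒱 ha), finsum_eq_single _ 0]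
  · refine finsum_congr fun p => ?_
    rw [← bz_natCast]
    simp [twoPoint, YYone_zero]
  · intro i hi
    refine finsum_eq_zero_of_forall_eq_zero fun p => ?_
    rw [twoPoint, YYone_neg _ _ (by omega)]
    simp

theorem sub21_twoPoint_neg (ha : IsTensorLaurent a) {n : ℤ} (hn : n < 0) (m : ℤ) :
    sub21 (twoPoint 𝒱 a) n m = 0 := by
  rw [sub21_eq_iterated (twoPoint_good 𝒱 ha)]
  refine finsum_eq_zero_of_forall_eq_zero fun i => finsum_eq_zero_of_forall_eq_zero fun p => ?_
  rw [twoPoint, YYone_neg _ _ (by omega)]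
  simp

theorem sub21_twoPoint_eq_zero (ha : IsTensorLaurent a) (h : ∀ n, conv (Yt 𝒱) a n = 0) (n m : ℤ) :
    sub21 (twoPoint 𝒱 a) n m = 0 := by
  rcases lt_or_ge n 0 with hn | hn
  · exact sub21_twoPoint_neg 𝒱 ha hn m
  · obtain ⟨n, rfl⟩ := Int.eq_ofNat_of_zero_le hn
    induction n generalizing m with
    | zero => exact (sub21_twoPoint_zero 𝒱 ha m).trans (h m)
    | succ n ih =>
      have := sub21_twoPoint_deriv 𝒱 ha n m
      rw [ih _ (by omega), ih _ (by omega), map_zero, smul_zero, sub_zero] at this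
      push_cast
      exact (smul_eq_zero.1 this).resolve_left (add_one_ne_zero_of_nonneg (by omega))

/-- The pairs of exponents `(k₁ - l₁, k₀ - l₀)`. -/
def finTwoEquiv (k : Fin 2 → ℤ) : (Fin 2 → ℤ) ≃ ℤ × ℤ where
  toFun l := (k 1 - l 1, k 0 - l 0)
  invFun x := ![k 0 - x.2, k 1 - x.1]
  left_inv l := by
    funext i
    fin_cases i <;> simp
  right_inv x := by simp

variable {𝒱}

theorem eq_zero_of_conv_Yt (hnd : 𝒱.NonDegenerate) (ha : IsTensorLaurent a)
    (h : ∀ n, conv (Yt 𝒱) a n = 0) (n : ℤ) : a n = 0 := by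
  let B := Module.Basis.ofVectorSpace ℂ V
  obtain ⟨s, hs, hl⟩ := tl_exists_repr (B.tensorProduct B) ha
  let c : s → ℤ → ℂ := fun x p => (B.tensorProduct B).repr (a p) x
  let e := s.equivFin.symm
  let f : Fin s.card → (Fin 2 → ℤ) → ℂ := fun j l =>
    (-1) ^ l 1 * bz (l 0 + l 1) (l 1) * c (e j) (l 0 + l 1)
  let v : Fin s.card → Fin 2 → V := fun j => ![B (e j).1.1, B (e j).1.2]
  have hc : ∀ x, IsLaurent (c x) := fun x => hl x
  have hf : ∀ j, f j = 0 := by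
    refine hnd 2 two_pos s.card v f (fun j => ?_) ?_ fun k => ?_
    · refine ⟨⟨0, fun k hk => ?_⟩, fun m => ⟨?_, fun _ => trivial⟩⟩
      · simp only [f]
        rw [bz_neg (show k 1 < 0 from hk), mul_zero, zero_mul]
      · obtain ⟨N, hN⟩ := hc (e j)
        refine ⟨N - m, fun k hk => ?_⟩
        simp only [f]
        rw [hN, mul_zero]
        have h0 : (Fin.snoc k m : Fin 2 → ℤ) 0 = k 0 := rfl
        have h1 : (Fin.snoc k m : Fin 2 → ℤ) 1 = m := rfl
        change k 0 < N - m at hk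
        rw [h0, h1]
        omega
    · have h1 := (Basis.piTensorProduct (R := ℂ) fun _ : Fin 2 => B).linearIndependent
      have h2 := h1.comp (fun j : Fin s.card => ![(e j).1.1, (e j).1.2]) fun i j hij => by
        apply e.injective
        have h0 := congr_fun hij 0
        have h1 := congr_fun hij 1
        exact Subtype.ext (Prod.ext h0 h1)
      have hv : (fun j => PiTensorProduct.tprod ℂ (v j)) = (Basis.piTensorProduct (R := ℂ)
          fun _ : Fin 2 => B) ∘ fun j : Fin s.card => ![(e j).1.1, (e j).1.2] := by
        funext j
        rw [Function.comp_apply, Basis.piTensorProduct_apply]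
        congr 1
        funext i
        fin_cases i <;> rfl
      rw [hv]
      exact h2
    · have hY : ∀ (j : Fin s.card) (l : Fin 2 → ℤ), 𝒱.prodY 2 (v j) l
          = YYone 𝒱 (l 0) (l 1) (B (e j).1.1 ⊗ₜ B (e j).1.2) := by
        intro j l
        rw [YYone_tmul]
        rfl
      have key := sub21_twoPoint_eq_zero 𝒱 ha h (k 1) (k 0)
      have hj : ∀ j, IsTensorLaurent fun p => c (e j) p •
          (B (e j).1.1 ⊗ₜ[ℂ] B (e j).1.2) := fun j =>
        ⟨isLaurent_iff.2 ((isLaurent_iff.1 (hc (e j))).mono fun p hp => by simp [hp]),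
          Submodule.span ℂ {_}, Submodule.fg_span_singleton _,
          fun p => Submodule.smul_mem _ _ (Submodule.mem_span_singleton_self _)⟩
      have ht : ∀ (j : Fin s.card) (l : Fin 2 → ℤ),
          f j l • 𝒱.prodY 2 (v j) (fun i => k i - l i) = (-1 : ℂ) ^ k 1 •
            (bz (k 1 + k 0 - (finTwoEquiv k l).1 - (finTwoEquiv k l).2)
              (k 1 - (finTwoEquiv k l).1) • twoPoint 𝒱 (fun p => c (e j) p •
              (B (e j).1.1 ⊗ₜ[ℂ] B (e j).1.2)) (finTwoEquiv k l).1
                (k 1 + k 0 - (finTwoEquiv k l).1 - (finTwoEquiv k l).2) (finTwoEquiv k l).2) := by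
        intro j l
        rw [hY]
        simp only [finTwoEquiv, Equiv.coe_fn_mk, f, twoPoint, map_smul]
        rw [show k 1 + k 0 - (k 1 - l 1) - (k 0 - l 0) = l 0 + l 1 by ring, sub_sub_cancel,
          sg_sub, smul_smul, smul_smul, smul_smul]
        congr 1
        linear_combination (-((-1) ^ l 1 * bz (l 0 + l 1) (l 1) * c (e j) (l 0 + l 1)))
          * sg_mul_self (k 1)
      have hsum : ∀ j, ∑ᶠ l, f j l • 𝒱.prodY 2 (v j) (fun i => k i - l i) = (-1 : ℂ) ^ k 1 •
          sub21 (twoPoint 𝒱 (fun p => c (e j) p • (B (e j).1.1 ⊗ₜ[ℂ] B (e j).1.2)))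
            (k 1) (k 0) := by
        intro j
        rw [sub21, smul_finsum, ← finsum_comp_equiv (finTwoEquiv k)]
        exact finsum_congr (ht j)
      simp only [hsum]
      rw [← Finset.smul_sum]
      refine smul_eq_zero_of_right _ (Eq.trans ?_ key)
      unfold sub21
      rw [← finsum_sum_comm _ _ fun j _ => (twoPoint_good 𝒱 (hj j)).finite_support (k 1) (k 0)]
      refine finsum_congr fun x => ?_
      rw [← Finset.smul_sum]
      simp only [twoPoint]
      rw [← Finset.smul_sum, ← map_sum]
      congr 3
      rw [hs]
      refine Eq.trans ?_ (Finset.sum_coe_sort s fun i =>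
        (B.tensorProduct B).repr (a (k 1 + k 0 - x.1 - x.2)) i • (B.tensorProduct B) i)
      rw [← Equiv.sum_comp e]
      exact Finset.sum_congr rfl fun j _ => by rw [Module.Basis.tensorProduct_apply']
  rw [hs n, ← Finset.sum_coe_sort, ← Equiv.sum_comp e]
  refine Finset.sum_eq_zero fun j _ => ?_
  have := congr_fun (hf j) ![n, 0]
  simp only [f, Matrix.cons_val_zero, Matrix.cons_val_one, zpow_zero, add_zero, bz_zero, one_mul,
    Pi.zero_apply] at this
  rw [show (B.tensorProduct B).repr (a n) (e j) = 0 from this, zero_smul]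

theorem eq_of_conv_Yt (hnd : 𝒱.NonDegenerate) {a b : ℤ → V ⊗[ℂ] V} (ha : IsTensorLaurent a)
    (hb : IsTensorLaurent b) (h : ∀ n, conv (Yt 𝒱) a n = conv (Yt 𝒱) b n) (n : ℤ) :
    a n = b n := by
  refine sub_eq_zero.1 (eq_zero_of_conv_Yt hnd (tl_sub ha hb) (fun n => ?_) n)
  rw [conv_sub (conv_finite (tl_trunc ha (Yt_isLaurent 𝒱)) ha.1 n)
    (conv_finite (tl_trunc hb (Yt_isLaurent 𝒱)) hb.1 n), h, sub_self]

theorem conv_Yt_finite {a : ℤ → V ⊗[ℂ] V} (ha : IsTensorLaurent a) (n : ℤ) :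
    {c | Yt 𝒱 (n - c) (a c) ≠ 0}.Finite :=
  conv_finite (tl_trunc ha (Yt_isLaurent 𝒱)) ha.1 n

/-- The map `Y(x)_n ⊗ 1`. -/
def Yt1 (𝒱 : NLVA V) (n : ℤ) : (V ⊗[ℂ] V) ⊗[ℂ] V →ₗ[ℂ] V ⊗[ℂ] V :=
  TensorProduct.map (Yt 𝒱 n) LinearMap.id

@[simp] theorem Yt1_tmul (n : ℤ) (s : V ⊗[ℂ] V) (w : V) :
    Yt1 𝒱 n (s ⊗ₜ w) = Yt 𝒱 n s ⊗ₜ w := rfl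

theorem Yt1_isLaurent (t : (V ⊗[ℂ] V) ⊗[ℂ] V) : IsLaurent fun n => Yt1 𝒱 n t := by
  induction t using TensorProduct.induction_on with
  | zero => exact ⟨0, fun n _ => map_zero _⟩
  | tmul u v =>
    obtain ⟨N, hN⟩ := Yt_isLaurent 𝒱 u
    exact ⟨N, fun n hn => by
      have h := hN n hn
      simp only at h ⊢
      rw [Yt1_tmul, h, TensorProduct.zero_tmul]⟩
  | add s t hs ht =>
    obtain ⟨M, hM⟩ := hs
    obtain ⟨N, hN⟩ := ht
    exact ⟨min M N, fun n hn => by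
      have h1 := hM n (by omega)
      have h2 := hN n (by omega)
      simp only at h1 h2 ⊢
      rw [map_add, h1, h2, add_zero]⟩

theorem eq_zero_of_conv_Yt1 (hnd : 𝒱.NonDegenerate) {a : ℤ → (V ⊗[ℂ] V) ⊗[ℂ] V}
    (ha : IsTensorLaurent a) (h : ∀ n, conv (Yt1 𝒱) a n = 0) (n : ℤ) : a n = 0 := by
  classical
  let B := Module.Basis.ofVectorSpace ℂ V
  let r := fun i => Finsupp.lapply i ∘ₗ
    (TensorProduct.equivFinsuppOfBasisRight (M := V ⊗[ℂ] V) B).toLinearMap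
  let r' := fun i => Finsupp.lapply i ∘ₗ
    (TensorProduct.equivFinsuppOfBasisRight (M := V) B).toLinearMap
  have hr : ∀ i n t, r' i (Yt1 𝒱 n t) = Yt 𝒱 n (r i t) := by
    intro i n t
    induction t using TensorProduct.induction_on with
    | zero => simp
    | tmul s w => simp [r, r']
    | add s t hs ht => simp only [map_add, hs, ht]
  apply (TensorProduct.equivFinsuppOfBasisRight (M := V ⊗[ℂ] V) B).injective
  rw [map_zero]
  ext1 i
  refine eq_zero_of_conv_Yt hnd (tl_map ha (r i)) (fun n => ?_) n
  have := congrArg (r' i) (h n)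
  rw [map_zero] at this
  rw [← this, conv, conv, map_finsum (r' i)
    (conv_finite (tl_trunc ha Yt1_isLaurent) ha.1 n)]
  exact finsum_congr fun c => (hr i _ _).symm

end Injectivity

section Convolution

variable {M N L : Type*} [AddCommGroup M] [Module ℂ M] [AddCommGroup N] [Module ℂ N]
  [AddCommGroup L] [Module ℂ L]

theorem conv_single (Φ : ℤ → M →ₗ[ℂ] N) (t : M) (n : ℤ) :
    conv Φ (fun c => if c = 0 then t else 0) n = Φ n t := by
  rw [conv, finsum_eq_single _ 0]
  · simp
  · intro c hc
    rw [if_neg hc, map_zero]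

theorem conv_assoc {Φ : ℤ → N →ₗ[ℂ] L} {Ψ : ℤ → M →ₗ[ℂ] N} {a : ℤ → M} (ha : IsLaurent a)
    (hΨ : ∀ᶠ n in Filter.atBot, ∀ d, Ψ n (a d) = 0)
    (hΦ : ∀ᶠ n in Filter.atBot, ∀ e d, Φ n (Ψ e (a d)) = 0) (n : ℤ) :
    conv Φ (conv Ψ a) n = ∑ᶠ d, conv Φ (fun e => Ψ e (a d)) (n - d) := by
  unfold conv
  rw [finsum_map_finsum (fun c => Φ (n - c)) _ fun c => conv_finite hΨ ha c]
  · refine finsum_congr fun d => ?_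
    rw [← finsum_shift d]
    refine finsum_congr fun e => ?_
    rw [add_sub_cancel_right, show n - (e + d) = n - d - e by ring]
  · obtain ⟨c₀, hc₀⟩ := Filter.eventually_atBot.1 (isLaurent_iff.1 (conv_isLaurent hΨ ha))
    obtain ⟨n₀, hn₀⟩ := Filter.eventually_atBot.1 hΦ
    obtain ⟨n₁, hn₁⟩ := Filter.eventually_atBot.1 hΨ
    obtain ⟨n₂, hn₂⟩ := Filter.eventually_atBot.1 (isLaurent_iff.1 ha)
    refine finite_prod_of_fibers (p := fun c d : ℤ => Φ (n - c) (Ψ (c - d) (a d)) ≠ 0) ?_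
      fun c => ?_
    · refine (Set.finite_Icc (n₁ + n₂) (n - n₀)).subset ?_
      rintro c ⟨d, h⟩
      have h1 : n₁ < c - d := by
        by_contra hc
        exact h (by rw [hn₁ _ (by omega), map_zero])
      have h2 : n₂ < d := by
        by_contra hc
        exact h (by rw [hn₂ _ (by omega), map_zero, map_zero])
      have h3 : n₀ < n - c := by
        by_contra hc
        exact h (hn₀ _ (by omega) _ _)
      exact ⟨by omega, by omega⟩
    · refine (conv_finite hΨ ha c).subset fun d hd h0 => hd ?_
      rw [h0, map_zero]

theorem conv_deriv {Φ : ℤ → M →ₗ[ℂ] N} {a : ℤ → M}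
    (h : ∀ᶠ n in Filter.atBot, ∀ c, Φ n (a c) = 0) (ha : IsLaurent a) (n : ℤ) :
    ((n : ℂ) + 1) • conv Φ a (n + 1)
      = ∑ᶠ c, (((n - c : ℤ) : ℂ) + 1) • Φ (n - c + 1) (a c)
        + conv Φ (fun c => ((c : ℂ) + 1) • a (c + 1)) n := by
  have hf := conv_finite h ha (n + 1)
  have h2 : conv Φ (fun c => ((c : ℂ) + 1) • a (c + 1)) n
      = ∑ᶠ c : ℤ, (c : ℂ) • Φ (n + 1 - c) (a c) := by
    rw [← finsum_shift 1]
    refine finsum_congr fun c => ?_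
    rw [map_smul, add_sub_add_right_eq_sub]
    push_cast
    rfl
  rw [h2, conv, smul_finsum, ← finsum_add_distrib]
  · refine finsum_congr fun c => ?_
    rw [show n - c + 1 = n + 1 - c by ring, ← add_smul]
    push_cast
    congr 1
    ring
  · refine hf.subset fun c hc h0 => hc ?_
    simp only
    rw [sub_add_eq_add_sub, h0, smul_zero]
  · refine hf.subset fun c hc h0 => hc ?_
    simp only
    rw [h0, smul_zero]

theorem isLaurent_tensor {Φ : ℤ → M ⊗[ℂ] N →ₗ[ℂ] L}
    (h : ∀ x y, IsLaurent fun n => Φ n (x ⊗ₜ y)) (t : M ⊗[ℂ] N) : IsLaurent fun n => Φ n t := by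
  simp only [isLaurent_iff] at h ⊢
  induction t using TensorProduct.induction_on with
  | zero => simp
  | tmul x y => exact h x y
  | add s t hs ht =>
    filter_upwards [hs, ht] with n h1 h2
    rw [map_add, h1, h2, add_zero]

theorem tl_tensor {Φ : ℤ → M ⊗[ℂ] N →ₗ[ℂ] L}
    (h : ∀ x y, IsTensorLaurent fun n => Φ n (x ⊗ₜ y)) (t : M ⊗[ℂ] N) :
    IsTensorLaurent fun n => Φ n t := by
  induction t using TensorProduct.induction_on with
  | zero => simpa using isTensorLaurent_single (0 : L)
  | tmul x y => exact h x y
  | add s t hs ht => simpa only [map_add] using tl_add hs ht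

theorem comm_rTensor (f : M →ₗ[ℂ] M) (t : M ⊗[ℂ] N) :
    TensorProduct.comm ℂ M N (LinearMap.rTensor N f t)
      = LinearMap.lTensor N f (TensorProduct.comm ℂ M N t) := by
  induction t using TensorProduct.induction_on with
  | zero => simp
  | tmul x y => rfl
  | add s t hs ht => simp only [map_add, hs, ht]

theorem comm_lTensor (f : N →ₗ[ℂ] N) (t : M ⊗[ℂ] N) :
    TensorProduct.comm ℂ M N (LinearMap.lTensor M f t)
      = LinearMap.rTensor M f (TensorProduct.comm ℂ M N t) := by
  induction t using TensorProduct.induction_on with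
  | zero => simp
  | tmul x y => rfl
  | add s t hs ht => simp only [map_add, hs, ht]

theorem addMul_pow_zero_right {A : ℤ → ℤ → M} (hA : ∀ m n, n < 0 → A m n = 0) (k : ℕ) (m : ℤ) :
    (addMul ^ k) A m 0 = A (m - k) 0 := by
  induction k generalizing m with
  | zero => simp
  | succ k ih =>
    rw [pow_succ', Module.End.mul_apply, addMul_apply, ih,
      addMul_pow_trunc_right hA k _ _ (by omega), add_zero]
    push_cast
    congr 1
    ring

theorem addMul_pow_zero_left {A : ℤ → ℤ → M} (hA : ∀ m n, m < 0 → A m n = 0) (k : ℕ) (n : ℤ) :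
    (addMul ^ k) A 0 n = A 0 (n - k) := by
  have h := addMul_pow_zero_right (A := fun m n => A n m) (fun m n hn => hA n m hn) k n
  rwa [addMul_pow_swap] at h

theorem addMul_pow_ode {D : M →ₗ[ℂ] M} {A : ℤ → ℤ → M}
    (hA : ∀ m n : ℤ, ((n : ℂ) + 1) • A m (n + 1) = D (A m n) + ((m : ℂ) + 1) • A (m + 1) n)
    (k : ℕ) : ∀ m n : ℤ, ((n : ℂ) + 1) • (addMul ^ k) A m (n + 1)
      = D ((addMul ^ k) A m n) + ((m : ℂ) + 1) • (addMul ^ k) A (m + 1) n := by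
  refine (addMul_pow_comm id (P := fun A : ℤ → ℤ → M => ∀ m n : ℤ, ((n : ℂ) + 1) • A m (n + 1)
      = D (A m n) + ((m : ℂ) + 1) • A (m + 1) n) (fun A hA m n => ?_) (fun A _ => rfl) hA k).1
  have h1 := hA (m - 1) n
  have h2 := hA m (n - 1)
  rw [sub_add_cancel] at h1 h2
  push_cast at h1 h2
  simp only [addMul_apply, add_sub_cancel_right, map_add, smul_add]
  have h1' : ((n : ℂ) + 1) • A (m - 1) (n + 1) = D (A (m - 1) n) + (m : ℂ) • A m n := by
    rw [h1]
    congr 2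
    ring
  have h2' : (n : ℂ) • A m n = D (A m (n - 1)) + ((m : ℂ) + 1) • A (m + 1) (n - 1) := by
    rw [← h2]
    congr 1
    ring
  rw [h1', add_smul _ _ (A m n), h2', add_smul _ _ (A m n)]
  abel

end Convolution

section Exchange

variable {V : Type*} [AddCommGroup V] [Module ℂ V] (𝒱 : NLVA V)

/-- The map `u ⊗ v ↦ Y(u)_b Y(v)_c w`. -/
def YY (w : V) (c b : ℤ) : V ⊗[ℂ] V →ₗ[ℂ] V :=
  Yt 𝒱 b ∘ₗ LinearMap.lTensor V ((𝒱.Yc c).flip w)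

@[simp] theorem YY_tmul (w : V) (c b : ℤ) (u v : V) :
    YY 𝒱 w c b (u ⊗ₜ v) = 𝒱.Y u (𝒱.Y v w c) b := rfl

theorem YY_one (c b : ℤ) : YY 𝒱 𝒱.one c b = YYone 𝒱 b c := by
  ext u v
  exact (YYone_tmul 𝒱 b c u v).symm

/-- The triple series whose substitution gives `Y(x₂)Y(-x₁)w` applied to `a(x₁ + x₂)`. -/
def exch (w : V) (a : ℤ → V ⊗[ℂ] V) (c p b : ℤ) : V := (-1 : ℂ) ^ c • YY 𝒱 w c b (a p)

/-- The exchange relation for `t` and the series `a` that is to be `S(x)t`. -/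
def IsExchange (t : V ⊗[ℂ] V) (a : ℤ → V ⊗[ℂ] V) : Prop :=
  ∃ k : ℕ, ∀ w, (addMul ^ k) (fun m n => (-1 : ℂ) ^ m • YY 𝒱 w n m (TensorProduct.comm ℂ V V t))
    = (addMul ^ k) (sub21 (exch 𝒱 w a))

variable {a b : ℤ → V ⊗[ℂ] V} {t s : V ⊗[ℂ] V}

theorem exch_good (ha : IsTensorLaurent a) (w : V) : Good (exch 𝒱 w a) where
  fst := by
    have h : ∀ t, IsLaurent fun c => LinearMap.lTensor V ((𝒱.Yc c).flip w) t :=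
      isLaurent_tensor fun x y => by
        obtain ⟨N, hN⟩ := 𝒱.trunc y w
        refine ⟨N, fun n hn => ?_⟩
        simp only
        rw [LinearMap.lTensor_tmul, LinearMap.flip_apply, Yc_apply, hN n hn,
          TensorProduct.tmul_zero]
    filter_upwards [tl_trunc ha h] with c hc p b
    rw [exch, YY, LinearMap.comp_apply, hc, map_zero, smul_zero]
  mid := by
    filter_upwards [isLaurent_iff.1 ha.1] with p hp c b
    rw [exch, hp, map_zero, smul_zero]
  lst c := by
    filter_upwards [tl_trunc (tl_map ha (LinearMap.lTensor V ((𝒱.Yc c).flip w)))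
      (Yt_isLaurent 𝒱)] with b hb p
    rw [exch, YY, LinearMap.comp_apply, hb, smul_zero]

theorem exch_one : exch 𝒱 𝒱.one a = twoPoint 𝒱 a := by
  funext c p b
  rw [exch, YY_one, twoPoint]

theorem exch_add (w : V) : exch 𝒱 w (fun n => a n + b n)
    = fun i p j => exch 𝒱 w a i p j + exch 𝒱 w b i p j := by
  funext i p j
  simp only [exch, map_add, smul_add]

theorem exch_smul (w : V) (k : ℂ) : exch 𝒱 w (fun n => k • a n)
    = fun i p j => (k • LinearMap.id : V →ₗ[ℂ] V) (exch 𝒱 w a i p j) := by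
  funext i p j
  simp only [exch, map_smul, LinearMap.smul_apply, LinearMap.id_apply]

variable {𝒱}

theorem IsExchange.add (ha : IsTensorLaurent a) (hb : IsTensorLaurent b)
    (h₁ : IsExchange 𝒱 s a) (h₂ : IsExchange 𝒱 t b) :
    IsExchange 𝒱 (s + t) fun n => a n + b n := by
  obtain ⟨j, hj⟩ := h₁
  obtain ⟨k, hk⟩ := h₂
  refine ⟨max j k, fun w => ?_⟩
  have e : sub21 (exch 𝒱 w fun n => a n + b n) = sub21 (exch 𝒱 w a) + sub21 (exch 𝒱 w b) := by
    funext m n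
    rw [exch_add, sub21_add (exch_good 𝒱 ha w) (exch_good 𝒱 hb w)]
    rfl
  rw [e, LinearMap.map_add, ← addMul_pow_congr (le_max_left j k) (hj w),
    ← addMul_pow_congr (le_max_right j k) (hk w), ← LinearMap.map_add]
  congr 1
  funext m n
  simp only [map_add, smul_add, Pi.add_apply]

theorem IsExchange.smul (ha : IsTensorLaurent a) (h : IsExchange 𝒱 t a) (c : ℂ) :
    IsExchange 𝒱 (c • t) fun n => c • a n := by
  obtain ⟨k, hk⟩ := h
  refine ⟨k, fun w => ?_⟩
  have e : sub21 (exch 𝒱 w fun n => c • a n) = c • sub21 (exch 𝒱 w a) := by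
    funext m n
    rw [exch_smul, sub21_map (exch_good 𝒱 ha w)]
    rfl
  rw [e, LinearMap.map_smul, ← hk w, ← LinearMap.map_smul]
  congr 1
  funext m n
  simp only [map_smul, Pi.smul_apply, smul_comm c]

theorem IsExchange.zero : IsExchange 𝒱 0 fun _ => 0 :=
  ⟨0, fun w => by
    funext m n
    simp [exch, sub21]⟩

theorem exists_exchange_tmul (hs : SLocal 𝒱) (u v : V) :
    ∃ a, IsTensorLaurent a ∧ IsExchange 𝒱 (v ⊗ₜ u) a := by
  obtain ⟨r, uu, vv, f, k, hf, h⟩ := hs u v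
  let a : Fin r → ℤ → V ⊗[ℂ] V := fun i p => f i p • (vv i ⊗ₜ uu i)
  have ha : ∀ i, IsTensorLaurent (a i) := fun i =>
    ⟨isLaurent_iff.2 ((isLaurent_iff.1 (hf i)).mono fun p hp => by simp [a, hp]),
      Submodule.span ℂ {_}, Submodule.fg_span_singleton _,
      fun p => Submodule.smul_mem _ _ (Submodule.mem_span_singleton_self _)⟩
  have hsum : ∀ S : Finset (Fin r), IsTensorLaurent fun p => ∑ i ∈ S, a i p := by
    intro S
    induction S using Finset.cons_induction with
    | empty => simpa using isTensorLaurent_single (0 : V ⊗[ℂ] V)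
    | cons i S hi ih => simpa only [Finset.sum_cons] using tl_add (ha i) ih
  refine ⟨_, hsum Finset.univ, k, fun w => ?_⟩
  have hexch : ∀ S : Finset (Fin r), sub21 (exch 𝒱 w fun p => ∑ i ∈ S, a i p)
      = fun m n => ∑ i ∈ S, sub21 (exch 𝒱 w (a i)) m n := by
    intro S
    induction S using Finset.cons_induction with
    | empty =>
      funext m n
      simp [exch, sub21]
    | cons i S hi ih =>
      funext m n
      simp only [Finset.sum_cons]
      rw [← congr_fun (congr_fun ih m) n, exch_add,
        sub21_add (exch_good 𝒱 (ha i) w) (exch_good 𝒱 (hsum S) w)]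
  have hsc : ∀ i m n, (-1 : ℂ) ^ m • scalarMulSub (f i)
      (fun a' b' => 𝒱.Y (vv i) (𝒱.Y (uu i) w a') b') m n = sub21 (exch 𝒱 w (a i)) m n := by
    intro i m n
    rw [sub21_eq_iterated (exch_good 𝒱 (ha i) w), scalarMulSub, smul_finsum]
    refine finsum_congr fun j => ?_
    rw [smul_finsum]
    refine finsum_congr fun p => ?_
    simp only [exch, a, map_smul, YY_tmul, smul_smul]
    congr 1
    rw [sg_sub, zpow_natCast]
    ring
  funext m n
  have := h w m n
  rw [mulSubPow_eq, mulSubPow_eq] at this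
  have := smul_right_injective V (sg_ne_zero (m - k)) this
  rw [hexch]
  refine this.trans ?_
  refine congrArg (fun A => (addMul ^ k) A m n) (funext fun m => funext fun n => ?_)
  rw [Finset.smul_sum]
  exact Finset.sum_congr rfl fun i _ => hsc i m n

theorem exists_exchange (hs : SLocal 𝒱) : ∃ S : ℤ → V ⊗[ℂ] V →ₗ[ℂ] V ⊗[ℂ] V,
    ∀ t, IsTensorLaurent (fun n => S n t) ∧ IsExchange 𝒱 t fun n => S n t := by
  let B := Module.Basis.ofVectorSpace ℂ V
  choose a ha h using fun x : _ × _ => exists_exchange_tmul hs (B x.2) (B x.1)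
  refine ⟨fun n => (B.tensorProduct B).constr ℂ fun x => a x n, fun t => ?_⟩
  have ht := (B.tensorProduct B).mem_span t
  induction ht using Submodule.span_induction with
  | mem t ht =>
    obtain ⟨x, rfl⟩ := ht
    simp only [Module.Basis.constr_basis]
    refine ⟨ha x, ?_⟩
    rw [Module.Basis.tensorProduct_apply']
    exact h x
  | zero =>
    simp only [map_zero]
    exact ⟨by simpa using isTensorLaurent_single (0 : V ⊗[ℂ] V), IsExchange.zero⟩
  | add s t _ _ hs ht =>
    simp only [map_add]
    exact ⟨tl_add hs.1 ht.1, hs.2.add hs.1 ht.1 ht.2⟩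
  | smul c t _ ht =>
    simp only [map_smul]
    exact ⟨tl_smul ht.1 _, ht.2.smul ht.1 c⟩

theorem conv_Yt_of_isExchange (ha : IsTensorLaurent a) (h : IsExchange 𝒱 t a) (n : ℤ) :
    conv (Yt 𝒱) a n = twist 𝒱.D (fun p => Yt 𝒱 p (TensorProduct.comm ℂ V V t)) n := by
  obtain ⟨k, hk⟩ := h
  have hk := hk 𝒱.one
  simp only [exch_one, YY_one] at hk
  set s := TensorProduct.comm ℂ V V t
  set A : ℤ → ℤ → V := fun m n => (-1 : ℂ) ^ m • YYone 𝒱 m n s with hA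
  have hA₀ : ∀ m n, n < 0 → A m n = 0 := fun m n hn => by simp [hA, YYone_neg 𝒱 m hn]
  have hode := addMul_pow_ode (D := 𝒱.D) (A := A) (fun m n => by
    simp only [hA, map_smul, D_YYone, sg_add]
    module) k
  have h0 : ∀ m, (addMul ^ k) A m 0 = (-1 : ℂ) ^ (m - k) • Yt 𝒱 (m - k) s := fun m => by
    rw [addMul_pow_zero_right hA₀, hA]
    simp only [YYone_zero]
  have h1 : ∀ n, (addMul ^ k) A 0 n = conv (Yt 𝒱) a (n - k) := fun n => by
    rw [hk, addMul_pow_zero_left (fun m n hm => sub21_twoPoint_neg 𝒱 ha hm n),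
      sub21_twoPoint_zero 𝒱 ha]
  have hneg : ∀ m < 0, (addMul ^ k) A m 0 = 0 := fun m hm => by
    rw [hk]
    exact addMul_pow_trunc_left (fun m n hm => sub21_twoPoint_neg 𝒱 ha hm n) k m 0 hm
  have := ode_solution 𝒱.D _ hode (addMul_pow_trunc_right hA₀ k) 0 (n + k)
  rw [h1, add_sub_cancel_right] at this
  rw [this, twist, conv, ← finsum_shift (k : ℤ)]
  refine finsum_congr fun i => ?_
  have h2 := h0 (i + k)
  rw [add_sub_cancel_right] at h2
  rw [zero_add, add_sub_add_right_eq_sub, ← h2]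
  rcases lt_or_ge (i + k) 0 with hi | hi
  · rw [hneg _ hi, bz_neg hi, zero_smul, map_zero]
  · rw [bz_symm hi, sub_self, bz_zero, one_smul]

end Exchange

section Consequences

variable {V : Type*} [AddCommGroup V] [Module ℂ V] {𝒱 : NLVA V}
  {S : ℤ → V ⊗[ℂ] V →ₗ[ℂ] V ⊗[ℂ] V}

theorem skewS_iff (hS : ∀ t, IsTensorLaurent fun n => S n t) :
    SkewS 𝒱 S ↔ ∀ t n, conv (Yt 𝒱) (fun c => S c t) n
      = twist 𝒱.D (fun p => Yt 𝒱 p (TensorProduct.comm ℂ V V t)) n := by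
  have hskew : SkewS 𝒱 S ↔ ∀ u v n, 𝒱.Y u v n
      = twist 𝒱.D (conv (Yt 𝒱) fun c => S c (v ⊗ₜ u)) n := by
    unfold SkewS
    refine forall_congr' fun u => forall_congr' fun v => forall_congr' fun n => ?_
    rw [expD_twist]
    rfl
  have hl : ∀ t, IsLaurent (conv (Yt 𝒱) fun c => S c t) := fun t =>
    conv_isLaurent (tl_trunc (hS t) (Yt_isLaurent 𝒱)) (hS t).1
  rw [hskew]
  constructor
  · intro h t n
    induction t using TensorProduct.induction_on with
    | zero => simp [conv, twist]
    | tmul v u =>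
      have e : (fun p => Yt 𝒱 p (TensorProduct.comm ℂ V V (v ⊗ₜ u)))
          = twist 𝒱.D (conv (Yt 𝒱) fun c => S c (v ⊗ₜ u)) := funext fun p => h u v p
      rw [e, twist_twist _ (hl _)]
    | add s t h₁ h₂ =>
      simp only [map_add]
      rw [conv_add (conv_Yt_finite (hS s) n) (conv_Yt_finite (hS t) n), h₁, h₂, twist, twist, twist]
      simp only [smul_add]
      rw [conv_add (conv_dz_finite _ (isLaurent_smul (Yt_isLaurent 𝒱 _) _) n)
        (conv_dz_finite _ (isLaurent_smul (Yt_isLaurent 𝒱 _) _) n)]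
  · intro h u v n
    rw [show (conv (Yt 𝒱) fun c => S c (v ⊗ₜ u)) = _ from funext (h (v ⊗ₜ u)),
      twist_twist _ (Yt_isLaurent 𝒱 _)]
    rfl

variable (hnd : 𝒱.NonDegenerate) (hS : ∀ t, IsTensorLaurent fun n => S n t)
  (hY : ∀ t n, conv (Yt 𝒱) (fun c => S c t) n
    = twist 𝒱.D (fun p => Yt 𝒱 p (TensorProduct.comm ℂ V V t)) n)

include hnd hS hY

theorem eq_S_of_conv_Yt {a : ℤ → V ⊗[ℂ] V} (ha : IsTensorLaurent a) (t : V ⊗[ℂ] V)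
    (h : ∀ n, conv (Yt 𝒱) a n
      = twist 𝒱.D (fun p => Yt 𝒱 p (TensorProduct.comm ℂ V V t)) n) (n : ℤ) : a n = S n t :=
  eq_of_conv_Yt hnd ha (hS t) (fun n => (h n).trans (hY t n).symm) n

theorem S_vacuum (v : V) (n : ℤ) :
    S n (𝒱.one ⊗ₜ v) = if n = 0 then 𝒱.one ⊗ₜ v else 0 := by
  refine (eq_S_of_conv_Yt hnd hS hY (isTensorLaurent_single _) _ (fun n => ?_) n).symm
  rw [conv_single, Yt_tmul, 𝒱.vacuum_left, ← alternating_dz_mul_dz 𝒱.D n v, twist, conv]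
  refine finsum_congr fun c => ?_
  rw [map_smul, TensorProduct.comm_tmul, Yt_tmul, Y_one_right]

theorem S_rTensor_D (t : V ⊗[ℂ] V) (n : ℤ) :
    S n (LinearMap.rTensor V 𝒱.D t)
      = LinearMap.rTensor V 𝒱.D (S n t) + ((n : ℂ) + 1) • S (n + 1) t := by
  have h1 := tl_map (hS t) (LinearMap.rTensor V 𝒱.D)
  have h2 := tl_smul (tl_shift (hS t) 1) fun n => (n : ℂ) + 1
  refine (eq_S_of_conv_Yt hnd hS hY (tl_add h1 h2) _ (fun n => ?_) n).symm
  rw [conv_add (conv_Yt_finite h1 n) (conv_Yt_finite h2 n), conv]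
  simp only [Yt_rTensor_D]
  rw [← conv_deriv (tl_trunc (hS t) (Yt_isLaurent 𝒱)) (hS t).1, hY,
    twist_deriv _ (Yt_isLaurent 𝒱 _), ← twist_map_comm _ (Yt_isLaurent 𝒱 _),
    ← twist_sub _ (isLaurent_iff.2 ((isLaurent_iff.1 (Yt_isLaurent 𝒱 _)).mono fun n hn => by
      rw [hn, map_zero])) (isLaurent_smul (isLaurent_iff.2 (eventually_atBot_add 1
      (isLaurent_iff.1 (Yt_isLaurent 𝒱 (TensorProduct.comm ℂ V V t))))) fun p => (p : ℂ) + 1)]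
  congr 1
  funext p
  rw [D_Yt, add_sub_cancel_right]
  congr 1
  exact (comm_rTensor _ _).symm

theorem S_lTensor_D (t : V ⊗[ℂ] V) (n : ℤ) :
    S n (LinearMap.lTensor V 𝒱.D t)
      = LinearMap.lTensor V 𝒱.D (S n t) - ((n : ℂ) + 1) • S (n + 1) t := by
  have h1 := tl_map (hS t) (LinearMap.lTensor V 𝒱.D)
  have h2 := tl_smul (tl_shift (hS t) 1) fun n => (n : ℂ) + 1
  have ht := tl_trunc (hS t) (Yt_isLaurent 𝒱)
  refine (eq_S_of_conv_Yt hnd hS hY (tl_sub h1 h2) _ (fun n => ?_) n).symm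
  rw [conv_sub (conv_Yt_finite h1 n) (conv_Yt_finite h2 n)]
  have hd := conv_deriv ht (hS t).1 n
  have hD : 𝒱.D (conv (Yt 𝒱) (fun c => S c t) n)
      = conv (Yt 𝒱) (fun c => LinearMap.lTensor V 𝒱.D (S c t)) n
        + ∑ᶠ c, (((n - c : ℤ) : ℂ) + 1) • Yt 𝒱 (n - c + 1) (S c t) := by
    rw [← conv_map ht (hS t).1, conv, conv, ← finsum_add_distrib (conv_Yt_finite h1 n)]
    · exact finsum_congr fun c => D_Yt 𝒱 _ _
    · refine (conv_Yt_finite (𝒱 := 𝒱) (hS t) (n + 1)).subset fun c hc h0 => hc ?_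
      simp only
      rw [sub_add_eq_add_sub, h0, smul_zero]
  rw [hY] at hD hd
  rw [twist_deriv _ (Yt_isLaurent 𝒱 _)] at hd
  have e : conv (Yt 𝒱) (fun c => LinearMap.lTensor V 𝒱.D (S c t)) n
      - conv (Yt 𝒱) (fun c => ((c : ℂ) + 1) • S (c + 1) t) n
      = twist 𝒱.D (fun p => ((p : ℂ) + 1) • Yt 𝒱 (p + 1) (TensorProduct.comm ℂ V V t)) n := by
    rw [hD] at hd
    rw [sub_eq_iff_eq_add] at hd ⊢

    exact add_right_cancel (hd.trans (by abel))
  rw [e]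
  congr 1
  funext p
  rw [← Yt_rTensor_D]
  congr 1
  exact (comm_lTensor _ _).symm

theorem S_unitary (n : ℤ) (t : V ⊗[ℂ] V) :
    ∑ᶠ c : ℤ, (-1 : ℂ) ^ (n - c) • S c (S21c S (n - c) t) = if n = 0 then t else 0 := by
  let a : ℤ → V ⊗[ℂ] V := fun c => (-1 : ℂ) ^ c • S21c S c t
  have h21 : ∀ c, S21c S c t = TensorProduct.comm ℂ V V (S c (TensorProduct.comm ℂ V V t)) :=
    fun c => rfl
  have ha : IsTensorLaurent a :=
    tl_smul (tl_map (hS _) (TensorProduct.comm ℂ V V).toLinearMap) _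
  have hb := tl_conv ha hS
  have e : ∑ᶠ c : ℤ, (-1 : ℂ) ^ (n - c) • S c (S21c S (n - c) t) = conv S a n := by
    rw [conv, ← finsum_reflect n]
    refine finsum_congr fun c => ?_
    rw [sub_sub_cancel]
    exact (map_smul _ _ _).symm
  rw [e]
  refine eq_of_conv_Yt hnd hb (isTensorLaurent_single t) (fun n => ?_) n
  have hΨ := tl_trunc ha fun t => (hS t).1
  have hΦ : ∀ᶠ n in Filter.atBot, ∀ e d, Yt 𝒱 n (S e (a d)) = 0 := by
    obtain ⟨F, hF, haF⟩ := ha.2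
    obtain ⟨F', hF', h⟩ := fg_range hF hS
    filter_upwards [fg_trunc hF' (Yt_isLaurent 𝒱)] with n hn e d
    exact hn _ (h e _ (haF d))
  rw [conv_single, conv_assoc ha.1 hΨ hΦ]
  set s := TensorProduct.comm ℂ V V t with hs
  have hca : ∀ d, TensorProduct.comm ℂ V V (a d) = (-1 : ℂ) ^ d • S d s := fun d => by
    rw [map_smul, h21, TensorProduct.comm_comm]
  have h1 : (fun n => Yt 𝒱 n t) = twist 𝒱.D (conv (Yt 𝒱) fun c => S c s) := by
    rw [show (conv (Yt 𝒱) fun c => S c s) = _ from funext (hY s), twist_twist _ (Yt_isLaurent 𝒱 _)]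
    funext n
    rw [hs, TensorProduct.comm_comm]
  have h2 : ∀ c, (-1 : ℂ) ^ c • conv (Yt 𝒱) (fun c => S c s) c
      = conv (fun c => (-1 : ℂ) ^ c • Yt 𝒱 c) (fun d => (-1 : ℂ) ^ d • S d s) c := fun c => by
    rw [conv, conv, smul_finsum]
    refine finsum_congr fun d => ?_
    rw [LinearMap.smul_apply, map_smul, smul_smul, ← sg_add, sub_add_cancel]
  have h3 := tl_trunc (tl_smul (hS s) fun d => (-1 : ℂ) ^ d) (Yt_isLaurent 𝒱)
  refine Eq.trans ?_ (congr_fun h1 n).symm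
  simp only [twist, h2]
  rw [conv_assoc (tl_smul (hS s) _).1]
  · refine finsum_congr fun d => ?_
    rw [hY, hca]
    rfl
  · filter_upwards [h3] with n hn d
    rw [LinearMap.smul_apply, hn, smul_zero]
  · filter_upwards [Filter.eventually_lt_atBot 0] with n hn e d
    rw [dz_neg _ hn, LinearMap.zero_apply]

end Consequences

section Series

variable {M N L : Type*} [AddCommGroup M] [Module ℂ M] [AddCommGroup N] [Module ℂ N]
  [AddCommGroup L] [Module ℂ L]

theorem addMul_pow_shift (i j : ℤ) (k : ℕ) (A : ℤ → ℤ → M) :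
    (addMul ^ k) (fun m n => A (m + i) (n + j)) = fun m n => (addMul ^ k) A (m + i) (n + j) := by
  refine ((addMul_pow_comm (fun (A : ℤ → ℤ → M) m n => A (m + i) (n + j)) (P := fun _ => True)
    (fun _ _ => trivial) (fun A _ => ?_) trivial k).2).symm
  funext m n
  simp only [addMul_apply]
  rw [sub_add_eq_add_sub, sub_add_eq_add_sub]

theorem addMul_pow_finsum {ι : Type*} {Z : ι → ℤ → ℤ → M}
    (hZ : ∀ m n, {d | Z d m n ≠ 0}.Finite) (k : ℕ) :
    (addMul ^ k) (fun m n => ∑ᶠ d, Z d m n) = fun m n => ∑ᶠ d, (addMul ^ k) (Z d) m n := by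
  induction k generalizing Z with
  | zero => rfl
  | succ k ih =>
    have e : addMul (fun m n => ∑ᶠ d, Z d m n) = fun m n => ∑ᶠ d, addMul (Z d) m n := by
      funext m n
      exact (finsum_add_distrib (hZ _ _) (hZ _ _)).symm
    rw [pow_succ, Module.End.mul_apply, e, ih]
    · rfl
    · intro m n
      refine ((hZ (m - 1) n).union (hZ m (n - 1))).subset fun d hd => ?_
      by_contra hc
      simp only [Set.mem_union, Set.mem_ofPred_eq, not_or, not_not] at hc
      exact hd (by rw [addMul_apply, hc.1, hc.2, add_zero])

theorem addMul_pow_conv_left {Φ : ℤ → M →ₗ[ℂ] N} (hΦ : ∀ n < 0, Φ n = 0) {A : ℤ → ℤ → M}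
    (hA : ∀ n, IsLaurent fun m => A m n) (k : ℕ) :
    (addMul ^ k) (fun m n => conv Φ (fun d => A d n) m)
      = fun m n => conv Φ (fun d => (addMul ^ k) A d n) m := by
  have e : ∀ B : ℤ → ℤ → M, (fun m n => conv Φ (fun d => B d n) m)
      = fun m n => ∑ᶠ j, Φ j (B (m + -j) (n + 0)) := by
    intro B
    funext m n
    rw [conv, ← finsum_reflect m]
    refine finsum_congr fun j => ?_
    rw [sub_sub_cancel, ← sub_eq_add_neg, add_zero]
  rw [e, e, addMul_pow_finsum]
  · funext m n
    refine finsum_congr fun j => ?_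
    rw [addMul_pow_map (Φ j) k fun m n => A (m + -j) (n + 0), addMul_pow_shift]
  · intro m n
    refine finite_int_of_bounds ?_ ?_
    · filter_upwards [Filter.eventually_lt_atBot 0] with j hj
      simp [hΦ j hj]
    · filter_upwards [eventually_atTop_sub m (isLaurent_iff.1 (hA (n + 0)))] with j hj
      rw [← sub_eq_add_neg, hj, map_zero]
      simp

theorem Good.conv_left {G : ℤ → ℤ → ℤ → M} (hG : Good G) {Φ : ℤ → M →ₗ[ℂ] N}
    (hΦ : ∀ n < 0, Φ n = 0) : Good fun c p b => conv Φ (fun d => G d p b) c := by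
  obtain ⟨c₀, hc₀⟩ := Filter.eventually_atBot.1 hG.fst
  refine ⟨?_, ?_, fun c => ?_⟩
  · filter_upwards [Filter.eventually_le_atBot c₀] with c hc p b
    refine finsum_eq_zero_of_forall_eq_zero fun d => ?_
    beta_reduce
    rcases lt_or_ge c d with h | h
    · rw [hΦ _ (by omega), LinearMap.zero_apply]
    · rw [hc₀ d (by omega), map_zero]
  · filter_upwards [hG.mid] with p hp c b
    refine finsum_eq_zero_of_forall_eq_zero fun d => ?_
    beta_reduce
    rw [hp, map_zero]
  · have h := (Filter.eventually_all_finite (Set.finite_Icc c₀ c)).2 fun d _ => hG.lst d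
    filter_upwards [h] with b hb p
    refine finsum_eq_zero_of_forall_eq_zero fun d => ?_
    beta_reduce
    rcases lt_or_ge c d with h | h
    · rw [hΦ _ (by omega), LinearMap.zero_apply]
    · rcases le_total d c₀ with h' | h'
      · rw [hc₀ d h', map_zero]
      · rw [hb d ⟨h', h⟩, map_zero]

theorem Good.conv_right {G : ℤ → ℤ → ℤ → M} (hG : Good G) {Φ : ℤ → M →ₗ[ℂ] N}
    (hΦ : ∀ c, ∀ᶠ n in Filter.atBot, ∀ p b, Φ n (G c p b) = 0) :
    Good fun c p b => conv Φ (G c p) b := by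
  refine ⟨?_, ?_, fun c => ?_⟩
  · filter_upwards [hG.fst] with c hc p b
    refine finsum_eq_zero_of_forall_eq_zero fun d => ?_
    rw [hc, map_zero]
  · filter_upwards [hG.mid] with p hp c b
    refine finsum_eq_zero_of_forall_eq_zero fun d => ?_
    rw [hp, map_zero]
  · obtain ⟨n₀, hn₀⟩ := Filter.eventually_atBot.1 (hΦ c)
    obtain ⟨b₀, hb₀⟩ := Filter.eventually_atBot.1 (hG.lst c)
    filter_upwards [Filter.eventually_le_atBot (n₀ + b₀)] with b hb p
    refine finsum_eq_zero_of_forall_eq_zero fun d => ?_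
    rcases le_total d b₀ with h | h
    · rw [hb₀ d h, map_zero]
    · rw [hn₀ _ (by omega)]

theorem good_comp {M' : Type*} [AddCommGroup M'] [Module ℂ M'] {Φ : ℤ → N →ₗ[ℂ] M'}
    {Ψ : ℤ → M →ₗ[ℂ] N} {a : ℤ → M}
    (ha : IsTensorLaurent a) (hΨ : ∀ t, IsTensorLaurent fun n => Ψ n t)
    (hΦ : ∀ t, IsLaurent fun n => Φ n t) : Good fun c p b => Φ c (Ψ b (a p)) where
  fst := by
    obtain ⟨F, hF, haF⟩ := ha.2
    obtain ⟨F', hF', h⟩ := fg_range hF hΨ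
    filter_upwards [fg_trunc hF' hΦ] with c hc p b
    exact hc _ (h b _ (haF p))
  mid := by
    filter_upwards [isLaurent_iff.1 ha.1] with p hp c b
    rw [hp, map_zero, map_zero]
  lst c := by
    filter_upwards [tl_trunc ha fun t => (hΨ t).1] with b hb p
    rw [hb, map_zero]

theorem tl_sub21 {G : ℤ → ℤ → ℤ → M} (hG : Good G)
    (hl : ∀ᶠ b in Filter.atBot, ∀ c p, G c p b = 0)
    (hF : ∀ c, ∃ F : Submodule ℂ M, F.FG ∧ ∀ p b, G c p b ∈ F) (m : ℤ) :
    IsTensorLaurent (sub21 G m) := by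
  obtain ⟨c₀, hc₀⟩ := Filter.eventually_atBot.1 hG.fst
  refine ⟨?_, ?_⟩
  · obtain ⟨p₀, hp₀⟩ := Filter.eventually_atBot.1 hG.mid
    obtain ⟨b₀, hb₀⟩ := Filter.eventually_atBot.1 hl
    refine ⟨c₀ + p₀ + b₀ - m, fun n hn => finsum_eq_zero_of_forall_eq_zero fun x => ?_⟩
    rcases le_total x.1 c₀ with h | h
    · rw [hc₀ _ h, smul_zero]
    rcases le_total x.2 b₀ with h' | h'
    · rw [hb₀ _ h', smul_zero]
    rw [hp₀ _ (by omega), smul_zero]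
  · choose F hF h using hF
    refine ⟨⨆ c ∈ Finset.Icc c₀ m, F c, Submodule.fg_biSup _ _ fun c _ => hF c,
      fun n => finsum_mem_of_forall fun x => ?_⟩
    rcases le_total x.1 c₀ with h₁ | h₁
    · rw [hc₀ _ h₁, smul_zero]
      exact zero_mem _
    rcases lt_or_ge m x.1 with h₂ | h₂
    · rw [bz_neg (by omega), zero_smul]
      exact zero_mem _
    · exact Submodule.smul_mem _ _ (le_biSup F (Finset.mem_Icc.2 ⟨h₁, h₂⟩) (h _ _ _))

end Series

section Associativity

variable {V : Type*} [AddCommGroup V] [Module ℂ V] {𝒱 : NLVA V}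

theorem finite_assoc (a : V) (t : V ⊗[ℂ] V) (x y : ℤ) :
    {i : ℤ | (bz (x + i) i • 𝒱.Yc (x + i) a ∘ₗ Yt 𝒱 (y - i)) t ≠ 0}.Finite := by
  refine finite_int_of_bounds ?_ ?_
  · filter_upwards [Filter.eventually_lt_atBot 0] with j hj
    simp [bz_neg hj]
  · filter_upwards [eventually_atTop_sub y (isLaurent_iff.1 (Yt_isLaurent 𝒱 t))] with j hj
    simp [hj]

variable (𝒱)

/-- The series `Y(a, x₀ + x₂) Y(x₂) t`. -/
def assocLeft (a : V) : V ⊗[ℂ] V →ₗ[ℂ] ℤ → ℤ → V :=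
  LinearMap.pi fun x => LinearMap.pi fun y =>
    finsumLin (fun i : ℤ => bz (x + i) i • 𝒱.Yc (x + i) a ∘ₗ Yt 𝒱 (y - i))
      fun t => finite_assoc a t x y

/-- The series `Y(x₂) (Y(a, x₀) ⊗ 1) t`. -/
def assocRight (a : V) : V ⊗[ℂ] V →ₗ[ℂ] ℤ → ℤ → V :=
  LinearMap.pi fun x => LinearMap.pi fun y => Yt 𝒱 y ∘ₗ LinearMap.rTensor V (𝒱.Yc x a)

variable {𝒱}

theorem assocLeft_apply (a : V) (t : V ⊗[ℂ] V) (x y : ℤ) : assocLeft 𝒱 a t x y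
    = ∑ᶠ i : ℤ, bz (x + i) i • 𝒱.Yc (x + i) a (Yt 𝒱 (y - i) t) := rfl

theorem exists_addMul_pow_uniform {M N : Type*} [AddCommGroup M] [Module ℂ M] [AddCommGroup N]
    [Module ℂ N] (f g : M →ₗ[ℂ] ℤ → ℤ → N) {F : Submodule ℂ M} (hF : F.FG) {s : Set M}
    (hs : Submodule.span ℂ s = ⊤)
    (h : ∀ t ∈ s, ∃ k : ℕ, (addMul ^ k) (f t) = (addMul ^ k) (g t)) :
    ∃ k : ℕ, ∀ t ∈ F, (addMul ^ k) (f t) = (addMul ^ k) (g t) := by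
  let P : ℕ → Submodule ℂ M := fun k =>
    LinearMap.eqLocus ((addMul ^ k : Module.End ℂ (ℤ → ℤ → N)) ∘ₗ f)
      ((addMul ^ k : Module.End ℂ (ℤ → ℤ → N)) ∘ₗ g)
  have hP : Monotone P := fun j k hjk t ht => addMul_pow_congr hjk ht
  refine fg_le_of_monotone hF hP fun t => ?_
  have ht : t ∈ Submodule.span ℂ s := hs ▸ Submodule.mem_top
  induction ht using Submodule.span_induction with
  | mem t ht => exact h t ht
  | zero => exact ⟨0, zero_mem _⟩
  | add t t' _ _ h₁ h₂ =>
    obtain ⟨j, hj⟩ := h₁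
    obtain ⟨k, hk⟩ := h₂
    exact ⟨max j k, add_mem (hP (le_max_left j k) hj) (hP (le_max_right j k) hk)⟩
  | smul c t _ ht =>
    obtain ⟨k, hk⟩ := ht
    exact ⟨k, Submodule.smul_mem _ _ hk⟩

theorem weak_assoc_uniform (a : V) {F : Submodule ℂ (V ⊗[ℂ] V)} (hF : F.FG) :
    ∃ k : ℕ, ∀ t ∈ F, (addMul ^ k) (assocLeft 𝒱 a t) = (addMul ^ k) (assocRight 𝒱 a t) := by
  refine exists_addMul_pow_uniform _ _ hF (TensorProduct.span_tmul_eq_top ℂ V V) ?_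
  rintro _ ⟨u, v, rfl⟩
  obtain ⟨k, hk⟩ := weak_assoc' 𝒱 a u v
  refine ⟨k, Eq.trans (congrArg _ ?_) hk⟩
  funext x y
  rw [substAdd02_eq]
  rfl

theorem finsum_assocLeft (a : V) {q : ℤ → V ⊗[ℂ] V} (hq : IsTensorLaurent q) (x y : ℤ) :
    ∑ᶠ d, assocLeft 𝒱 a (q d) x (y - d)
      = ∑ᶠ i : ℤ, bz (x + i) i • 𝒱.Yc (x + i) a (conv (Yt 𝒱) q (y - i)) := by
  have hΦ := tl_trunc (Φ := Yt 𝒱) hq (Yt_isLaurent 𝒱)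
  have h := finsum_map_finsum (fun i => bz (x + i) i • 𝒱.Yc (x + i) a)
    (fun i d => Yt 𝒱 (y - i - d) (q d)) (fun i => conv_Yt_finite (𝒱 := 𝒱) hq (y - i)) ?_
  · refine Eq.trans ?_ h.symm
    refine finsum_congr fun d => ?_
    rw [assocLeft_apply]
    refine finsum_congr fun i => ?_
    rw [sub_right_comm]
    rfl
  · obtain ⟨d₀, hd₀⟩ := Filter.eventually_atBot.1 (isLaurent_iff.1 hq.1)
    obtain ⟨n₀, hn₀⟩ := Filter.eventually_atBot.1 hΦ
    refine finite_prod_of_fibers (p := fun i d : ℤ => (bz (x + i) i • 𝒱.Yc (x + i) a)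
      (Yt 𝒱 (y - i - d) (q d)) ≠ 0) ?_ fun i => ?_
    · refine (Set.finite_Icc 0 (y - n₀ - d₀)).subset ?_
      rintro i ⟨d, h⟩
      have h1 : 0 ≤ i := by
        by_contra hc
        exact h (by rw [bz_neg (by omega), zero_smul, LinearMap.zero_apply])
      have h2 : n₀ < y - i - d := by
        by_contra hc
        exact h (by rw [hn₀ _ (by omega), map_zero])
      have h3 : d₀ < d := by
        by_contra hc
        exact h (by rw [hd₀ _ (by omega), map_zero, map_zero])
      exact ⟨h1, by omega⟩
    · refine (conv_Yt_finite (𝒱 := 𝒱) hq (y - i)).subset fun d hd h0 => hd ?_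
      rw [h0, map_zero]

theorem conv_weak_assoc (a : V) {q : ℤ → V ⊗[ℂ] V} (hq : IsTensorLaurent q) :
    ∃ k : ℕ, (addMul ^ k) (fun x y => ∑ᶠ i : ℤ, bz (x + i) i •
        𝒱.Yc (x + i) a (conv (Yt 𝒱) q (y - i)))
      = (addMul ^ k) fun x y => conv (Yt 𝒱) (fun d => LinearMap.rTensor V (𝒱.Yc x a) (q d)) y := by
  obtain ⟨F, hF, hqF⟩ := hq.2
  obtain ⟨k, hk⟩ := weak_assoc_uniform (𝒱 := 𝒱) a hF
  have hsum : ∀ Z : ℤ → ℤ → ℤ → V, (∀ x y : ℤ, {d | Z d x (y - d) ≠ 0}.Finite) →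
      (addMul ^ k) (fun x y => ∑ᶠ d, Z d x (y - d))
        = fun x y => ∑ᶠ d, (addMul ^ k) (Z d) x (y - d) := by
    intro Z hZ
    rw [addMul_pow_finsum hZ]
    funext x y
    refine finsum_congr fun d => ?_
    have := congr_fun (congr_fun (addMul_pow_shift 0 (-d) k (Z d)) x) y
    simpa only [add_zero, ← sub_eq_add_neg] using this
  refine ⟨k, ?_⟩
  simp only [← finsum_assocLeft a hq]
  rw [hsum]
  · simp only [hk _ (hqF _)]
    rw [← hsum]
    · rfl
    · exact fun x y => conv_Yt_finite (𝒱 := 𝒱) (tl_map hq _) y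
  · intro x y
    obtain ⟨n₀, hn₀⟩ := Filter.eventually_atBot.1 (tl_trunc (Φ := Yt 𝒱) hq (Yt_isLaurent 𝒱))
    refine finite_int_of_bounds ?_ ?_
    · filter_upwards [isLaurent_iff.1 hq.1] with d hd
      simp [hd]
    · filter_upwards [Filter.eventually_ge_atTop (y - n₀)] with d hd
      rw [not_not, assocLeft_apply]
      refine finsum_eq_zero_of_forall_eq_zero fun i => ?_
      rcases lt_or_ge i 0 with h | h
      · rw [bz_neg h, zero_smul]
      · rw [hn₀ _ (by omega), map_zero, smul_zero]

theorem finsum_Yc_twist (a : V) {F : ℤ → V} (hF : IsLaurent F) (x y : ℤ) :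
    ∑ᶠ i : ℤ, bz (x + i) i • 𝒱.Yc (x + i) a (twist 𝒱.D F (y - i))
      = conv (dz 𝒱.D) (fun d => (-1 : ℂ) ^ d • 𝒱.Yc x a (F d)) y := by
  have h := finsum_map_finsum (fun i => bz (x + i) i • 𝒱.Yc (x + i) a)
    (fun i d => dz 𝒱.D (y - i - d) ((-1 : ℂ) ^ d • F d))
    (fun i => conv_dz_finite _ (isLaurent_smul hF _) (y - i)) ?_
  · refine Eq.trans h ?_
    refine finsum_congr fun d => ?_
    beta_reduce
    rw [← map_smul, dz_leibniz (X := fun m => 𝒱.Yc m a) (D := 𝒱.D) (D' := 𝒱.D)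
      (fun m t => D_Y 𝒱 a t m)]
    refine finsum_congr fun i => ?_
    rw [sub_right_comm]
    rfl
  · obtain ⟨d₀, hd₀⟩ := Filter.eventually_atBot.1 (isLaurent_iff.1 hF)
    refine finite_prod_of_fibers (p := fun i d : ℤ => (bz (x + i) i • 𝒱.Yc (x + i) a)
      (dz 𝒱.D (y - i - d) ((-1 : ℂ) ^ d • F d)) ≠ 0) ?_ fun i => ?_
    · refine (Set.finite_Icc 0 (y - d₀)).subset ?_
      rintro i ⟨d, h⟩
      have h1 : 0 ≤ i := by
        by_contra hc
        exact h (by rw [bz_neg (by omega), zero_smul, LinearMap.zero_apply])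
      have h2 : 0 ≤ y - i - d := by
        by_contra hc
        exact h (by rw [dz_neg _ (by omega), LinearMap.zero_apply, map_zero])
      have h3 : d₀ < d := by
        by_contra hc
        exact h (by rw [hd₀ _ (by omega), smul_zero, map_zero, map_zero])
      exact ⟨h1, by omega⟩
    · refine (conv_dz_finite 𝒱.D (isLaurent_smul hF fun d => (-1 : ℂ) ^ d) (y - i)).subset
        fun d hd h0 => hd ?_
      rw [h0, map_zero]

end Associativity

section Triple

variable {V : Type*} [AddCommGroup V] [Module ℂ V]

/-- The map `x ⊗ z ↦ x ⊗ v ⊗ z`. -/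
def ins (v : V) : V ⊗[ℂ] V →ₗ[ℂ] (V ⊗[ℂ] V) ⊗[ℂ] V :=
  swap23 ∘ₗ (TensorProduct.mk ℂ (V ⊗[ℂ] V) V).flip v

@[simp] theorem ins_tmul (v x z : V) : ins v (x ⊗ₜ[ℂ] z) = (x ⊗ₜ v) ⊗ₜ z := rfl

variable (S : ℤ → V ⊗[ℂ] V →ₗ[ℂ] V ⊗[ℂ] V)

theorem S23m_tmul (p : ℤ) (u v w : V) : S23m S p ((u ⊗ₜ v) ⊗ₜ w)
    = (TensorProduct.assoc ℂ V V V).symm (u ⊗ₜ S p (v ⊗ₜ w)) := rfl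

theorem Yt1_assoc_symm (𝒱 : NLVA V) (n : ℤ) (u : V) (q : V ⊗[ℂ] V) :
    Yt1 𝒱 n ((TensorProduct.assoc ℂ V V V).symm (u ⊗ₜ q)) = LinearMap.rTensor V (𝒱.Yc n u) q := by
  induction q using TensorProduct.induction_on with
  | zero => simp
  | tmul x y => rfl
  | add x y hx hy => rw [TensorProduct.tmul_add, map_add, map_add, map_add, hx, hy]

variable {S} (hS : ∀ t, IsTensorLaurent fun n => S n t)

include hS

theorem S12m_isTensorLaurent (t : (V ⊗[ℂ] V) ⊗[ℂ] V) : IsTensorLaurent fun n => S12m S n t :=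
  tl_tensor (fun x y => tl_map (hS x) ((TensorProduct.mk ℂ (V ⊗[ℂ] V) V).flip y)) t

theorem S13m_isTensorLaurent (t : (V ⊗[ℂ] V) ⊗[ℂ] V) : IsTensorLaurent fun n => S13m S n t :=
  tl_map (S12m_isTensorLaurent hS _) swap23

theorem S23m_isTensorLaurent (t : (V ⊗[ℂ] V) ⊗[ℂ] V) : IsTensorLaurent fun n => S23m S n t :=
  tl_map (tl_tensor (Φ := fun n => LinearMap.lTensor V (S n))
    (fun x y => tl_map (hS y) (TensorProduct.mk ℂ V (V ⊗[ℂ] V) x))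
    (TensorProduct.assoc ℂ V V V t)) (TensorProduct.assoc ℂ V V V).symm.toLinearMap

end Triple

section Hexagon

variable {V : Type*} [AddCommGroup V] [Module ℂ V] (𝒱 : NLVA V)
  (S : ℤ → V ⊗[ℂ] V →ₗ[ℂ] V ⊗[ℂ] V)

/-- The triple series `(Y(z) ⊗ 1) S²³(x) S¹³(y) t` in `x, y, z`. -/
def hexTriple (t : (V ⊗[ℂ] V) ⊗[ℂ] V) (c p b : ℤ) : V ⊗[ℂ] V := Yt1 𝒱 b (S23m S c (S13m S p t))

/-- The coefficients of `Y(x₁)(Y(x₂) ⊗ 1)S²³(x₁)(s¹ ⊗ v ⊗ s²)`. -/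
def hexRight (v : V) (s : V ⊗[ℂ] V) (c b : ℤ) : V :=
  conv (Yt 𝒱) (fun d => Yt1 𝒱 b (S23m S d (ins v s))) c

/-- The coefficients of `e^{x₁ D}Y(s¹, x₂)Y(s², -x₁)v`. -/
def hexLeft (v : V) (s : V ⊗[ℂ] V) (c b : ℤ) : V :=
  conv (dz 𝒱.D) (fun d => (-1 : ℂ) ^ d • YY 𝒱 v d b s) c

variable {𝒱 S}

theorem isLaurent_YY (v : V) (b : ℤ) (s : V ⊗[ℂ] V) : IsLaurent fun d => YY 𝒱 v d b s := by
  refine isLaurent_tensor (fun x y => ?_) s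
  obtain ⟨N, hN⟩ := 𝒱.trunc y v
  exact ⟨N, fun n hn => by simp only [YY_tmul, hN n hn, Y_zero_right]⟩

variable (hS : ∀ t, IsTensorLaurent fun n => S n t)

theorem hexTriple_add (s t : (V ⊗[ℂ] V) ⊗[ℂ] V) : flip3 (hexTriple 𝒱 S (s + t))
    = fun c p b => flip3 (hexTriple 𝒱 S s) c p b + flip3 (hexTriple 𝒱 S t) c p b := by
  funext c p b
  simp only [flip3, hexTriple, map_add]

include hS

theorem hexTriple_good (t : (V ⊗[ℂ] V) ⊗[ℂ] V) : Good (flip3 (hexTriple 𝒱 S t)) :=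
  good_comp (S13m_isTensorLaurent hS t) (S23m_isTensorLaurent hS) Yt1_isLaurent

theorem hexTriple_fg (t : (V ⊗[ℂ] V) ⊗[ℂ] V) (c : ℤ) :
    ∃ F : Submodule ℂ (V ⊗[ℂ] V), F.FG ∧ ∀ p b, flip3 (hexTriple 𝒱 S t) c p b ∈ F := by
  obtain ⟨F, hF, h⟩ := (S13m_isTensorLaurent hS t).2
  obtain ⟨F', hF', h'⟩ := fg_range hF (S23m_isTensorLaurent hS)
  exact ⟨F'.map (Yt1 𝒱 c), hF'.map _, fun p b => Submodule.mem_map_of_mem (h' b _ (h p))⟩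

theorem hexTriple_trunc (t : (V ⊗[ℂ] V) ⊗[ℂ] V) :
    ∀ᶠ b in Filter.atBot, ∀ c p, flip3 (hexTriple 𝒱 S t) c p b = 0 := by
  filter_upwards [tl_trunc (S13m_isTensorLaurent hS t) fun t => (S23m_isTensorLaurent hS t).1]
    with b hb c p
  rw [flip3, hexTriple, hb, map_zero]

theorem sub12_hexTriple_isTensorLaurent (t : (V ⊗[ℂ] V) ⊗[ℂ] V) (n : ℤ) :
    IsTensorLaurent fun m => sub12 (hexTriple 𝒱 S t) m n :=
  tl_sub21 (hexTriple_good hS t) (hexTriple_trunc hS t) (hexTriple_fg hS t) n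

theorem hexRight_isLinear (v : V) : ∃ f : V ⊗[ℂ] V →ₗ[ℂ] ℤ → ℤ → V,
    ∀ s x y, f s x y = hexRight 𝒱 S v s y x :=
  ⟨LinearMap.pi fun x => LinearMap.pi fun y =>
    finsumLin (fun d => Yt 𝒱 (y - d) ∘ₗ Yt1 𝒱 x ∘ₗ S23m S d ∘ₗ ins v) fun _ =>
      conv_Yt_finite (𝒱 := 𝒱) (tl_map (S23m_isTensorLaurent hS _) (Yt1 𝒱 x)) y,
    fun _ _ _ => rfl⟩

omit hS in
theorem hexLeft_isLinear (v : V) : ∃ f : V ⊗[ℂ] V →ₗ[ℂ] ℤ → ℤ → V,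
    ∀ s x y, f s x y = hexLeft 𝒱 v s y x :=
  ⟨LinearMap.pi fun x => LinearMap.pi fun y =>
    finsumLin (fun d => dz 𝒱.D (y - d) ∘ₗ ((-1 : ℂ) ^ d • YY 𝒱 v d x)) fun s =>
      conv_dz_finite 𝒱.D (isLaurent_smul (isLaurent_YY v x s) fun d => (-1 : ℂ) ^ d) y,
    fun _ _ _ => rfl⟩

variable (hY : ∀ t n, conv (Yt 𝒱) (fun c => S c t) n
    = twist 𝒱.D (fun p => Yt 𝒱 p (TensorProduct.comm ℂ V V t)) n)

include hY

theorem exists_hexLeft_eq_hexRight (v : V) {F : Submodule ℂ (V ⊗[ℂ] V)} (hF : F.FG) :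
    ∃ k : ℕ, ∀ s ∈ F, (addMul ^ k) (hexLeft 𝒱 v s) = (addMul ^ k) (hexRight 𝒱 S v s) := by
  obtain ⟨f, hf⟩ := hexLeft_isLinear (𝒱 := 𝒱) v
  obtain ⟨g, hg⟩ := hexRight_isLinear (𝒱 := 𝒱) hS v
  obtain ⟨k, hk⟩ := exists_addMul_pow_uniform f g hF (TensorProduct.span_tmul_eq_top ℂ V V) (by
    rintro _ ⟨a, e, rfl⟩
    obtain ⟨k, hk⟩ := conv_weak_assoc (𝒱 := 𝒱) a (hS (v ⊗ₜ e))
    have e1 : f (a ⊗ₜ e) = fun x y => ∑ᶠ i : ℤ, bz (x + i) i •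
        𝒱.Yc (x + i) a (conv (Yt 𝒱) (fun n => S n (v ⊗ₜ e)) (y - i)) := by
      funext x y
      rw [hf]
      simp only [hY]
      rw [finsum_Yc_twist a (Yt_isLaurent 𝒱 _)]
      rfl
    have e2 : g (a ⊗ₜ e) = fun x y =>
        conv (Yt 𝒱) (fun d => LinearMap.rTensor V (𝒱.Yc x a) (S d (v ⊗ₜ e))) y := by
      funext x y
      rw [hg, hexRight]
      simp only [ins_tmul, S23m_tmul, Yt1_assoc_symm]
    exact ⟨k, by rw [e1, e2, hk]⟩)
  refine ⟨k, fun s hs => ?_⟩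
  have e1 : hexLeft 𝒱 v s = fun c b => f s b c := by
    funext c b
    rw [hf]
  have e2 : hexRight 𝒱 S v s = fun c b => g s b c := by
    funext c b
    rw [hg]
  rw [e1, e2, addMul_pow_swap k (f s), addMul_pow_swap k (g s), hk s hs]

variable (hE : ∀ t, IsExchange 𝒱 t fun n => S n t)

include hE

theorem conv_Yt_hexTriple (u v w : V) (m n : ℤ) :
    conv (Yt 𝒱) (fun d => sub12 (hexTriple 𝒱 S ((u ⊗ₜ v) ⊗ₜ w)) d n) m
      = twist 𝒱.D (fun p => 𝒱.Y w (𝒱.Y u v n) p) m := by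
  have hu := hS (u ⊗ₜ w)
  have hG := hexTriple_good (𝒱 := 𝒱) hS ((u ⊗ₜ v) ⊗ₜ w)
  have hΦ : ∀ c, ∀ᶠ n in Filter.atBot, ∀ p b,
      Yt 𝒱 n (flip3 (hexTriple 𝒱 S ((u ⊗ₜ v) ⊗ₜ w)) c p b) = 0 := by
    intro c
    obtain ⟨F, hF, h⟩ := hexTriple_fg (𝒱 := 𝒱) hS ((u ⊗ₜ v) ⊗ₜ w) c
    filter_upwards [fg_trunc hF (Yt_isLaurent 𝒱)] with n hn p b using hn _ (h p b)
  let G₁ : ℤ → ℤ → ℤ → V := fun c p b => hexRight 𝒱 S v (S p (u ⊗ₜ w)) c b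
  let G₂ := exch 𝒱 v fun p => S p (u ⊗ₜ w)
  let G₃ : ℤ → ℤ → ℤ → V := fun c p b => hexLeft 𝒱 v (S p (u ⊗ₜ w)) c b
  let R : ℤ → ℤ → V := fun m n => twist 𝒱.D (fun p => 𝒱.Y w (𝒱.Y u v n) p) m
  have hG₁ : Good (flip3 G₁) := hG.conv_right hΦ
  have hG₂ : Good G₂ := exch_good 𝒱 hu v
  have hdz : ∀ n < 0, dz 𝒱.D n = 0 := fun n hn => dz_neg 𝒱.D hn
  have hG₃ : Good G₃ := hG₂.conv_left hdz
  suffices h : R = sub12 G₁ by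
    rw [show twist 𝒱.D (fun p => 𝒱.Y w (𝒱.Y u v n) p) m = R m n from rfl, h]
    exact conv_sub21_right hG hΦ n m
  obtain ⟨F, hF, hSF⟩ := hu.2
  obtain ⟨k₁, hk₁⟩ := exists_hexLeft_eq_hexRight hS hY v hF
  obtain ⟨k₂, hk₂⟩ := exists_sub21_eq_sub12 hG₃ hG₁ k₁ (by
    funext c p b
    exact congr_fun (congr_fun (hk₁ _ (hSF p)) c) b)
  obtain ⟨k₃, hk₃⟩ := hE (u ⊗ₜ w)
  have e : (addMul ^ k₃) R = (addMul ^ k₃) (sub21 G₃) := by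
    have h1 := addMul_pow_conv_left (Φ := dz 𝒱.D) hdz
      (A := fun m n => (-1 : ℂ) ^ m • 𝒱.Y w (𝒱.Y u v n) m)
      (fun n => isLaurent_smul (𝒱.trunc w (𝒱.Y u v n)) fun m => (-1 : ℂ) ^ m) k₃
    have h2 := addMul_pow_conv_left (Φ := dz 𝒱.D) hdz (A := sub21 G₂)
      (fun n => isLaurent_iff.2 ((sub21_trunc_left hG₂).mono fun m hm => hm n)) k₃
    have h3 : (fun m n => conv (dz 𝒱.D) (fun d => sub21 G₂ d n) m) = sub21 G₃ := by
      funext m n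
      refine conv_sub21_left hG₂ ?_ m n
      filter_upwards [Filter.eventually_lt_atBot 0] with j hj c p b
      rw [hdz j hj, LinearMap.zero_apply]
    rw [← h3, h2, ← hk₃ v]
    exact h1
  refine addMul_pow_cancel (k := max k₂ k₃) ?_ (sub21_trunc_left hG₁)
    ((addMul_pow_congr (le_max_right _ _) e).trans (addMul_pow_congr (le_max_left _ _) hk₂))
  obtain ⟨N, hN⟩ := 𝒱.trunc u v
  filter_upwards [Filter.eventually_lt_atBot N] with n hn m
  refine finsum_eq_zero_of_forall_eq_zero fun c => ?_
  simp only [hN n hn, Y_zero_right, smul_zero, map_zero]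

variable (hnd : 𝒱.NonDegenerate)

include hnd

theorem S_Yt1 (t : (V ⊗[ℂ] V) ⊗[ℂ] V) (m n : ℤ) :
    S m (Yt1 𝒱 n t) = sub12 (hexTriple 𝒱 S t) m n := by
  have hadd : ∀ s t : (V ⊗[ℂ] V) ⊗[ℂ] V, sub12 (hexTriple 𝒱 S (s + t)) m n
      = sub12 (hexTriple 𝒱 S s) m n + sub12 (hexTriple 𝒱 S t) m n := fun s t => by
    simp only [sub12, hexTriple_add]
    exact sub21_add (hexTriple_good hS s) (hexTriple_good hS t) n m
  induction t using TensorProduct.induction_on with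
  | zero =>
    rw [map_zero, map_zero]
    refine (finsum_eq_zero_of_forall_eq_zero fun x => ?_).symm
    simp only [flip3, hexTriple, map_zero, smul_zero]
  | tmul s w =>
    induction s using TensorProduct.induction_on with
    | zero =>
      rw [TensorProduct.zero_tmul, map_zero, map_zero]
      refine (finsum_eq_zero_of_forall_eq_zero fun x => ?_).symm
      simp only [flip3, hexTriple, map_zero, smul_zero]
    | tmul u v =>
      exact (eq_S_of_conv_Yt hnd hS hY (sub12_hexTriple_isTensorLaurent hS _ n) _
        (fun m => conv_Yt_hexTriple hS hY hE u v w m n) m).symm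
    | add s t hs ht => rw [TensorProduct.add_tmul, hadd, map_add, map_add, hs, ht]
  | add s t hs ht => rw [hadd, map_add, map_add, hs, ht]

theorem S_hexY1 : HexY1 𝒱 S := fun t m n =>
  (S_Yt1 hS hY hE hnd t m n).trans (sub12_eq_iterated (hexTriple_good hS t) m n)

end Hexagon

section Series

variable {M N L : Type*} [AddCommGroup M] [Module ℂ M] [AddCommGroup N] [Module ℂ N]
  [AddCommGroup L] [Module ℂ L]

theorem sub21_finsum {Z : ℤ → ℤ → ℤ → ℤ → M}
    (he : ∀ᶠ e in Filter.atBot, ∀ c p b, Z e c p b = 0)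
    (hc : ∀ᶠ c in Filter.atBot, ∀ e p b, Z e c p b = 0)
    (hp : ∀ᶠ p in Filter.atBot, ∀ e c b, Z e c p b = 0)
    (hb : ∀ᶠ b in Filter.atBot, ∀ e c p, Z e c p b = 0) (m n : ℤ) :
    sub21 (fun c p b => ∑ᶠ e, Z e (c - e) p b) m n = ∑ᶠ e, sub21 (Z e) (m - e) n := by
  obtain ⟨e₀, he⟩ := Filter.eventually_atBot.1 he
  obtain ⟨c₀, hc⟩ := Filter.eventually_atBot.1 hc
  obtain ⟨p₀, hp⟩ := Filter.eventually_atBot.1 hp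
  obtain ⟨b₀, hb⟩ := Filter.eventually_atBot.1 hb
  unfold sub21
  simp only [smul_finsum]
  rw [finsum_comm' (f := fun (x : ℤ × ℤ) e => bz (m + n - x.1 - x.2) (m - x.1) •
    Z e (x.1 - e) (m + n - x.1 - x.2) x.2)]
  · refine finsum_congr fun e => ?_
    rw [← finsum_comp_equiv ((Equiv.addRight e).prodCongr (Equiv.refl ℤ))]
    refine finsum_congr fun x => ?_
    simp only [Equiv.prodCongr_apply, Prod.map_fst, Prod.map_snd, Equiv.coe_addRight,
      Equiv.refl_apply, add_sub_cancel_right]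
    rw [show m + n - (x.1 + e) - x.2 = m - e + n - x.1 - x.2 by ring,
      show m - (x.1 + e) = m - e - x.1 by ring]
  · refine (((Set.finite_Icc (c₀ + e₀) m).prod (Set.finite_Icc b₀ (m + n - c₀ - e₀ - p₀))).prod
      (Set.finite_Icc e₀ (m - c₀))).subset ?_
    rintro ⟨⟨c, b⟩, e⟩ h
    simp only [Set.mem_ofPred_eq, ne_eq, smul_eq_zero, not_or] at h
    obtain ⟨h, h'⟩ := h
    have h1 : c ≤ m := bz_ne_zero h
    have h2 : e₀ < e := by
      by_contra hx
      exact h' (he _ (by omega) _ _ _)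
    have h3 : c₀ < c - e := by
      by_contra hx
      exact h' (hc _ (by omega) _ _ _)
    have h4 : p₀ < m + n - c - b := by
      by_contra hx
      exact h' (hp _ (by omega) _ _ _)
    have h5 : b₀ < b := by
      by_contra hx
      exact h' (hb _ (by omega) _ _ _)
    simp only [Set.mem_prod, Set.mem_Icc]
    omega

theorem map_twist_leibniz {X : ℤ → M →ₗ[ℂ] N} {D : M →ₗ[ℂ] M} {D' : N →ₗ[ℂ] N}
    (h : ∀ m t, X m (D t) = D' (X m t) + ((m : ℂ) + 1) • X (m + 1) t) {F : ℤ → M}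
    (hF : IsLaurent F) (m n : ℤ) :
    X m (twist D F n) = conv (dz D') (fun k => ∑ᶠ j : ℤ, (bz (m + j) j * (-1) ^ (k - j)) •
      X (m + j) (F (k - j))) n := by
  obtain ⟨N, hN⟩ := hF
  have e : ∀ c : ℤ, X m (dz D (n - c) ((-1 : ℂ) ^ c • F c)) = ∑ᶠ k : ℤ,
      dz D' (n - k) ((bz (m + (k - c)) (k - c) * (-1) ^ c) • X (m + (k - c)) (F c)) := by
    intro c
    rw [dz_map_leibniz h, ← finsum_shift (-c)]
    refine finsum_congr fun k => ?_
    rw [← sub_eq_add_neg, sub_sub_sub_cancel_right, map_smul, map_smul, map_smul, smul_smul]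
  unfold twist conv
  rw [map_finsum (X m) (conv_dz_finite D (isLaurent_smul ⟨N, hN⟩ fun p => (-1 : ℂ) ^ p) n)]
  simp only [e]
  rw [finsum_comm']
  · refine finsum_congr fun k => ?_
    rw [map_finsum]
    · rw [← finsum_reflect k]
      refine finsum_congr fun j => ?_
      rw [sub_sub_cancel]
    · refine finite_int_of_bounds ?_ ?_
      · filter_upwards [Filter.eventually_lt_atBot 0] with j hj
        simp [bz_neg hj]
      · filter_upwards [Filter.eventually_gt_atTop (k - N)] with j hj
        rw [hN _ (by omega), map_zero, smul_zero, not_not]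
  · refine ((Set.finite_Icc N n).prod (Set.finite_Icc N n)).subset ?_
    rintro ⟨c, k⟩ h'
    have h1 : N ≤ c := by
      by_contra hx
      exact h' (by rw [hN _ (by omega), map_zero, smul_zero, map_zero])
    have h2 : c ≤ k := by
      by_contra hx
      exact h' (by rw [bz_neg (by omega), zero_mul, zero_smul, map_zero])
    have h3 : k ≤ n := by
      by_contra hx
      exact h' (by rw [dz_neg _ (by omega), LinearMap.zero_apply])
    simp only [Set.mem_prod, Set.mem_Icc]
    omega

theorem map_dz {D : M →ₗ[ℂ] M} {D' : N →ₗ[ℂ] N} {f : M →ₗ[ℂ] N} (h : ∀ x, f (D x) = D' (f x))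
    (r : ℤ) (x : M) : f (dz D r x) = dz D' r (f x) := by
  rcases lt_or_ge r 0 with hr | hr
  · rw [dz_neg _ hr, dz_neg _ hr, LinearMap.zero_apply, LinearMap.zero_apply, map_zero]
  · lift r to ℕ using hr
    have hp : ∀ x, f ((D ^ r) x) = (D' ^ r) (f x) := by
      induction r with
      | zero => exact fun _ => rfl
      | succ r ih => exact fun x => by rw [pow_succ', pow_succ', Module.End.mul_apply, h, ih]; rfl
    rw [dz_natCast, dz_natCast, LinearMap.smul_apply, LinearMap.smul_apply, map_smul, hp]

theorem map_twist {D : M →ₗ[ℂ] M} {D' : N →ₗ[ℂ] N} {f : M →ₗ[ℂ] N}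
    (h : ∀ x, f (D x) = D' (f x)) {F : ℤ → M} (hF : IsLaurent F) (n : ℤ) :
    f (twist D F n) = twist D' (fun p => f (F p)) n := by
  unfold twist conv
  rw [map_finsum f (conv_dz_finite D (isLaurent_smul hF fun p => (-1 : ℂ) ^ p) n)]
  refine finsum_congr fun c => ?_
  rw [map_dz h, map_smul]

theorem twist_add (D : M →ₗ[ℂ] M) {F G : ℤ → M} (hF : IsLaurent F) (hG : IsLaurent G) (n : ℤ) :
    twist D (fun p => F p + G p) n = twist D F n + twist D G n := by
  unfold twist
  rw [← conv_add (conv_dz_finite D (isLaurent_smul hF _) n)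
    (conv_dz_finite D (isLaurent_smul hG _) n)]
  simp only [smul_add]

/-- Elements of `M ⊗ ℂ((x)) ⊗ ℂ((y)) ⊗ ℂ((z))`. -/
structure TripleLaurent (G : ℤ → ℤ → ℤ → M) : Prop where
  fst : ∀ᶠ c in Filter.atBot, ∀ p b, G c p b = 0
  mid : ∀ᶠ p in Filter.atBot, ∀ c b, G c p b = 0
  lst : ∀ᶠ b in Filter.atBot, ∀ c p, G c p b = 0
  fg : ∃ F : Submodule ℂ M, F.FG ∧ ∀ c p b, G c p b ∈ F

namespace TripleLaurent

variable {G : ℤ → ℤ → ℤ → M}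

theorem good (hG : TripleLaurent G) : Good G :=
  ⟨hG.fst, hG.mid, fun c => hG.lst.mono fun _ h p => h c p⟩

theorem flip (hG : TripleLaurent G) : TripleLaurent (flip3 G) where
  fst := hG.lst.mono fun _ h p c => h c p
  mid := hG.mid.mono fun _ h b c => h c b
  lst := hG.fst.mono fun _ h b p => h p b
  fg := hG.fg.imp fun _ h => ⟨h.1, fun b p c => h.2 c p b⟩

theorem comp {Φ Ψ Θ : ℤ → M →ₗ[ℂ] M} (hΦ : ∀ t, IsTensorLaurent fun n => Φ n t)
    (hΨ : ∀ t, IsTensorLaurent fun n => Ψ n t) (hΘ : ∀ t, IsTensorLaurent fun n => Θ n t) (t : M) :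
    TripleLaurent fun c p b => Φ c (Ψ p (Θ b t)) := by
  obtain ⟨F, hF, h⟩ := (hΘ t).2
  obtain ⟨F', hF', h'⟩ := fg_range hF hΨ
  obtain ⟨F'', hF'', h''⟩ := fg_range hF' hΦ
  refine ⟨?_, ?_, ?_, F'', hF'', fun c p b => h'' _ _ (h' _ _ (h _))⟩
  · filter_upwards [fg_trunc hF' fun t => (hΦ t).1] with c hc p b using hc _ (h' _ _ (h _))
  · filter_upwards [fg_trunc hF fun t => (hΨ t).1] with p hp c b
    rw [hp _ (h _), map_zero]
  · filter_upwards [isLaurent_iff.1 (hΘ t).1] with b hb c p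
    rw [hb, map_zero, map_zero]

theorem sub21_left (hG : TripleLaurent G) (n : ℤ) : IsTensorLaurent fun m => sub21 G m n :=
  ⟨isLaurent_iff.2 ((sub21_trunc_left hG.good).mono fun _ h => h n),
    hG.fg.imp fun F h => ⟨h.1, fun _ => finsum_mem_of_forall fun _ => F.smul_mem _ (h.2 _ _ _)⟩⟩

theorem trunc (hG : TripleLaurent G) {Φ : ℤ → M →ₗ[ℂ] N} (hΦ : ∀ t, IsLaurent fun n => Φ n t) :
    ∀ᶠ n in Filter.atBot, ∀ c p b, Φ n (G c p b) = 0 := by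
  obtain ⟨F, hF, h⟩ := hG.fg
  filter_upwards [fg_trunc hF hΦ] with n hn c p b using hn _ (h _ _ _)

theorem sub21_eq_of_sub12_eq {G' : ℤ → ℤ → ℤ → M} (hG : TripleLaurent G)
    (hG' : TripleLaurent G') (h : sub12 G = sub12 G') : sub21 G = sub21 G' := by
  obtain ⟨j, hj⟩ := exists_sub21_eq_sub12 hG.good hG.flip.good 0 rfl
  obtain ⟨k, hk⟩ := exists_sub21_eq_sub12 hG'.good hG'.flip.good 0 rfl
  refine addMul_pow_cancel_left (k := max j k) (sub21_trunc_left hG.good)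
    (sub21_trunc_left hG'.good) ?_
  rw [addMul_pow_congr (le_max_left j k) hj, h, addMul_pow_congr (le_max_right j k) hk]

end TripleLaurent

end Series

section YangBaxter

variable {V : Type*} [AddCommGroup V] [Module ℂ V] {𝒱 : NLVA V}
  {S : ℤ → V ⊗[ℂ] V →ₗ[ℂ] V ⊗[ℂ] V}

variable (V) in
/-- The flip of the first two factors of `V ⊗ V ⊗ V`. -/
def swap12 : (V ⊗[ℂ] V) ⊗[ℂ] V →ₗ[ℂ] (V ⊗[ℂ] V) ⊗[ℂ] V :=
  LinearMap.rTensor V (TensorProduct.comm ℂ V V).toLinearMap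

theorem swap12_ins (v : V) (q : V ⊗[ℂ] V) :
    swap12 V (ins v q) = (TensorProduct.assoc ℂ V V V).symm (v ⊗ₜ q) := by
  induction q using TensorProduct.induction_on with
  | zero => simp
  | tmul x y => rfl
  | add x y hx hy => rw [TensorProduct.tmul_add, map_add, map_add, map_add, hx, hy]

theorem swap12_assoc_symm (v : V) (q : V ⊗[ℂ] V) :
    swap12 V ((TensorProduct.assoc ℂ V V V).symm (v ⊗ₜ q)) = ins v q := by
  rw [← swap12_ins]
  induction q using TensorProduct.induction_on with
  | zero => simp
  | tmul x y => rfl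
  | add x y hx hy => rw [map_add, map_add, map_add, hx, hy]

theorem swap12_S13m (p : ℤ) (t : (V ⊗[ℂ] V) ⊗[ℂ] V) :
    swap12 V (S13m S p t) = S23m S p (swap12 V t) := by
  refine LinearMap.congr_fun (f := swap12 V ∘ₗ S13m S p) (g := S23m S p ∘ₗ swap12 V) ?_ t
  refine TensorProduct.ext_threefold fun u v w => ?_
  exact swap12_ins v (S p (u ⊗ₜ w))

theorem swap12_S23m (p : ℤ) (t : (V ⊗[ℂ] V) ⊗[ℂ] V) :
    swap12 V (S23m S p t) = S13m S p (swap12 V t) := by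
  refine LinearMap.congr_fun (f := swap12 V ∘ₗ S23m S p) (g := S13m S p ∘ₗ swap12 V) ?_ t
  refine TensorProduct.ext_threefold fun u v w => ?_
  exact swap12_assoc_symm u (S p (v ⊗ₜ w))

variable (hS : ∀ t, IsTensorLaurent fun n => S n t)
  (hY : ∀ t n, conv (Yt 𝒱) (fun c => S c t) n
    = twist 𝒱.D (fun p => Yt 𝒱 p (TensorProduct.comm ℂ V V t)) n)

include hS hY

theorem conv_Yt1_S12m (t : (V ⊗[ℂ] V) ⊗[ℂ] V) (n : ℤ) : conv (Yt1 𝒱) (fun c => S12m S c t) n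
    = twist (LinearMap.rTensor V 𝒱.D) (fun p => Yt1 𝒱 p (swap12 V t)) n := by
  have hfin : ∀ t, {c | Yt1 𝒱 (n - c) (S12m S c t) ≠ 0}.Finite := fun t =>
    conv_finite (tl_trunc (S12m_isTensorLaurent hS t) Yt1_isLaurent)
      (S12m_isTensorLaurent hS t).1 n
  induction t using TensorProduct.induction_on with
  | zero => simp [conv, twist]
  | tmul s w =>
    let f := (TensorProduct.mk ℂ V V).flip w
    have h1 : f (conv (Yt 𝒱) (fun c => S c s) n) = conv (Yt1 𝒱) (fun c => S12m S c (s ⊗ₜ w)) n :=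
      map_finsum f (conv_Yt_finite (𝒱 := 𝒱) (hS s) n)
    rw [← h1, hY]
    exact map_twist (D' := LinearMap.rTensor V 𝒱.D) (f := f) (fun _ => rfl) (Yt_isLaurent 𝒱 _) n
  | add s t hs ht =>
    simp only [map_add]
    rw [conv_add (hfin s) (hfin t), hs, ht, ← twist_add _ (Yt1_isLaurent _) (Yt1_isLaurent _)]

variable (hE : ∀ t, IsExchange 𝒱 t fun n => S n t) (hnd : 𝒱.NonDegenerate)

include hE hnd

theorem conv_Yt1_S23m_S13m_S12m (t : (V ⊗[ℂ] V) ⊗[ℂ] V) (m n : ℤ) :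
    conv (Yt1 𝒱) (fun d => sub12 (fun c p b => S23m S c (S13m S p (S12m S b t))) m d) n
      = S m (conv (Yt1 𝒱) (fun c => S12m S c t) n) := by
  have h12 := S12m_isTensorLaurent hS t
  have hG := TripleLaurent.comp (S23m_isTensorLaurent hS) (S13m_isTensorLaurent hS)
    (S12m_isTensorLaurent hS) t
  have h1 : S m (conv (Yt1 𝒱) (fun c => S12m S c t) n)
      = ∑ᶠ c, S m (Yt1 𝒱 (n - c) (S12m S c t)) :=
    map_finsum (S m) (conv_finite (tl_trunc h12 Yt1_isLaurent) h12.1 n)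
  simp only [S_Yt1 hS hY hE hnd] at h1
  refine (conv_sub21_left hG.flip.good (hG.flip.trunc Yt1_isLaurent) n m).trans
    (Eq.trans (sub21_finsum (Z := fun e => flip3 (hexTriple 𝒱 S (S12m S e t)))
      ?_ ?_ ?_ ?_ n m) h1.symm)
  · exact hG.lst.mono fun e h c p b => by simp only [flip3, hexTriple, h, map_zero]
  · exact (hG.trunc Yt1_isLaurent).mono fun c h e p b => h b p e
  · exact hG.mid.mono fun p h e c b => by simp only [flip3, hexTriple, h, map_zero]
  · exact hG.fst.mono fun b h e c p => by simp only [flip3, hexTriple, h, map_zero]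

theorem conv_Yt1_S12m_S13m_S23m (t : (V ⊗[ℂ] V) ⊗[ℂ] V) (m n : ℤ) :
    conv (Yt1 𝒱) (fun d => sub12 (fun c p b => S12m S b (S13m S p (S23m S c t))) m d) n
      = S m (conv (Yt1 𝒱) (fun c => S12m S c t) n) := by
  have hG := TripleLaurent.comp (S12m_isTensorLaurent hS) (S13m_isTensorLaurent hS)
    (S23m_isTensorLaurent hS) t
  have hH := hexTriple_good (𝒱 := 𝒱) hS (swap12 V t)
  let G₁ : ℤ → ℤ → ℤ → V ⊗[ℂ] V := fun c p b =>
    (-1 : ℂ) ^ c • flip3 (hexTriple 𝒱 S (swap12 V t)) c b p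
  have hG₁ : Good G₁ := by
    refine ⟨?_, ?_, fun c => ?_⟩
    · filter_upwards [hH.fst] with c hc p b
      simp only [G₁, hc, smul_zero]
    · filter_upwards [hexTriple_trunc (𝒱 := 𝒱) hS (swap12 V t)] with p hp c b
      simp only [G₁, hp, smul_zero]
    · filter_upwards [hH.mid] with b hb p
      simp only [G₁, hb, smul_zero]
  have hsum : ∀ k, sub21 G₁ k m = ∑ᶠ j : ℤ, (bz (m + j) j * (-1) ^ (k - j)) •
      S (m + j) (Yt1 𝒱 (k - j) (swap12 V t)) := by
    intro k
    simp only [S_Yt1 hS hY hE hnd]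
    refine Eq.trans ?_ (finsum_sub21_shift hH m k).symm
    let e : ℤ × ℤ ≃ ℤ × ℤ :=
      { toFun := fun x => (x.1, m + k - x.1 - x.2)
        invFun := fun x => (x.1, m + k - x.1 - x.2)
        left_inv := fun x => by simp
        right_inv := fun x => by simp }
    rw [sub21, ← finsum_comp_equiv e]
    refine finsum_congr fun x => ?_
    simp only [e, Equiv.coe_fn_mk, G₁, smul_smul]
    rw [add_comm k m, sub_sub_cancel, mul_comm]
  have hL : conv (Yt1 𝒱)
      (fun d => sub12 (fun c p b => S12m S b (S13m S p (S23m S c t))) m d) n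
      = sub21 (fun c p b => conv (dz (LinearMap.rTensor V 𝒱.D)) (fun d => G₁ d p b) c) n m := by
    refine (conv_sub21_left hG.good (hG.trunc Yt1_isLaurent) n m).trans ?_
    simp only [conv_Yt1_S12m hS hY, swap12_S13m, swap12_S23m]
    rfl
  rw [hL, ← conv_sub21_left hG₁, conv_Yt1_S12m hS hY,
    map_twist_leibniz (X := S) (fun m t => S_rTensor_D hnd hS hY t m) (Yt1_isLaurent _)]
  · simp only [hsum]
  · filter_upwards [Filter.eventually_lt_atBot 0] with j hj c p b
    rw [dz_neg _ hj, LinearMap.zero_apply]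

theorem S_sub21_eq (t : (V ⊗[ℂ] V) ⊗[ℂ] V) :
    sub21 (fun c p b => S23m S c (S13m S p (S12m S b t)))
      = sub21 (fun c p b => S12m S b (S13m S p (S23m S c t))) := by
  have hG₁ := TripleLaurent.comp (S23m_isTensorLaurent hS) (S13m_isTensorLaurent hS)
    (S12m_isTensorLaurent hS) t
  have hG₂ := (TripleLaurent.comp (S12m_isTensorLaurent hS) (S13m_isTensorLaurent hS)
    (S23m_isTensorLaurent hS) t).flip
  refine hG₁.sub21_eq_of_sub12_eq hG₂ ?_
  funext m n
  have h₁ := hG₁.flip.sub21_left m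
  have h₂ := hG₂.flip.sub21_left m
  rw [← sub_eq_zero]
  refine eq_zero_of_conv_Yt1 hnd (tl_sub h₁ h₂) (fun n => ?_) n
  rw [conv_sub (conv_finite (tl_trunc h₁ Yt1_isLaurent) h₁.1 n)
    (conv_finite (tl_trunc h₂ Yt1_isLaurent) h₂.1 n), sub_eq_zero]
  exact (conv_Yt1_S23m_S13m_S12m hS hY hE hnd t m n).trans
    (conv_Yt1_S12m_S13m_S23m hS hY hE hnd t m n).symm

theorem S_qybe : QYBE S := by
  intro t a b
  have hG₁ := TripleLaurent.comp (S23m_isTensorLaurent hS) (S13m_isTensorLaurent hS)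
    (S12m_isTensorLaurent hS) t
  have hG₂ := (TripleLaurent.comp (S12m_isTensorLaurent hS) (S13m_isTensorLaurent hS)
    (S23m_isTensorLaurent hS) t).flip
  have h := congr_fun (congr_fun (S_sub21_eq hS hY hE hnd t) b) a
  exact (sub21_eq_iterated hG₂.good b a).symm.trans
    (h.symm.trans (sub21_eq_iterated hG₁.good b a))

end YangBaxter

end QuantumVertex

open QuantumVertex in
/-- A non-degenerate weak quantum vertex algebra carries a unique
quantum Yang–Baxter operator `𝒮` realizing skew symmetry, making it a quantum
vertex algebra, and `[1⊗D, 𝒮(x)] = (d/dx)𝒮(x)` (Proposition 3.8). -/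
theorem statement_13 {V : Type*} [AddCommGroup V] [Module ℂ V]
    (𝒱 : NLVA V) (hs : SLocal 𝒱) (hnd : 𝒱.NonDegenerate) :
    ∃ Sc : ℤ → (V ⊗[ℂ] V →ₗ[ℂ] V ⊗[ℂ] V),
      (∀ t : V ⊗[ℂ] V, IsTensorLaurent fun n => Sc n t) ∧ SkewS 𝒱 Sc ∧
      (∀ Sc' : ℤ → (V ⊗[ℂ] V →ₗ[ℂ] V ⊗[ℂ] V),
        (∀ t : V ⊗[ℂ] V, IsTensorLaurent fun n => Sc' n t) → SkewS 𝒱 Sc' →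
        Sc' = Sc) ∧
      (∃ Q : QVA V, Q.alg = 𝒱 ∧ Q.Sc = Sc) ∧
      (∀ (t : V ⊗[ℂ] V) (n : ℤ),
        (LinearMap.lTensor V 𝒱.D) (Sc n t) - Sc n ((LinearMap.lTensor V 𝒱.D) t)
          = ((n : ℂ) + 1) • Sc (n + 1) t) := by
  obtain ⟨S, h⟩ := exists_exchange hs
  have hS := fun t => (h t).1
  have hE := fun t => (h t).2
  have hY := fun t n => conv_Yt_of_isExchange (hS t) (hE t) n
  have hskew := (skewS_iff hS).2 hY
  have hD : DComm1 𝒱 S := fun t n => by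
    rw [S_rTensor_D hnd hS hY t n, sub_add_cancel_left, neg_smul]
  refine ⟨S, hS, hskew, fun S' hS' h' => ?_, ⟨⟨𝒱, hs, S, hS, S_qybe hS hY hE hnd,
    fun t n => S_unitary hnd hS hY n t, S_vacuum hnd hS hY, hD, hskew, S_hexY1 hS hY hE hnd⟩,
    rfl, rfl⟩, fun t n => by rw [S_lTensor_D hnd hS hY t n, sub_sub_cancel]⟩
  funext n
  exact LinearMap.ext fun t =>
    eq_S_of_conv_Yt hnd hS hY (hS' t) t ((skewS_iff hS').1 h' t) n
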